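/- arXiv:math/0407234 — 3 statements merged into one kernel-verified Lean document; each statement's English description precedes it below -/
import Mathlib

section
/- There exists a constant c > 0 such that for all positive integers n and k satisfying k ≤ c·n^{1/4} and for every k-dimensional real normed space W, there exists a symmetric convex body K ⊂ ℝⁿ such that for every orthogonal map u ∈ O(n), the normed space (ℝⁿ, ‖·‖_{K+u(K)}) whose unit ball is the Minkowski sum K + u(K) contains a subspace which is 3-complemented and 3-isomorphic to W. -/
open scoped Pointwise

/-- With respect to the norm on `ℝⁿ` whose unit ball is the symmetric convex body `B`
(i.e. the Minkowski functional `gauge B`), the subspace `E` is `C`-isomorphic to `W`: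
there is a linear bijection `T : W → E` with `‖T‖ ⬝ ‖T⁻¹‖ ≤ C`. -/
def GaugeIsomorphicTo (C : ℝ) (W : Type*) [SeminormedAddCommGroup W] [NormedSpace ℝ W]
    {n : ℕ} (B : Set (EuclideanSpace ℝ (Fin n)))
    (E : Submodule ℝ (EuclideanSpace ℝ (Fin n))) : Prop :=
  ∃ (T : W ≃ₗ[ℝ] E) (r : ℝ), 0 < r ∧
    ∀ w : W, r * ‖w‖ ≤ gauge B (T w : EuclideanSpace ℝ (Fin n)) ∧
      gauge B (T w : EuclideanSpace ℝ (Fin n)) ≤ C * (r * ‖w‖)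

/-- With respect to the norm on `ℝⁿ` whose unit ball is `B`, the subspace `E` is
`C`-complemented: there is a linear projection `P` with range `E` and `‖P‖ ≤ C`. -/
def GaugeComplementedIn (C : ℝ) {n : ℕ} (B : Set (EuclideanSpace ℝ (Fin n)))
    (E : Submodule ℝ (EuclideanSpace ℝ (Fin n))) : Prop :=
  ∃ P : EuclideanSpace ℝ (Fin n) →ₗ[ℝ] EuclideanSpace ℝ (Fin n),
    P ∘ₗ P = P ∧ LinearMap.range P = E ∧ ∀ x, gauge B (P x) ≤ C * gauge B x

/-- For `ρ > k`, a small stretch in one direction gains more in determinant than it costs after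
rescaling in dimension `k`. -/
theorem exists_stretch (k : ℕ) {ρ : ℝ} (hρ : (k : ℝ) < ρ) (hk : 0 < k) :
    ∃ μ : ℝ, 0 < μ ∧ (1 + 2 * μ + μ ^ 2 * ρ) ^ k < (1 + μ * ρ) ^ 2 := by
  have hk1 : (1 : ℝ) ≤ k := by exact_mod_cast hk
  set μ := (ρ - k) / (10 * k * ρ ^ 2) with hμ
  have hρ1 : 1 < ρ := by linarith
  have hμ0 : 0 < μ := div_pos (by linarith) (by positivity)
  have hμk : μ * (10 * k * ρ ^ 2) = ρ - k := by rw [hμ]; field_simp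
  refine ⟨μ, hμ0, ?_⟩
  set x := 2 * μ + μ ^ 2 * ρ with hx
  have hx0 : 0 < x := by positivity
  have hb : 1 - k * x ≤ ((1 + x) ^ k)⁻¹ := by
    have h1 : (1 + x)⁻¹ = 1 + -(x / (1 + x)) := by field_simp; ring
    rw [← inv_pow, h1]
    have h2 := one_add_mul_le_pow (a := -(x / (1 + x))) (by
      have : x / (1 + x) ≤ 1 := (div_le_one (by linarith)).2 (by linarith)
      linarith) k
    have h3 : x / (1 + x) ≤ x := div_le_self hx0.le (by linarith)
    nlinarith
  have hpos : 0 < (1 + x) ^ k := by positivity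
  have hmain : 1 < (1 + μ * ρ) ^ 2 * (1 - k * x) := by
    have hkμ : k * μ * ρ ≤ 1 / 10 := by nlinarith
    have hd : 0 < ρ - k := by linarith
    have e1 : k * μ * ρ ^ 2 = (ρ - k) / 10 := by linarith
    have hμk0 : 0 < μ * k := by positivity
    have h5 : k * μ * ρ ≤ (ρ - k) / 10 := by rw [← e1]; nlinarith
    have hkx : k * x ≤ 1 := by
      have : k * x = 2 * (k * μ) + k * μ * ρ * μ := by rw [hx]; ring
      have : k * μ ≤ k * μ * ρ := le_mul_of_one_le_right (by positivity) hρ1.le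
      have : μ ≤ k * μ * ρ := by nlinarith
      nlinarith
    have h6 : 1 < (1 + 2 * μ * ρ) * (1 - k * x) := by
      have : (1 + 2 * μ * ρ) * (1 - k * x) =
        1 + μ * (2 * (ρ - k) - 5 * (k * μ * ρ) - 2 * (k * μ * ρ ^ 2) * μ) := by rw [hx]; ring
      rw [this, e1]
      have hμ1 : μ ≤ 1 := by nlinarith [mul_pos hμk0 (by linarith : 0 < ρ)]
      have : 0 < 2 * (ρ - k) - 5 * (k * μ * ρ) - 2 * ((ρ - k) / 10) * μ := by nlinarith
      nlinarith [mul_pos hμ0 this]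
    nlinarith [sq_nonneg (μ * ρ)]
  have : (1 + μ * ρ) ^ 2 * (1 - k * x) ≤ (1 + μ * ρ) ^ 2 * ((1 + x) ^ k)⁻¹ := by gcongr
  have h7 := hmain.trans_le this
  rw [← div_eq_mul_inv, one_lt_div hpos] at h7
  rwa [hx, ← add_assoc] at h7

/-- Every `k`-dimensional normed space is at distance at most `√k` from Euclidean space. -/
theorem exists_linearEquiv_euclideanSpace {W : Type*} [NormedAddCommGroup W] [NormedSpace ℝ W]
    [FiniteDimensional ℝ W] {k : ℕ} (hk : 0 < k) (hW : Module.finrank ℝ W = k) :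
    ∃ S : W ≃ₗ[ℝ] EuclideanSpace ℝ (Fin k), ∀ w, ‖S w‖ ≤ ‖w‖ ∧ ‖w‖ ≤ √k * ‖S w‖ := by
  let V := EuclideanSpace ℝ (Fin k)
  have hV : Module.finrank ℝ V = k := by simp [V]
  let e : V ≃L[ℝ] W := ContinuousLinearEquiv.ofFinrankEq (hV.trans hW.symm)
  let F : (W →L[ℝ] V) → ℝ := fun S => |(S ∘L (e : V →L[ℝ] W)).det|
  have hF : Continuous F :=
    (ContinuousLinearMap.continuous_det.comp (by fun_prop)).abs
  have hdetr : ∀ r : ℝ, F (r • (e.symm : W →L[ℝ] V)) = |r ^ k| := by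
    intro r
    have : (r • (e.symm : W →L[ℝ] V)) ∘L (e : V →L[ℝ] W) = r • ContinuousLinearMap.id ℝ V := by
      ext; simp
    simp only [F, this, ContinuousLinearMap.det, ContinuousLinearMap.toLinearMap_smul,
      LinearMap.det_smul, hV]
    simp
  obtain ⟨S, hS, hmax⟩ := (isCompact_closedBall (0 : W →L[ℝ] V) 1).exists_isMaxOn
    ⟨0, by simp⟩ hF.continuousOn
  have hpos : 0 < F S := by
    let r : ℝ := (‖(e.symm : W →L[ℝ] V)‖ + 1)⁻¹
    have hr : 0 < r := by positivity
    have : F (r • (e.symm : W →L[ℝ] V)) ≤ F S := hmax (by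
      rw [mem_closedBall_zero_iff, norm_smul, Real.norm_of_nonneg hr.le,
        inv_mul_le_one₀ (by positivity)]
      linarith)
    rw [hdetr] at this
    exact (abs_pos.2 (pow_pos hr k).ne').trans_le this
  have hS1 : ∀ w, ‖S w‖ ≤ ‖w‖ := fun w =>
    (S.le_opNorm w).trans (mul_le_of_le_one_left (norm_nonneg _) (by simpa using hS))
  let S' : W ≃ₗ[ℝ] V := e.symm.toLinearEquiv.trans
    (LinearMap.equivOfDetNeZero (S ∘L (e : V →L[ℝ] W) : V →L[ℝ] V).toLinearMap (abs_pos.1 hpos))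
  have hS' : ∀ w, S' w = S w := fun w => by
    simp [S']
  refine ⟨S', fun w₀ => ⟨by rw [hS']; exact hS1 w₀, ?_⟩⟩
  by_contra! hcon
  rw [hS'] at hcon
  obtain ⟨f, hf1, hf⟩ := exists_dual_vector'' ℝ w₀
  let y : V := (InnerProductSpace.toDual ℝ V).symm
    (f ∘L S'.toContinuousLinearEquiv.symm.toContinuousLinearMap)
  have hy : ∀ w, inner ℝ y (S w) = f w := by
    intro w
    rw [InnerProductSpace.toDual_symm_apply, ← hS']
    simp
  have hρ : (k : ℝ) < ‖y‖ ^ 2 := by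
    have h1 : √k * ‖S w₀‖ < ‖y‖ * ‖S w₀‖ := by
      refine hcon.trans_le ?_
      have : inner ℝ y (S w₀) = ‖w₀‖ := by rw [hy, hf]; simp
      rw [← this]
      exact real_inner_le_norm _ _
    have h2 : √k < ‖y‖ := lt_of_mul_lt_mul_right h1 (norm_nonneg _)
    exact (Real.sqrt_lt' ((Real.sqrt_nonneg _).trans_lt h2)).1 h2
  obtain ⟨μ, hμ, hlt⟩ := exists_stretch k hρ hk
  set c := 1 + 2 * μ + μ ^ 2 * ‖y‖ ^ 2 with hc
  have hc0 : 0 < c := by positivity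
  let D₀ : V →L[ℝ] V := ContinuousLinearMap.id ℝ V + (μ • innerSL ℝ y).smulRight y
  have hD₀ : D₀.toLinearMap = LinearMap.transvection (μ • (innerSL ℝ y).toLinearMap) y := by
    ext z
    simp [D₀, LinearMap.transvection]
  let D : V →L[ℝ] V := (√c)⁻¹ • D₀
  have hdet : D.det = ((√c)⁻¹) ^ k * (1 + μ * ‖y‖ ^ 2) := by
    simp only [D, ContinuousLinearMap.det, ContinuousLinearMap.toLinearMap_smul,
      LinearMap.det_smul, hV, hD₀, LinearMap.transvection.det]
    simp
  have hDS : D ∘L S ∈ Metric.closedBall (0 : W →L[ℝ] V) 1 := by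
    rw [mem_closedBall_zero_iff]
    refine ContinuousLinearMap.opNorm_le_bound _ zero_le_one fun w => ?_
    have h1 : ‖D₀ (S w)‖ ^ 2 ≤ c * ‖w‖ ^ 2 := by
      have : D₀ (S w) = S w + (μ * f w) • y := by simp [D₀, hy]
      rw [this, norm_add_sq_real, inner_smul_right, real_inner_comm, hy, norm_smul, mul_pow,
        Real.norm_eq_abs, sq_abs]
      have h2 : ‖S w‖ ^ 2 ≤ ‖w‖ ^ 2 := pow_le_pow_left₀ (norm_nonneg _) (hS1 w) 2
      have h3 : f w ^ 2 ≤ ‖w‖ ^ 2 := by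
        rw [← sq_abs, ← Real.norm_eq_abs]
        exact pow_le_pow_left₀ (norm_nonneg _)
          ((f.le_opNorm w).trans (mul_le_of_le_one_left (norm_nonneg _) hf1)) 2
      rw [hc]
      nlinarith [mul_le_mul_of_nonneg_left h3 hμ.le,
        mul_le_mul_of_nonneg_left h3 (by positivity : 0 ≤ μ ^ 2 * ‖y‖ ^ 2)]
    have h2 : ‖D₀ (S w)‖ ≤ √c * ‖w‖ := by
      refine le_of_sq_le_sq ?_ (by positivity)
      rwa [mul_pow, Real.sq_sqrt hc0.le]
    simp only [D, ContinuousLinearMap.comp_apply, smul_apply, norm_smul, norm_inv,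
      Real.norm_of_nonneg (Real.sqrt_nonneg c), one_mul]
    rwa [inv_mul_le_iff₀ (Real.sqrt_pos.2 hc0)]
  have h1 : F (D ∘L S) = |D.det| * F S := by
    simp only [F, ← abs_mul]
    rw [ContinuousLinearMap.comp_assoc]
    simp [ContinuousLinearMap.det]
  have h2 : |D.det| ≤ 1 := by
    have : F (D ∘L S) ≤ F S := hmax hDS
    rw [h1] at this
    exact (mul_le_iff_le_one_left hpos).1 this
  have h3 : D.det ^ 2 ≤ 1 := (sq_le_one_iff_abs_le_one _).2 h2
  rw [hdet, mul_pow, ← pow_mul, mul_comm k 2, pow_mul, inv_pow, Real.sq_sqrt hc0.le, inv_pow,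
    inv_mul_le_one₀ (by positivity)] at h3
  exact hlt.not_ge h3

/-- The sign attached to a Boolean. -/
def boolSign (b : Bool) : ℝ := if b then 1 else -1

theorem boolSign_mul_self (b : Bool) : boolSign b * boolSign b = 1 := by
  cases b <;> simp [boolSign]

theorem abs_boolSign (b : Bool) : |boolSign b| = 1 := by
  cases b <;> simp [boolSign]

theorem boolSign_not (b : Bool) : boolSign (!b) = -boolSign b := by
  cases b <;> simp [boolSign]

/-- The exponential moment of a Rademacher sum. -/
theorem sum_exp_boolSign_le {n : ℕ} (v : Fin n → ℝ) :
    ∑ ε : Fin n → Bool, Real.exp (∑ i, boolSign (ε i) * v i) ≤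
      2 ^ n * Real.exp ((∑ i, v i ^ 2) / 2) := by
  have h : ∑ ε : Fin n → Bool, Real.exp (∑ i, boolSign (ε i) * v i) =
      ∏ i, (2 * Real.cosh (v i)) := by
    simp only [Real.exp_sum]
    rw [← Fintype.piFinset_univ, ← Finset.prod_univ_sum (fun _ => Finset.univ)
      (fun i b => Real.exp (boolSign b * v i))]
    refine Finset.prod_congr rfl fun i _ => ?_
    rw [Fintype.sum_bool, Real.cosh_eq]
    simp only [boolSign, if_true, Bool.false_eq_true, if_false, one_mul, neg_one_mul]
    ring
  rw [h, Finset.prod_mul_distrib, Finset.prod_const, Finset.card_univ, Fintype.card_fin,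
    Finset.sum_div, Real.exp_sum]
  gcongr with i
  exact Real.cosh_le_exp_half_sq _

theorem sum_eq_zero_of_flip {n : ℕ} (f : (Fin n → Bool) → ℝ) (i : Fin n)
    (hf : ∀ ε, f (Function.update ε i (!ε i)) = -f ε) : ∑ ε, f ε = 0 := by
  have hinv : Function.Involutive fun ε : Fin n → Bool => Function.update ε i (!ε i) := by
    intro ε
    simp
  have h := Equiv.sum_comp hinv.toPerm f
  simp only [Function.Involutive.coe_toPerm, hf, Finset.sum_neg_distrib] at h
  linarith

open Finset in
theorem abs_sum_walsh_le {n : ℕ} {a b c d : Fin n} (hcd : c ≠ d) :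
    |∑ ε : Fin n → Bool, boolSign (ε a) * boolSign (ε b) * (boolSign (ε c) * boolSign (ε d))| ≤
      2 ^ n * ((if (c, d) = (a, b) then 1 else 0) + (if (c, d) = (b, a) then 1 else 0)) := by
  by_cases h : (c, d) = (a, b) ∨ (c, d) = (b, a)
  · refine (abs_sum_le_sum_abs _ _).trans ?_
    simp only [abs_mul, abs_boolSign, mul_one, sum_const, card_univ, nsmul_eq_mul,
      Fintype.card_fun, Fintype.card_bool, Fintype.card_fin, Nat.cast_pow, Nat.cast_ofNat]
    refine le_mul_of_one_le_right (by positivity) ?_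
    rcases h with h | h
    · rw [if_pos h]
      split_ifs <;> norm_num
    · rw [if_pos h]
      split_ifs <;> norm_num
  · have hex : (c ≠ a ∧ c ≠ b) ∨ (d ≠ a ∧ d ≠ b) := by
      simp only [Prod.mk.injEq] at h
      grind
    have : ∑ ε : Fin n → Bool,
        boolSign (ε a) * boolSign (ε b) * (boolSign (ε c) * boolSign (ε d)) = 0 := by
      rcases hex with ⟨h1, h2⟩ | ⟨h1, h2⟩
      · refine sum_eq_zero_of_flip _ c fun ε => ?_
        simp [Function.update_of_ne h1.symm, Function.update_of_ne h2.symm,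
          Function.update_of_ne hcd.symm, boolSign_not]
      · refine sum_eq_zero_of_flip _ d fun ε => ?_
        simp [Function.update_of_ne h1.symm, Function.update_of_ne h2.symm,
          Function.update_of_ne hcd, boolSign_not]
    rw [this, abs_zero]
    positivity

open Finset in
/-- Second moment of a Rademacher chaos. -/
theorem sum_sq_chaos_le {n : ℕ} (m : Fin n × Fin n → ℝ) :
    ∑ ε : Fin n → Bool, (∑ p ∈ univ.offDiag, m p * (boolSign (ε p.1) * boolSign (ε p.2))) ^ 2 ≤
      2 ^ n * (2 * ∑ p, m p ^ 2) := by
  set χ : (Fin n → Bool) → Fin n × Fin n → ℝ := fun ε p => boolSign (ε p.1) * boolSign (ε p.2)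
  set O : Finset (Fin n × Fin n) := univ.offDiag
  have hexp : ∑ ε : Fin n → Bool, (∑ p ∈ O, m p * χ ε p) ^ 2 =
      ∑ p ∈ O, ∑ q ∈ O, m p * m q * ∑ ε, χ ε p * χ ε q := by
    simp_rw [sq, sum_mul_sum]
    rw [sum_comm]
    refine sum_congr rfl fun p _ => ?_
    rw [sum_comm]
    refine sum_congr rfl fun q _ => ?_
    rw [mul_sum]
    exact sum_congr rfl fun ε _ => by ring
  have hterm : ∀ p ∈ O, ∀ q ∈ O, m p * m q * ∑ ε, χ ε p * χ ε q ≤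
      2 ^ n * ((if q = p then |m p * m q| else 0) + if q = p.swap then |m p * m q| else 0) := by
    intro p _ q hq
    have := abs_sum_walsh_le (a := p.1) (b := p.2) (mem_offDiag.1 hq).2.2
    calc m p * m q * ∑ ε, χ ε p * χ ε q ≤ |m p * m q| * |∑ ε, χ ε p * χ ε q| := by
          rw [← abs_mul]; exact le_abs_self _
      _ ≤ |m p * m q| * (2 ^ n * ((if q = p then 1 else 0) + if q = p.swap then 1 else 0)) :=
          mul_le_mul_of_nonneg_left this (abs_nonneg _)
      _ = _ := by split_ifs <;> ring
  have hrow : ∀ p ∈ O, ∑ q ∈ O, m p * m q * ∑ ε, χ ε p * χ ε q ≤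
      2 ^ n * (m p ^ 2 + (m p ^ 2 + m p.swap ^ 2) / 2) := by
    intro p hp
    refine (sum_le_sum fun q hq => hterm p hp q hq).trans ?_
    rw [← mul_sum, sum_add_distrib, sum_ite_eq', sum_ite_eq', if_pos hp]
    gcongr
    · rw [abs_mul_self, sq]
    · split_ifs
      · rw [abs_mul]
        nlinarith [sq_nonneg (|m p| - |m p.swap|), sq_abs (m p), sq_abs (m p.swap)]
      · positivity
  calc _ = ∑ p ∈ O, ∑ q ∈ O, m p * m q * ∑ ε, χ ε p * χ ε q := hexp
    _ ≤ ∑ p ∈ O, 2 ^ n * (m p ^ 2 + (m p ^ 2 + m p.swap ^ 2) / 2) := sum_le_sum hrow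
    _ ≤ ∑ p, 2 ^ n * (m p ^ 2 + (m p ^ 2 + m p.swap ^ 2) / 2) :=
        sum_le_univ_sum_of_nonneg fun p => by positivity
    _ = _ := by
        rw [← mul_sum, sum_add_distrib, ← sum_div, sum_add_distrib]
        have : ∑ p : Fin n × Fin n, m p.swap ^ 2 = ∑ p, m p ^ 2 :=
          (Equiv.prodComm (Fin n) (Fin n)).sum_comp fun p => m p ^ 2
        rw [this]
        ring

/-- The unit vector with coordinates `± 1 / √n`. -/
noncomputable def signVector {n : ℕ} (ε : Fin n → Bool) : EuclideanSpace ℝ (Fin n) :=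
  WithLp.toLp 2 fun i => boolSign (ε i) / √n

theorem norm_signVector {n : ℕ} (hn : 0 < n) (ε : Fin n → Bool) : ‖signVector ε‖ = 1 := by
  have hn' : (0 : ℝ) < n := by exact_mod_cast hn
  rw [EuclideanSpace.norm_eq, Real.sqrt_eq_one]
  simp [signVector, abs_boolSign, hn'.ne']

open Finset in
theorem card_lt_inner_signVector_le {n : ℕ} (hn : 0 < n) {v : EuclideanSpace ℝ (Fin n)}
    (hv : ‖v‖ ≤ 1) {δ : ℝ} (hδ : 0 ≤ δ) :
    (Nat.card {ε : Fin n → Bool // δ < inner ℝ (signVector ε) v} : ℝ) ≤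
      2 ^ n * Real.exp (-(δ ^ 2 * n / 2)) := by
  classical
  have hn' : (0 : ℝ) < n := by exact_mod_cast hn
  rw [Nat.card_eq_fintype_card, Fintype.card_subtype]
  have hinner : ∀ ε : Fin n → Bool, ∑ i, boolSign (ε i) * (δ * √n * v i) =
      δ * n * inner ℝ (signVector ε) v := by
    intro ε
    rw [PiLp.inner_apply, mul_sum]
    refine sum_congr rfl fun i _ => ?_
    simp only [signVector, RCLike.inner_apply, conj_trivial]
    field_simp
    rw [Real.sq_sqrt hn'.le]
    ring
  have h1 := sum_exp_boolSign_le fun i => δ * √n * v i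
  have h2 : ∑ i, (δ * √n * v i) ^ 2 ≤ δ ^ 2 * n := by
    simp only [mul_pow, Real.sq_sqrt hn'.le, ← mul_sum]
    refine mul_le_of_le_one_right (by positivity) ?_
    rw [← EuclideanSpace.real_norm_sq_eq]
    exact pow_le_one₀ (norm_nonneg _) hv
  have h3 : (#{ε : Fin n → Bool | δ < inner ℝ (signVector ε) v} : ℝ) * Real.exp (δ ^ 2 * n) ≤
      ∑ ε : Fin n → Bool, Real.exp (∑ i, boolSign (ε i) * (δ * √n * v i)) := by
    rw [← nsmul_eq_mul, ← sum_const]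
    refine (sum_le_sum fun ε hε => ?_).trans
      (sum_le_univ_sum_of_nonneg fun ε => (Real.exp_pos _).le)
    rw [hinner]
    have := (mem_filter.1 hε).2
    refine Real.exp_le_exp.2 ?_
    calc δ ^ 2 * n = δ * n * δ := by ring
      _ ≤ _ := by gcongr
  have h4 : (#{ε : Fin n → Bool | δ < inner ℝ (signVector ε) v} : ℝ) * Real.exp (δ ^ 2 * n) ≤
      2 ^ n * Real.exp (δ ^ 2 * n / 2) := h3.trans (h1.trans (by gcongr))
  rw [← le_div_iff₀ (Real.exp_pos _), mul_div_assoc, ← Real.exp_sub] at h4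
  refine h4.trans_eq ?_
  congr 2
  ring

theorem card_lt_abs_inner_signVector_le {n : ℕ} (hn : 0 < n) {v : EuclideanSpace ℝ (Fin n)}
    (hv : ‖v‖ ≤ 1) {δ : ℝ} (hδ : 0 ≤ δ) :
    (Nat.card {ε : Fin n → Bool // δ < |inner ℝ (signVector ε) v|} : ℝ) ≤
      2 * Real.exp (-(δ ^ 2 * n / 2)) * 2 ^ n := by
  have h1 := card_lt_inner_signVector_le hn hv hδ
  have h2 := card_lt_inner_signVector_le hn (v := -v) (by simpa using hv) hδ
  have h3 : Nat.card {ε : Fin n → Bool // δ < |inner ℝ (signVector ε) v|} ≤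
      Nat.card {ε : Fin n → Bool // δ < inner ℝ (signVector ε) v} +
        Nat.card {ε : Fin n → Bool // δ < inner ℝ (signVector ε) (-v)} := by
    simp only [lt_abs, inner_neg_right]
    classical
    simp only [Nat.card_eq_fintype_card]
    exact Fintype.card_subtype_or _ _
  have h4 := (Nat.cast_le (α := ℝ)).2 h3
  push_cast at h4
  linarith

/-- The matrix entries of an orthogonal map in the standard basis. -/
noncomputable def entry {n : ℕ} (u : EuclideanSpace ℝ (Fin n) ≃ₗᵢ[ℝ] EuclideanSpace ℝ (Fin n))
    (a b : Fin n) : ℝ := u (EuclideanSpace.single b 1) a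

theorem sum_entry_sq {n : ℕ} (u : EuclideanSpace ℝ (Fin n) ≃ₗᵢ[ℝ] EuclideanSpace ℝ (Fin n))
    (b : Fin n) : ∑ a, entry u a b ^ 2 = 1 := by
  simp only [entry]
  rw [← EuclideanSpace.real_norm_sq_eq]
  simp

theorem abs_entry_le {n : ℕ} (u : EuclideanSpace ℝ (Fin n) ≃ₗᵢ[ℝ] EuclideanSpace ℝ (Fin n))
    (a b : Fin n) : |entry u a b| ≤ 1 := by
  rw [← sq_le_one_iff_abs_le_one, ← sum_entry_sq u b]
  exact Finset.single_le_sum (f := fun a => entry u a b ^ 2) (fun _ _ => sq_nonneg _)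
    (Finset.mem_univ a)

/-- The normalized trace of an orthogonal map. -/
noncomputable def meanTrace {n : ℕ}
    (u : EuclideanSpace ℝ (Fin n) ≃ₗᵢ[ℝ] EuclideanSpace ℝ (Fin n)) : ℝ :=
  (∑ a, entry u a a) / n

theorem abs_meanTrace_le {n : ℕ} (hn : 0 < n)
    (u : EuclideanSpace ℝ (Fin n) ≃ₗᵢ[ℝ] EuclideanSpace ℝ (Fin n)) : |meanTrace u| ≤ 1 := by
  have hn' : (0 : ℝ) < n := by exact_mod_cast hn
  rw [meanTrace, abs_div, Nat.abs_cast, div_le_one hn']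
  refine (Finset.abs_sum_le_sum_abs _ _).trans ?_
  exact (Finset.sum_le_sum fun a _ => abs_entry_le u a a).trans (by simp)

theorem inner_signVector_map {n : ℕ}
    (u : EuclideanSpace ℝ (Fin n) ≃ₗᵢ[ℝ] EuclideanSpace ℝ (Fin n)) (ε η : Fin n → Bool) :
    inner ℝ (signVector ε) (u (signVector η)) =
      (∑ a, ∑ b, entry u a b * (boolSign (ε a) * boolSign (η b))) / n := by
  have h1 : ∀ a, u (signVector η) a = ∑ b, boolSign (η b) / √n * entry u a b := by
    intro a
    conv_lhs => rw [← (EuclideanSpace.basisFun (Fin n) ℝ).sum_repr (signVector η)]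
    simp [entry, signVector]
  rw [PiLp.inner_apply, Finset.sum_div]
  refine Finset.sum_congr rfl fun a _ => ?_
  rw [h1, Finset.sum_div]
  simp only [signVector, RCLike.inner_apply, conj_trivial, Finset.sum_mul]
  refine Finset.sum_congr rfl fun b _ => ?_
  have : (n : ℝ) = √n * √n := (Real.mul_self_sqrt (Nat.cast_nonneg n)).symm
  conv_rhs => rw [this]
  ring

open Finset in
theorem card_lt_abs_inner_sub_meanTrace_le {n : ℕ} (hn : 0 < n)
    (u : EuclideanSpace ℝ (Fin n) ≃ₗᵢ[ℝ] EuclideanSpace ℝ (Fin n)) {δ : ℝ} (hδ : 0 < δ) :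
    (Nat.card {ε : Fin n → Bool //
      δ < |inner ℝ (signVector ε) (u (signVector ε)) - meanTrace u|} : ℝ) ≤
      2 / (n * δ ^ 2) * 2 ^ n := by
  classical
  have hn' : (0 : ℝ) < n := by exact_mod_cast hn
  rw [Nat.card_eq_fintype_card, Fintype.card_subtype]
  have hch : ∀ ε : Fin n → Bool, inner ℝ (signVector ε) (u (signVector ε)) - meanTrace u =
      (∑ p ∈ univ.offDiag, entry u p.1 p.2 * (boolSign (ε p.1) * boolSign (ε p.2))) / n := by
    intro ε
    rw [inner_signVector_map, meanTrace, ← sub_div]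
    congr 1
    rw [← Fintype.sum_prod_type', ← univ_product_univ, ← diag_union_offDiag,
      sum_union (disjoint_diag_offDiag _), sum_diag]
    simp [boolSign_mul_self]
  have h1 := sum_sq_chaos_le fun p : Fin n × Fin n => entry u p.1 p.2
  have h2 : ∑ p : Fin n × Fin n, entry u p.1 p.2 ^ 2 = n := by
    rw [Fintype.sum_prod_type, sum_comm]
    simp [sum_entry_sq]
  rw [h2] at h1
  have h3 : (#{ε : Fin n → Bool |
      δ < |inner ℝ (signVector ε) (u (signVector ε)) - meanTrace u|} : ℝ) * (n * δ) ^ 2 ≤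
      ∑ ε : Fin n → Bool,
        (∑ p ∈ univ.offDiag, entry u p.1 p.2 * (boolSign (ε p.1) * boolSign (ε p.2))) ^ 2 := by
    rw [← nsmul_eq_mul, ← sum_const]
    refine (sum_le_sum fun ε hε => ?_).trans (sum_le_univ_sum_of_nonneg fun ε => sq_nonneg _)
    have h4 := (mem_filter.1 hε).2
    rw [hch, abs_div, Nat.abs_cast, lt_div_iff₀ hn'] at h4
    rw [← sq_abs (∑ p ∈ _, _), mul_comm]
    gcongr
  have h5 := h3.trans h1
  rw [← le_div_iff₀ (by positivity)] at h5
  refine h5.trans_eq ?_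
  field_simp

theorem abs_inner_signVector_map_sub_le {n : ℕ} (hn : 0 < n)
    {u v : EuclideanSpace ℝ (Fin n) ≃ₗᵢ[ℝ] EuclideanSpace ℝ (Fin n)} {η : ℝ}
    (h : ∀ a b, |entry u a b - entry v a b| ≤ η) (ε ε' : Fin n → Bool) :
    |inner ℝ (signVector ε) (u (signVector ε')) - inner ℝ (signVector ε) (v (signVector ε'))| ≤
      n * η := by
  have hn' : (0 : ℝ) < n := by exact_mod_cast hn
  rw [inner_signVector_map, inner_signVector_map, ← sub_div, abs_div, Nat.abs_cast,
    div_le_iff₀ hn', ← Finset.sum_sub_distrib]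
  simp only [← Finset.sum_sub_distrib, ← sub_mul]
  calc _ ≤ ∑ _a : Fin n, ∑ _b : Fin n, η := by
        refine (Finset.abs_sum_le_sum_abs _ _).trans (Finset.sum_le_sum fun a _ => ?_)
        refine (Finset.abs_sum_le_sum_abs _ _).trans (Finset.sum_le_sum fun b _ => ?_)
        simpa [abs_mul, abs_boolSign] using h a b
    _ = _ := by simp; ring

theorem abs_meanTrace_sub_le {n : ℕ} (hn : 0 < n)
    {u v : EuclideanSpace ℝ (Fin n) ≃ₗᵢ[ℝ] EuclideanSpace ℝ (Fin n)} {η : ℝ}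
    (h : ∀ a b, |entry u a b - entry v a b| ≤ η) : |meanTrace u - meanTrace v| ≤ η := by
  have hn' : (0 : ℝ) < n := by exact_mod_cast hn
  rw [meanTrace, meanTrace, ← sub_div, abs_div, Nat.abs_cast, div_le_iff₀ hn',
    ← Finset.sum_sub_distrib]
  refine (Finset.abs_sum_le_sum_abs _ _).trans
    ((Finset.sum_le_sum fun a _ => h a a).trans_eq ?_)
  simp [mul_comm]

/-- A finite net of the orthogonal group, in the entrywise maximum distance. -/
theorem exists_orthogonal_net (n L : ℕ) (hL : 0 < L) :
    ∃ v : (Fin n → Fin n → Fin (2 * L + 1)) →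
        (EuclideanSpace ℝ (Fin n) ≃ₗᵢ[ℝ] EuclideanSpace ℝ (Fin n)),
      ∀ u, ∃ β, ∀ a b, |entry u a b - entry (v β) a b| ≤ 1 / L := by
  have hL' : (0 : ℝ) < L := by exact_mod_cast hL
  have hnn : ∀ (u : EuclideanSpace ℝ (Fin n) ≃ₗᵢ[ℝ] EuclideanSpace ℝ (Fin n)) a b,
      0 ≤ (entry u a b + 1) * L := fun u a b =>
    mul_nonneg (by linarith [(abs_le.1 (abs_entry_le u a b)).1]) hL'.le
  let round : (EuclideanSpace ℝ (Fin n) ≃ₗᵢ[ℝ] EuclideanSpace ℝ (Fin n)) →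
      Fin n → Fin n → Fin (2 * L + 1) := fun u a b =>
    ⟨⌊(entry u a b + 1) * L⌋₊, by
      have h2 : (entry u a b + 1) * L ≤ ((2 * L : ℕ) : ℝ) := by
        push_cast
        nlinarith [(abs_le.1 (abs_entry_le u a b)).2]
      exact Nat.lt_succ_of_le (Nat.floor_le_of_le h2)⟩
  refine ⟨Function.invFun round, fun u => ⟨round u, fun a b => ?_⟩⟩
  have h : round (Function.invFun round (round u)) = round u := Function.invFun_eq ⟨u, rfl⟩
  set w := Function.invFun round (round u)
  have h1 : ⌊(entry w a b + 1) * L⌋₊ = ⌊(entry u a b + 1) * L⌋₊ :=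
    congrArg Fin.val (congrFun (congrFun h a) b)
  have h2 := Nat.floor_le (hnn u a b)
  have h3 := Nat.lt_floor_add_one ((entry u a b + 1) * L)
  have h4 := Nat.floor_le (hnn w a b)
  have h5 := Nat.lt_floor_add_one ((entry w a b + 1) * L)
  rw [h1] at h4 h5
  rw [le_div_iff₀ hL', ← Nat.abs_cast L, ← abs_mul, abs_le]
  constructor <;> linarith

open Finset in
/-- The exponential moment of the number of entries of a random tuple which satisfy `D` or are
related by `R` to a later entry. -/
theorem sum_four_pow_card_le {X : Type*} [Fintype X] (R : X → X → Prop) (D : X → Prop)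
    [DecidablePred D] [DecidableRel R] {p q d : ℝ} (hq : 0 ≤ q) (hd : 0 ≤ d)
    (hR : ∀ y, (#{x | R x y} : ℝ) ≤ q * Fintype.card X)
    (hD : (#{x | D x} : ℝ) ≤ d * Fintype.card X) (m : ℕ) (hm : d + m * q ≤ p) :
    ∑ g : Fin m → X, (4 : ℝ) ^ #{s | D (g s) ∨ ∃ t, s < t ∧ R (g s) (g t)} ≤
      ((1 + 3 * p) * Fintype.card X) ^ m := by
  classical
  induction m with
  | zero => simp
  | succ m ih =>
    have hm' : d + m * q ≤ p := by
      push_cast at hm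
      linarith
    have hp : 0 ≤ p := le_trans (by positivity) hm
    have key : ∀ (x : X) (g : Fin m → X),
        (4 : ℝ) ^ #{s | D ((Fin.cons x g : Fin (m + 1) → X) s) ∨
          ∃ t, s < t ∧
            R ((Fin.cons x g : Fin (m + 1) → X) s) ((Fin.cons x g : Fin (m + 1) → X) t)} =
        (1 + 3 * (if D x ∨ ∃ t, R x (g t) then 1 else 0)) *
          4 ^ #{s | D (g s) ∨ ∃ t, s < t ∧ R (g s) (g t)} := by
      intro x g
      rw [Fin.card_filter_univ_succ]
      simp only [Fin.cons_zero, Fin.exists_fin_succ, Fin.cons_succ, lt_self_iff_false, false_and,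
        Fin.succ_pos, true_and, false_or, Fin.not_lt_zero, Fin.succ_lt_succ_iff]
      split_ifs
      · rw [pow_succ]; ring
      · simp
    rw [← (Fin.consEquiv fun _ : Fin (m + 1) => X).sum_comp, Fintype.sum_prod_type, sum_comm]
    calc _ = ∑ g : Fin m → X, (∑ x, (1 + 3 * (if D x ∨ ∃ t, R x (g t) then (1 : ℝ) else 0))) *
          4 ^ #{s | D (g s) ∨ ∃ t, s < t ∧ R (g s) (g t)} := by
          refine sum_congr rfl fun g _ => ?_
          rw [sum_mul]
          exact sum_congr rfl fun x _ => key x g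
      _ ≤ ∑ g : Fin m → X, ((1 + 3 * p) * Fintype.card X) *
          4 ^ #{s | D (g s) ∨ ∃ t, s < t ∧ R (g s) (g t)} := by
          refine sum_le_sum fun g _ => mul_le_mul_of_nonneg_right ?_ (by positivity)
          have h1 : (#{x | D x ∨ ∃ t, R x (g t)} : ℝ) ≤ p * Fintype.card X := by
            have h2 : #{x | D x ∨ ∃ t, R x (g t)} ≤ #{x | D x} + ∑ t, #{x | R x (g t)} := by
              rw [filter_or]
              refine (card_union_le _ _).trans (Nat.add_le_add_left ?_ _)
              have : ({x | ∃ t, R x (g t)} : Finset X) = univ.biUnion fun t => {x | R x (g t)} := by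
                ext; simp
              rw [this]
              exact card_biUnion_le
            calc (#{x | D x ∨ ∃ t, R x (g t)} : ℝ)
                ≤ #{x | D x} + ∑ t, (#{x | R x (g t)} : ℝ) := mod_cast h2
              _ ≤ d * Fintype.card X + ∑ _t : Fin m, q * Fintype.card X :=
                add_le_add hD (sum_le_sum fun t _ => hR _)
              _ = (d + m * q) * Fintype.card X := by simp; ring
              _ ≤ _ := by gcongr
          rw [sum_add_distrib, ← mul_sum, sum_boole]
          simp only [sum_const, card_univ, nsmul_eq_mul, mul_one]
          linarith
      _ ≤ _ := by
          rw [← mul_sum, pow_succ']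
          exact mul_le_mul_of_nonneg_left (ih hm') (by positivity)

open Finset in
/-- The exponential moment of the number of entries of a random tuple which satisfy `D` or are
related by `R` to an earlier entry. -/
theorem sum_four_pow_card_le_of_earlier {X : Type*} [Fintype X] (R : X → X → Prop) (D : X → Prop)
    [DecidablePred D] [DecidableRel R] {p q d : ℝ} (hq : 0 ≤ q) (hd : 0 ≤ d)
    (hR : ∀ y, (#{x | R x y} : ℝ) ≤ q * Fintype.card X)
    (hD : (#{x | D x} : ℝ) ≤ d * Fintype.card X) (m : ℕ) (hm : d + m * q ≤ p) :
    ∑ g : Fin m → X, (4 : ℝ) ^ #{s | D (g s) ∨ ∃ t, t < s ∧ R (g s) (g t)} ≤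
      ((1 + 3 * p) * Fintype.card X) ^ m := by
  refine le_of_eq_of_le ?_ (sum_four_pow_card_le R D hq hd hR hD m hm)
  rw [← (Equiv.arrowCongr (Fin.revPerm (n := m)) (Equiv.refl X)).sum_comp]
  refine sum_congr rfl fun g _ => ?_
  congr 1
  refine card_equiv Fin.revPerm fun s => ?_
  simp only [mem_filter, mem_univ, true_and, Equiv.arrowCongr_apply, Equiv.coe_refl,
    Function.comp_apply, id, Fin.revPerm_symm, Fin.revPerm_apply]
  refine or_congr_right ⟨?_, ?_⟩
  · rintro ⟨t, ht, h⟩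
    exact ⟨t.rev, by simpa using ht, h⟩
  · rintro ⟨t, ht, h⟩
    exact ⟨t.rev, by rw [← Fin.rev_lt_rev]; simpa using ht, by simpa using h⟩

open Finset in
/-- If the relations `R β` and the predicates `D β` are rarely satisfied, some family of `N` blocks
of length `k` has, for each `β`, a block none of whose entries satisfies `D β` or is related by
`R β` to another entry of the family. -/
theorem exists_forall_exists_unmarked_block {X ι : Type*} [Fintype X] [Nonempty X] [Fintype ι]
    (R : ι → X → X → Prop) (D : ι → X → Prop) {p q d : ℝ} (hq : 0 ≤ q) (hd : 0 ≤ d)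
    (hR : ∀ β y, (Nat.card {x // R β x y} : ℝ) ≤ q * Nat.card X)
    (hD : ∀ β, (Nat.card {x // D β x} : ℝ) ≤ d * Nat.card X) (N k : ℕ)
    (hm : d + (N * k : ℕ) * q ≤ p) (hcard : Nat.card ι * (1 + 3 * p) ^ (N * k) < 2 ^ N) :
    ∃ g : Fin N → Fin k → X, ∀ β, ∃ j, ∀ a, ¬ D β (g j a) ∧
      ∀ i b, (i, b) ≠ (j, a) → ¬ R β (g j a) (g i b) := by
  classical
  simp only [Nat.card_eq_fintype_card, Fintype.card_subtype] at hR hD hcard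
  set M := N * k
  let bad : ι → (Fin M → X) → Finset (Fin M) := fun β g =>
    {s | D β (g s) ∨ ∃ t, t ≠ s ∧ R β (g s) (g t)}
  have hX : (0 : ℝ) < Fintype.card X := by exact_mod_cast Fintype.card_pos
  have hex : ∃ g : Fin M → X, ∀ β, #(bad β g) < N := by
    by_contra! hcon
    have hlow : ∀ g : Fin M → X, (2 : ℝ) * 2 ^ N ≤
        ∑ β, ((4 : ℝ) ^ #{s | D β (g s) ∨ ∃ t, s < t ∧ R β (g s) (g t)} +
          4 ^ #{s | D β (g s) ∨ ∃ t, t < s ∧ R β (g s) (g t)}) := by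
      intro g
      obtain ⟨β, hβ⟩ := hcon g
      refine le_trans ?_ (single_le_sum (f := fun β =>
        ((4 : ℝ) ^ #{s | D β (g s) ∨ ∃ t, s < t ∧ R β (g s) (g t)} +
          4 ^ #{s | D β (g s) ∨ ∃ t, t < s ∧ R β (g s) (g t)}))
          (fun _ _ => by positivity) (mem_univ β))
      set x := #{s | D β (g s) ∨ ∃ t, s < t ∧ R β (g s) (g t)}
      set y := #{s | D β (g s) ∨ ∃ t, t < s ∧ R β (g s) (g t)}
      have hxy : N ≤ x + y := by
        refine hβ.trans ((card_le_card ?_).trans (card_union_le _ _))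
        intro s hs
        simp only [bad, mem_filter, mem_univ, true_and, mem_union] at hs ⊢
        rcases hs with h | ⟨t, hts, h⟩
        · exact Or.inl (Or.inl h)
        · rcases lt_or_gt_of_ne hts with h' | h'
          · exact Or.inr (Or.inr ⟨t, h', h⟩)
          · exact Or.inl (Or.inr ⟨t, h', h⟩)
      have h4 : ∀ z : ℕ, (4 : ℝ) ^ z = (2 ^ z) ^ 2 := fun z => by
        rw [← pow_mul, mul_comm, pow_mul]; norm_num
      have : (2 : ℝ) ^ N ≤ 2 ^ x * 2 ^ y := by
        rw [← pow_add]
        exact pow_le_pow_right₀ (by norm_num) hxy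
      rw [h4, h4]
      nlinarith [sq_nonneg ((2 : ℝ) ^ x - 2 ^ y)]
    have hsum := sum_le_sum fun g (_ : g ∈ (univ : Finset (Fin M → X))) => hlow g
    rw [sum_comm] at hsum
    have hup := sum_le_sum fun β (_ : β ∈ (univ : Finset ι)) => add_le_add
      (sum_four_pow_card_le (R β) (D β) hq hd (hR β) (hD β) M hm)
      (sum_four_pow_card_le_of_earlier (R β) (D β) hq hd (hR β) (hD β) M hm)
    simp only [← sum_add_distrib] at hup
    have := hsum.trans hup
    simp only [sum_const, card_univ, nsmul_eq_mul, Fintype.card_fun, Fintype.card_fin,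
      mul_pow, Nat.cast_pow] at this
    have hXM : (0 : ℝ) < (Fintype.card X : ℝ) ^ M := by positivity
    nlinarith
  obtain ⟨g, hg⟩ := hex
  refine ⟨fun j a => g (finProdFinEquiv (j, a)), fun β => ?_⟩
  by_contra! hcon
  refine (hg β).not_ge ?_
  have : univ ⊆ (bad β g).image fun s => (finProdFinEquiv.symm s).1 := by
    intro j _
    obtain ⟨a, ha⟩ := hcon j
    refine mem_image.2 ⟨finProdFinEquiv (j, a), ?_, by simp⟩
    simp only [bad, mem_filter, mem_univ, true_and]
    by_cases h : D β (g (finProdFinEquiv (j, a)))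
    · exact Or.inl h
    · obtain ⟨i, b, hne, h⟩ := ha h
      exact Or.inr ⟨_, fun h' => hne (finProdFinEquiv.injective h'), h⟩
  simpa using (card_le_card this).trans card_image_le

theorem parameter_bounds {n k : ℕ} (hn : 0 < n) (hk : 0 < k)
    (h : (k : ℝ) ≤ 1 / 100 * (n : ℝ) ^ ((1 : ℝ) / 4)) :
    (10 : ℝ) ^ 8 * k ^ 4 ≤ n ∧
      (n : ℝ) ^ 3 * k ^ 2 * Real.exp (-(n / (800 * k ^ 3))) ≤ 1 / 10000 := by
  set y := (n : ℝ) ^ ((1 : ℝ) / 4) with hy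
  have hn' : (0 : ℝ) < n := by exact_mod_cast hn
  have hk' : (0 : ℝ) < k := by exact_mod_cast hk
  have hy0 : 0 < y := Real.rpow_pos_of_pos hn' _
  have hy4 : y ^ 4 = n := by
    rw [hy, ← Real.rpow_natCast, ← Real.rpow_mul hn'.le]
    norm_num
  constructor
  · have := pow_le_pow_left₀ hk'.le h 4
    rw [mul_pow, hy4] at this
    linarith
  · have h1 : 14 * y ≤ n / (800 * k ^ 3) := by
      rw [le_div_iff₀ (by positivity), ← hy4]
      have h3 := pow_le_pow_left₀ hk'.le h 3
      calc 14 * y * (800 * k ^ 3) ≤ 14 * y * (800 * (1 / 100 * y) ^ 3) := by gcongr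
        _ ≤ y ^ 4 := by nlinarith [pow_pos hy0 4]
    have h2 : y ^ 14 ≤ Real.exp (n / (800 * k ^ 3)) := by
      refine le_trans ?_ (Real.exp_le_exp.2 h1)
      have : Real.exp (14 * y) = Real.exp y ^ 14 := by
        rw [← Real.exp_nat_mul]; norm_num
      rw [this]
      have := Real.add_one_le_exp y
      gcongr
      linarith
    rw [Real.exp_neg, ← div_eq_mul_inv, div_le_iff₀ (Real.exp_pos _)]
    calc (n : ℝ) ^ 3 * k ^ 2 ≤ n ^ 3 * (1 / 100 * y) ^ 2 := by gcongr
      _ = 1 / 10000 * y ^ 14 := by rw [← hy4]; ring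
      _ ≤ _ := by gcongr

theorem card_net_mul_lt {n k : ℕ} (hn : 81 ≤ n) {p : ℝ} (hp : 0 ≤ p) (hpk : k * p ≤ 1 / 9) :
    (Nat.card (Fin n → Fin n → Fin (2 * (40 * n ^ 2) + 1)) : ℝ) * (1 + 3 * p) ^ (9 * n ^ 3 * k) <
      2 ^ (9 * n ^ 3) := by
  have hb : (1 + 3 * p) ^ k ≤ 3 / 2 := by
    have h1 : (1 + 3 * p) ^ k ≤ Real.exp (k * (3 * p)) := by
      rw [Real.exp_nat_mul]
      gcongr
      linarith [Real.add_one_le_exp (3 * p)]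
    have h2 : Real.exp (k * (3 * p)) ≤ Real.exp (1 / 3) := Real.exp_le_exp.2 (by linarith)
    have h3 : Real.exp (1 / 3) ≤ 3 / 2 := by
      have := Real.add_one_le_exp (-(1 / 3) : ℝ)
      rw [Real.exp_neg, le_inv_comm₀ (by norm_num) (Real.exp_pos _)] at this
      norm_num at this ⊢
      exact this
    exact h1.trans (h2.trans h3)
  have hcard : Nat.card (Fin n → Fin n → Fin (2 * (40 * n ^ 2) + 1)) ≤ 8 ^ n ^ 3 := by
    simp only [Nat.card_eq_fintype_card, Fintype.card_fun, Fintype.card_fin]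
    have : 2 * (40 * n ^ 2) + 1 ≤ 8 ^ n := by
      calc 2 * (40 * n ^ 2) + 1 ≤ n ^ 3 := by nlinarith [pow_pos (show 0 < n by omega) 2]
        _ ≤ (2 ^ n) ^ 3 := Nat.pow_le_pow_left Nat.lt_two_pow_self.le 3
        _ = 8 ^ n := by rw [← pow_mul, mul_comm, pow_mul]; norm_num
    calc ((2 * (40 * n ^ 2) + 1) ^ n) ^ n ≤ ((8 ^ n) ^ n) ^ n := by gcongr
      _ = 8 ^ n ^ 3 := by rw [← pow_mul, ← pow_mul]; ring_nf
  calc (Nat.card (Fin n → Fin n → Fin (2 * (40 * n ^ 2) + 1)) : ℝ) *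
        (1 + 3 * p) ^ (9 * n ^ 3 * k)
      ≤ 8 ^ n ^ 3 * (3 / 2) ^ (9 * n ^ 3) := by
        rw [mul_comm (9 * n ^ 3) k, pow_mul]
        gcongr
        exact_mod_cast hcard
    _ = (8 * (3 / 2) ^ 9) ^ n ^ 3 := by rw [mul_pow, ← pow_mul]
    _ < (2 ^ 9) ^ n ^ 3 := by
        refine pow_lt_pow_left₀ (by norm_num) (by norm_num) (pow_pos (by omega) 3).ne'
    _ = _ := by rw [← pow_mul]

/-- A system of blocks of unit vectors such that every orthogonal map acts almost as a scalar on
one of the blocks and maps the whole system almost orthogonally to the rest of that block. -/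
theorem exists_block_system {n k : ℕ} (hn : 0 < n) (hk : 0 < k)
    (h : (k : ℝ) ≤ 1 / 100 * (n : ℝ) ^ ((1 : ℝ) / 4)) {δ : ℝ} (hδ : δ = 1 / (10 * (k * √k))) :
    ∃ (N : ℕ) (g : Fin N → Fin k → EuclideanSpace ℝ (Fin n)), (∀ j a, ‖g j a‖ = 1) ∧
      ∀ u : EuclideanSpace ℝ (Fin n) ≃ₗᵢ[ℝ] EuclideanSpace ℝ (Fin n),
        ∃ (j : Fin N) (c : ℝ), |c| ≤ 1 ∧ ∀ a, |inner ℝ (g j a) (u (g j a)) - c| ≤ δ ∧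
          ∀ i b, (i, b) ≠ (j, a) →
            |inner ℝ (g j a) (g i b)| ≤ δ ∧ |inner ℝ (g j a) (u (g i b))| ≤ δ := by
  obtain ⟨hkn, hexp⟩ := parameter_bounds hn hk h
  have hn' : (0 : ℝ) < n := by exact_mod_cast hn
  have hk' : (1 : ℝ) ≤ k := by exact_mod_cast hk
  have hk0 : (0 : ℝ) < k := by linarith
  have hδ0 : 0 < δ := by rw [hδ]; positivity
  have hδ2 : δ ^ 2 = 1 / (100 * k ^ 3) := by
    rw [hδ, div_pow, mul_pow, mul_pow, Real.sq_sqrt hk0.le]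
    ring
  have hn81 : 81 ≤ n := by
    have : (81 : ℝ) ≤ n := by nlinarith [one_le_pow₀ hk' (n := 4)]
    exact_mod_cast this
  have hL : 0 < 40 * n ^ 2 := by positivity
  obtain ⟨v, hv⟩ := exists_orthogonal_net n (40 * n ^ 2) hL
  set E := Real.exp (-(n / (800 * k ^ 3))) with hE
  have hEδ : Real.exp (-((δ / 2) ^ 2 * n / 2)) = E := by
    rw [hE, div_pow, hδ2]
    congr 1
    field_simp
    norm_num
  let R : (Fin n → Fin n → Fin (2 * (40 * n ^ 2) + 1)) → (Fin n → Bool) → (Fin n → Bool) → Prop :=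
    fun β x y => δ / 2 < |inner ℝ (signVector x) (signVector y)| ∨
      δ / 2 < |inner ℝ (signVector x) (v β (signVector y))|
  let D : (Fin n → Fin n → Fin (2 * (40 * n ^ 2) + 1)) → (Fin n → Bool) → Prop :=
    fun β x => δ / 2 < |inner ℝ (signVector x) (v β (signVector x)) - meanTrace (v β)|
  have hX : (Nat.card (Fin n → Bool) : ℝ) = 2 ^ n := by simp
  have hR : ∀ β y, (Nat.card {x // R β x y} : ℝ) ≤ 4 * E * Nat.card (Fin n → Bool) := by
    intro β y
    have h1 := card_lt_abs_inner_signVector_le hn (v := signVector y)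
      (norm_signVector hn y).le (half_pos hδ0).le
    have h2 := card_lt_abs_inner_signVector_le hn (v := v β (signVector y))
      (by simp [norm_signVector hn y]) (half_pos hδ0).le
    have h3 : Nat.card {x // R β x y} ≤
        Nat.card {x : Fin n → Bool // δ / 2 < |inner ℝ (signVector x) (signVector y)|} +
          Nat.card {x : Fin n → Bool // δ / 2 < |inner ℝ (signVector x) (v β (signVector y))|} := by
      classical
      simp only [Nat.card_eq_fintype_card, R]
      exact Fintype.card_subtype_or _ _
    have h4 := (Nat.cast_le (α := ℝ)).2 h3
    push_cast at h4
    rw [hEδ] at h1 h2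
    rw [hX]
    linarith
  have hD : ∀ β, (Nat.card {x // D β x} : ℝ) ≤
      800 * k ^ 3 / n * Nat.card (Fin n → Bool) := by
    intro β
    rw [hX]
    refine (card_lt_abs_inner_sub_meanTrace_le hn (v β) (half_pos hδ0)).trans_eq ?_
    rw [div_pow, hδ2]
    field_simp
    norm_num
  have hpk : k * (800 * k ^ 3 / n + (9 * n ^ 3 * k : ℕ) * (4 * E)) ≤ (1 : ℝ) / 9 := by
    have h1 : k * (800 * k ^ 3 / n) ≤ (1 : ℝ) / 100 := by
      rw [← mul_div_assoc, div_le_iff₀ hn']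
      linarith
    have h2 : k * ((9 * n ^ 3 * k : ℕ) * (4 * E)) = 36 * ((n : ℝ) ^ 3 * k ^ 2 * E) := by
      push_cast; ring
    rw [mul_add, h2]
    linarith
  obtain ⟨g, hg⟩ := exists_forall_exists_unmarked_block R D (q := 4 * E) (d := 800 * k ^ 3 / n)
    (by positivity) (by positivity) hR hD (9 * n ^ 3) k le_rfl
    (card_net_mul_lt hn81 (by positivity) hpk)
  refine ⟨9 * n ^ 3, fun j a => signVector (g j a), fun j a => norm_signVector hn _, fun u => ?_⟩
  obtain ⟨β, hβ⟩ := hv u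
  obtain ⟨j, hj⟩ := hg β
  have hηn : n * (1 / ((40 * n ^ 2 : ℕ) : ℝ)) ≤ δ / 4 := by
    have : n * (1 / ((40 * n ^ 2 : ℕ) : ℝ)) = 1 / (40 * n) := by
      push_cast
      field_simp
    rw [this, hδ, div_div]
    refine one_div_le_one_div_of_le (by positivity) ?_
    have h1 : √k ≤ k := Real.sqrt_le_self_iff.2 (Or.inr hk')
    have h2 : (k : ℝ) * √k ≤ k ^ 4 := by
      calc (k : ℝ) * √k ≤ k * k := by gcongr
        _ = k ^ 2 := by ring
        _ ≤ k ^ 4 := pow_le_pow_right₀ hk' (by norm_num)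
    nlinarith
  have hη : 1 / ((40 * n ^ 2 : ℕ) : ℝ) ≤ δ / 4 := by
    refine le_trans ?_ hηn
    refine le_mul_of_one_le_left (by positivity) ?_
    exact_mod_cast hn
  refine ⟨j, meanTrace u, abs_meanTrace_le hn u, fun a => ⟨?_, fun i b hne => ⟨?_, ?_⟩⟩⟩
  · have h1 := not_lt.1 (hj a).1
    have h2 := (abs_inner_signVector_map_sub_le hn hβ (g j a) (g j a)).trans hηn
    have h3 := (abs_meanTrace_sub_le hn hβ).trans hη
    rw [abs_le] at h1 h2 h3 ⊢
    constructor <;> linarith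
  · have h1 := not_lt.1 (not_or.1 ((hj a).2 i b hne)).1
    linarith
  · have h1 := not_lt.1 (not_or.1 ((hj a).2 i b hne)).2
    have h2 := (abs_inner_signVector_map_sub_le hn hβ (g j a) (g i b)).trans hηn
    rw [abs_le] at h1 h2 ⊢
    constructor <;> linarith

theorem le_mul_gauge_of_forall_mem_le {E W : Type*} [AddCommGroup E] [Module ℝ E]
    [SeminormedAddCommGroup W] [NormedSpace ℝ W] {B : Set E} (hB : Absorbent ℝ B) (f : E →ₗ[ℝ] W)
    {C : ℝ} (hC : 0 ≤ C) (hf : ∀ x ∈ B, ‖f x‖ ≤ C) (x : E) : ‖f x‖ ≤ C * gauge B x := by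
  refine le_of_forall_pos_le_add fun η hη => ?_
  obtain ⟨b, hb, hlt, y, hy, rfl⟩ := exists_lt_of_gauge_lt hB
    (lt_add_of_pos_right (gauge B x) (show 0 < η / (C + 1) by positivity))
  simp only [map_smul, norm_smul, Real.norm_of_nonneg hb.le] at hlt ⊢
  calc b * ‖f y‖ ≤ b * C := by gcongr; exact hf y hy
    _ ≤ (gauge B (b • y) + η / (C + 1)) * C := by gcongr
    _ = C * gauge B (b • y) + η * (C / (C + 1)) := by ring
    _ ≤ C * gauge B (b • y) + η := by
        gcongr
        exact mul_le_of_le_one_right hη.le ((div_le_one (by positivity)).2 (by linarith))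

theorem gauge_map_le_norm {E W : Type*} [AddCommGroup E] [Module ℝ E]
    [NormedAddCommGroup W] [NormedSpace ℝ W] {B : Set E} (T : W →ₗ[ℝ] E)
    (hT : ∀ w, ‖w‖ ≤ 1 → T w ∈ B) (w : W) : gauge B (T w) ≤ ‖w‖ := by
  rcases eq_or_ne w 0 with rfl | hw
  · simp
  · have hw' : ‖w‖ ≠ 0 := norm_ne_zero_iff.2 hw
    refine gauge_le_of_mem (norm_nonneg w) ⟨T (‖w‖⁻¹ • w), hT _ ?_, ?_⟩
    · simp [norm_smul, hw']
    · simp [smul_smul, hw']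

/-- A body into which `W` embeds contractively by `T`, and which a left inverse of `T` maps into
the ball of radius `C`, has a `C`-complemented subspace `C`-isomorphic to `W`. -/
theorem exists_complemented_of_leftInverse {n : ℕ} {W : Type*} [NormedAddCommGroup W]
    [NormedSpace ℝ W] {B : Set (EuclideanSpace ℝ (Fin n))} (hB : Absorbent ℝ B) {C : ℝ}
    (hC : 0 < C) (T : W →ₗ[ℝ] EuclideanSpace ℝ (Fin n)) (Q : EuclideanSpace ℝ (Fin n) →ₗ[ℝ] W)
    (hQT : ∀ w, Q (T w) = w) (hT : ∀ w, ‖w‖ ≤ 1 → T w ∈ B) (hQ : ∀ x ∈ B, ‖Q x‖ ≤ C) :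
    ∃ E, GaugeComplementedIn C B E ∧ GaugeIsomorphicTo C W B E := by
  have hQ' := le_mul_gauge_of_forall_mem_le hB Q hC.le hQ
  have hT' := gauge_map_le_norm T hT
  refine ⟨LinearMap.range T, ⟨T ∘ₗ Q, ?_, ?_, fun x => (hT' _).trans (hQ' x)⟩,
    LinearEquiv.ofInjective T (Function.LeftInverse.injective hQT), C⁻¹, inv_pos.2 hC,
    fun w => ⟨?_, ?_⟩⟩
  · ext1 x
    simp [hQT]
  · rw [LinearMap.range_comp_of_range_eq_top]
    exact LinearMap.range_eq_top.2 (Function.RightInverse.surjective hQT)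
  · rw [inv_mul_le_iff₀ hC, LinearEquiv.ofInjective_apply]
    simpa [hQT] using hQ' (T w)
  · rw [mul_inv_cancel_left₀ hC.ne', LinearEquiv.ofInjective_apply]
    exact hT' w

/-- The body spanned by contractive copies of the ball of `W` and a Euclidean ball. -/
def copiesBody {n N : ℕ} {W : Type*} [NormedAddCommGroup W] [NormedSpace ℝ W]
    (T : Fin N → W →ₗ[ℝ] EuclideanSpace ℝ (Fin n)) (r : ℝ) : Set (EuclideanSpace ℝ (Fin n)) :=
  (fun q : (Fin N → W) × EuclideanSpace ℝ (Fin n) => ∑ i, T i (q.1 i) + q.2) ''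
    {q | ∑ i, ‖q.1 i‖ ≤ 1 ∧ ‖q.2‖ ≤ r}

section copiesBody

variable {n N : ℕ} {W : Type*} [NormedAddCommGroup W] [NormedSpace ℝ W]
  (T : Fin N → W →ₗ[ℝ] EuclideanSpace ℝ (Fin n)) (r : ℝ)

theorem isCompact_copiesBody [FiniteDimensional ℝ W] : IsCompact (copiesBody T r) := by
  have hT : ∀ i, Continuous (T i) := fun i => (T i).continuous_of_finiteDimensional
  refine IsCompact.image ?_ (by fun_prop)
  have : ProperSpace W := FiniteDimensional.proper ℝ W
  refine (isCompact_closedBall (0 : (Fin N → W) × EuclideanSpace ℝ (Fin n))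
    (max 1 r)).of_isClosed_subset ?_ ?_
  · refine IsClosed.and (isClosed_le ?_ continuous_const) (isClosed_le ?_ continuous_const)
    all_goals fun_prop
  · rintro ⟨w, z⟩ ⟨hw, hz⟩
    rw [mem_closedBall_zero_iff, Prod.norm_def]
    refine max_le_max ?_ hz
    refine (pi_norm_le_iff_of_nonneg zero_le_one).2 fun i => le_trans ?_ hw
    exact Finset.single_le_sum (f := fun i => ‖w i‖) (fun _ _ => norm_nonneg _) (Finset.mem_univ i)

theorem convex_copiesBody : Convex ℝ (copiesBody T r) := by
  rintro _ ⟨⟨w, z⟩, ⟨hw, hz⟩, rfl⟩ _ ⟨⟨w', z'⟩, ⟨hw', hz'⟩, rfl⟩ a b ha hb hab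
  refine ⟨(a • w + b • w', a • z + b • z'), ⟨?_, ?_⟩, ?_⟩
  · calc ∑ i, ‖a • w i + b • w' i‖ ≤ ∑ i, (a * ‖w i‖ + b * ‖w' i‖) := by
          refine Finset.sum_le_sum fun i _ => (norm_add_le _ _).trans_eq ?_
          rw [norm_smul, norm_smul, Real.norm_of_nonneg ha, Real.norm_of_nonneg hb]
      _ = a * ∑ i, ‖w i‖ + b * ∑ i, ‖w' i‖ := by
          rw [Finset.sum_add_distrib, Finset.mul_sum, Finset.mul_sum]
      _ ≤ a * 1 + b * 1 := by gcongr
      _ = 1 := by linarith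
  · calc ‖a • z + b • z'‖ ≤ a * ‖z‖ + b * ‖z'‖ := by
          refine (norm_add_le _ _).trans_eq ?_
          rw [norm_smul, norm_smul, Real.norm_of_nonneg ha, Real.norm_of_nonneg hb]
      _ ≤ a * r + b * r := by gcongr
      _ = r := by rw [← add_mul, hab, one_mul]
  · simp only [Pi.add_apply, Pi.smul_apply, map_add, map_smul, Finset.sum_add_distrib, smul_add,
      Finset.smul_sum]
    abel

theorem neg_copiesBody : copiesBody T r = -copiesBody T r := by
  have h : ∀ x ∈ copiesBody T r, -x ∈ copiesBody T r := by
    rintro _ ⟨⟨w, z⟩, ⟨hw, hz⟩, rfl⟩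
    refine ⟨(-w, -z), ⟨by simpa using hw, by simpa using hz⟩, ?_⟩
    simp [add_comm]
  ext x
  exact ⟨fun hx => h x hx, fun hx => by simpa using h _ hx⟩

theorem closedBall_subset_copiesBody : Metric.closedBall 0 r ⊆ copiesBody T r := fun z hz =>
  ⟨(0, z), ⟨by simp, by simpa using hz⟩, by simp⟩

theorem map_mem_copiesBody {r : ℝ} (hr : 0 ≤ r) (j : Fin N) {w : W} (hw : ‖w‖ ≤ 1) :
    T j w ∈ copiesBody T r := by
  classical
  refine ⟨(Pi.single j w, 0), ⟨?_, by simpa using hr⟩, ?_⟩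
  · rw [Finset.sum_eq_single j] <;> simp +contextual [hw]
  · dsimp only
    rw [Finset.sum_eq_single j] <;> simp +contextual

theorem norm_map_le_of_mem_copiesBody
    {T : Fin N → W →ₗ[ℝ] EuclideanSpace ℝ (Fin n)} {r : ℝ} {V : Type*} [SeminormedAddCommGroup V]
    [NormedSpace ℝ V] (f : EuclideanSpace ℝ (Fin n) →ₗ[ℝ] V) {α β : ℝ} (hα : 0 ≤ α)
    (hT : ∀ i w, ‖f (T i w)‖ ≤ α * ‖w‖) (hf : ∀ z, ‖z‖ ≤ r → ‖f z‖ ≤ β)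
    {x : EuclideanSpace ℝ (Fin n)} (hx : x ∈ copiesBody T r) : ‖f x‖ ≤ α + β := by
  obtain ⟨⟨w, z⟩, ⟨hw, hz⟩, rfl⟩ := hx
  simp only [map_add, map_sum]
  refine (norm_add_le _ _).trans (add_le_add ?_ (hf z hz))
  calc ‖∑ i, f (T i (w i))‖ ≤ ∑ i, α * ‖w i‖ := norm_sum_le_of_le _ fun i _ => hT i _
    _ = α * ∑ i, ‖w i‖ := (Finset.mul_sum _ _ _).symm
    _ ≤ α := mul_le_of_le_one_right hα hw

end copiesBody

/-- An almost inverse `f` of one of the copies yields the complemented subspace. -/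
theorem exists_complemented_of_almost_leftInverse {n N : ℕ} {W : Type*} [NormedAddCommGroup W]
    [NormedSpace ℝ W] [FiniteDimensional ℝ W] (T : Fin N → W →ₗ[ℝ] EuclideanSpace ℝ (Fin n))
    {r : ℝ} (hr : 0 < r) (u : EuclideanSpace ℝ (Fin n) ≃ₗᵢ[ℝ] EuclideanSpace ℝ (Fin n))
    (j : Fin N) {c : ℝ} (hc : |c| ≤ 1) (f : EuclideanSpace ℝ (Fin n) →ₗ[ℝ] W)
    (hj : ∀ w, ‖f (T j w) - w‖ ≤ 1 / 10 * ‖w‖)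
    (hi : ∀ i, i ≠ j → ∀ w, ‖f (T i w)‖ ≤ 1 / 10 * ‖w‖)
    (huj : ∀ w, ‖f (u (T j w)) - c • w‖ ≤ 1 / 10 * ‖w‖)
    (hui : ∀ i, i ≠ j → ∀ w, ‖f (u (T i w))‖ ≤ 1 / 10 * ‖w‖)
    (hf : ∀ z, ‖z‖ ≤ r → ‖f z‖ ≤ 1 / 10) :
    ∃ E, GaugeComplementedIn 3 (copiesBody T r + u '' copiesBody T r) E ∧
      GaugeIsomorphicTo 3 W (copiesBody T r + u '' copiesBody T r) E := by
  have hzero : (0 : EuclideanSpace ℝ (Fin n)) ∈ copiesBody T r :=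
    closedBall_subset_copiesBody T r (by simpa using hr.le)
  have hsub : copiesBody T r ⊆ copiesBody T r + u '' copiesBody T r := fun x hx =>
    ⟨x, hx, 0, ⟨0, hzero, map_zero u⟩, add_zero x⟩
  have hlow : ∀ w, 9 / 10 * ‖w‖ ≤ ‖f (T j w)‖ := fun w => by
    have := norm_sub_norm_le w (f (T j w))
    rw [norm_sub_rev] at this
    linarith [hj w]
  have hinj : Function.Injective (f ∘ₗ T j) := by
    refine (injective_iff_map_eq_zero _).2 fun w hw => norm_le_zero_iff.1 ?_
    have := hlow w
    rw [← LinearMap.comp_apply, hw, norm_zero] at this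
    linarith
  let G : W ≃ₗ[ℝ] W := LinearEquiv.ofInjectiveEndo (f ∘ₗ T j) hinj
  have hG : ∀ w, G w = f (T j w) := fun w => rfl
  have hGsymm : ∀ w, ‖G.symm w‖ ≤ 10 / 9 * ‖w‖ := fun w => by
    have := hlow (G.symm w)
    rw [← hG, G.apply_symm_apply] at this
    linarith
  refine exists_complemented_of_leftInverse ?_ (by norm_num) (T j) (G.symm.toLinearMap ∘ₗ f) ?_
    (fun w hw => hsub (map_mem_copiesBody T hr.le j hw)) ?_
  · refine absorbent_nhds_zero (Filter.mem_of_superset (Metric.closedBall_mem_nhds 0 hr) ?_)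
    exact (closedBall_subset_copiesBody T r).trans hsub
  · intro w
    simp [← hG]
  · rintro _ ⟨x, hx, _, ⟨y, hy, rfl⟩, rfl⟩
    have h1 : ‖f x‖ ≤ 11 / 10 + 1 / 10 := by
      refine norm_map_le_of_mem_copiesBody f (by norm_num) (fun i w => ?_) hf hx
      by_cases h : i = j
      · subst h
        have := norm_le_norm_add_norm_sub' (f (T i w)) w
        linarith [hj w]
      · linarith [hi i h w, norm_nonneg w]
    have h2 : ‖f (u y)‖ ≤ 11 / 10 + 1 / 10 := by
      refine norm_map_le_of_mem_copiesBody (f ∘ₗ u.toLinearEquiv.toLinearMap) (by norm_num)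
        (fun i w => ?_) (fun z hz => hf (u z) (by simpa using hz)) hy
      by_cases h : i = j
      · subst h
        have h3 := norm_le_norm_add_norm_sub' (f (u (T i w))) (c • w)
        have h4 : ‖c • w‖ ≤ ‖w‖ := by
          rw [norm_smul]
          exact mul_le_of_le_one_left (norm_nonneg w) hc
        have := huj w
        simp only [LinearMap.comp_apply, LinearEquiv.coe_coe, LinearIsometryEquiv.coe_toLinearEquiv]
        linarith
      · have := hui i h w
        simp only [LinearMap.comp_apply, LinearEquiv.coe_coe, LinearIsometryEquiv.coe_toLinearEquiv]
        linarith [norm_nonneg w]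
    have h3 := hGsymm (f (x + u y))
    have h4 : ‖f (x + u y)‖ ≤ ‖f x‖ + ‖f (u y)‖ := by
      rw [map_add]
      exact norm_add_le _ _
    simp only [LinearMap.comp_apply, LinearEquiv.coe_coe]
    linarith

theorem norm_le_of_entries_le {k : ℕ} {δ : ℝ} (hδ : 0 ≤ δ) (A : Fin k → Fin k → ℝ)
    (hA : ∀ a b, |A a b| ≤ δ) (x : EuclideanSpace ℝ (Fin k)) :
    ‖(WithLp.toLp 2 fun a => ∑ b, A a b * x b : EuclideanSpace ℝ (Fin k))‖ ≤ k * δ * ‖x‖ := by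
  refine le_of_sq_le_sq ?_ (by positivity)
  rw [EuclideanSpace.real_norm_sq_eq, mul_pow, EuclideanSpace.real_norm_sq_eq x]
  calc ∑ a, (∑ b, A a b * x b) ^ 2 ≤ ∑ _a : Fin k, (k * δ ^ 2) * ∑ b, x b ^ 2 := by
        refine Finset.sum_le_sum fun a _ =>
          (Finset.sum_mul_sq_le_sq_mul_sq _ _ _).trans ?_
        gcongr
        calc ∑ b, A a b ^ 2 ≤ ∑ _b : Fin k, δ ^ 2 := by
              refine Finset.sum_le_sum fun b _ => ?_
              rw [← sq_abs]
              exact pow_le_pow_left₀ (abs_nonneg _) (hA a b) 2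
          _ = k * δ ^ 2 := by simp
    _ = _ := by simp; ring

/-- **Global saturation (Theorem 2.2).** There is `c > 0` such that for all `n, k` with
`k ≤ c n^{1/4}` and every `k`-dimensional normed space `W` there is a symmetric convex
body `K ⊂ ℝⁿ` such that for every orthogonal `u ∈ O(n)`, the normed space whose unit
ball is `K + u(K)` contains a `3`-complemented subspace `3`-isomorphic to `W`. -/
theorem global_saturation :
    ∃ c : ℝ, 0 < c ∧
    ∀ n k : ℕ, 0 < n → 0 < k → (k : ℝ) ≤ c * (n : ℝ) ^ ((1 : ℝ)/4) →
    ∀ (W : Type) (_ : NormedAddCommGroup W) (_ : NormedSpace ℝ W),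
      FiniteDimensional ℝ W → Module.finrank ℝ W = k →
    ∃ K : Set (EuclideanSpace ℝ (Fin n)),
      IsCompact K ∧ Convex ℝ K ∧ (interior K).Nonempty ∧ K = -K ∧
      ∀ u : EuclideanSpace ℝ (Fin n) ≃ₗᵢ[ℝ] EuclideanSpace ℝ (Fin n),
        ∃ E : Submodule ℝ (EuclideanSpace ℝ (Fin n)),
          GaugeComplementedIn 3 (K + ⇑u '' K) E ∧
          GaugeIsomorphicTo 3 W (K + ⇑u '' K) E := by
  refine ⟨1 / 100, by norm_num, fun n k hn hk hkn W _ _ _ hW => ?_⟩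
  obtain ⟨S, hS⟩ := exists_linearEquiv_euclideanSpace hk hW
  have hk0 : (0 : ℝ) < k := by exact_mod_cast hk
  set δ : ℝ := 1 / (10 * (k * √k)) with hδ
  have hδ0 : 0 < δ := by positivity
  have hδk : √k * (k * δ) = 1 / 10 := by
    rw [hδ]
    field_simp
  obtain ⟨N, g, hg, hblock⟩ := exists_block_system hn hk hkn hδ
  let T : Fin N → W →ₗ[ℝ] EuclideanSpace ℝ (Fin n) := fun j =>
    Fintype.linearCombination ℝ (g j) ∘ₗ (WithLp.linearEquiv 2 ℝ (Fin k → ℝ)).toLinearMap ∘ₗ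
      S.toLinearMap
  have hT : ∀ j w, T j w = ∑ a, S w a • g j a := fun j w => rfl
  have hSsymm : ∀ x, ‖S.symm x‖ ≤ √k * ‖x‖ := fun x => by
    simpa using (hS (S.symm x)).2
  let A : Fin N → EuclideanSpace ℝ (Fin n) →ₗ[ℝ] EuclideanSpace ℝ (Fin k) := fun j =>
    (WithLp.linearEquiv 2 ℝ (Fin k → ℝ)).symm.toLinearMap ∘ₗ
      LinearMap.pi fun a => (innerSL ℝ (g j a)).toLinearMap
  have hA : ∀ j x, A j x = WithLp.toLp 2 fun a => inner ℝ (g j a) x := fun j x => rfl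
  -- a map which is entrywise close to a scalar is close to this scalar on `W`
  have hentry : ∀ (j i : Fin N) (v : EuclideanSpace ℝ (Fin n) →ₗ[ℝ] EuclideanSpace ℝ (Fin n))
      (c : ℝ), (∀ a b, |inner ℝ (g j a) (v (g i b)) - if a = b then c else 0| ≤ δ) →
      ∀ w, ‖(S.symm.toLinearMap ∘ₗ A j) (v (T i w)) - c • w‖ ≤ 1 / 10 * ‖w‖ := by
    intro j i v c h w
    have h1 : (S.symm.toLinearMap ∘ₗ A j) (v (T i w)) - c • w = S.symm (WithLp.toLp 2 fun a =>
        ∑ b, (inner ℝ (g j a) (v (g i b)) - if a = b then c else 0) * S w b) := by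
      apply S.injective
      ext a
      simp [hA, hT, mul_comm, mul_sub, Finset.sum_sub_distrib]
    rw [h1]
    calc _ ≤ √k * (k * δ * ‖S w‖) := (hSsymm _).trans (by
          gcongr
          exact norm_le_of_entries_le hδ0.le _ h (S w))
      _ = 1 / 10 * ‖S w‖ := by rw [← hδk]; ring
      _ ≤ _ := by gcongr; exact (hS w).1
  refine ⟨copiesBody T δ, isCompact_copiesBody T δ, convex_copiesBody T δ, ⟨0, ?_⟩,
    neg_copiesBody T δ, fun u => ?_⟩
  · exact mem_interior_iff_mem_nhds.2 (Filter.mem_of_superset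
      (Metric.closedBall_mem_nhds 0 hδ0) (closedBall_subset_copiesBody T δ))
  obtain ⟨j, c, hc, hj⟩ := hblock u
  refine exists_complemented_of_almost_leftInverse T hδ0 u j hc (S.symm.toLinearMap ∘ₗ A j)
    (fun w => ?_) (fun i hij w => ?_) (hentry j j u.toLinearEquiv.toLinearMap c fun a b => ?_)
    (fun i hij w => ?_) fun z hz => ?_
  · have := hentry j j LinearMap.id 1 (fun a b => ?_) w
    · simpa using this
    · by_cases hab : a = b
      · subst hab
        simp [hg, hδ0.le]
      · simpa [hab] using ((hj a).2 j b (by simp [Ne.symm hab])).1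
  · have := hentry j i LinearMap.id 0 (fun a b => ?_) w
    · simpa using this
    · simpa using ((hj a).2 i b (by simp [hij])).1
  · by_cases hab : a = b
    · subst hab
      simpa using (hj a).1
    · simpa [hab] using ((hj a).2 j b (by simp [Ne.symm hab])).2
  · have := hentry j i u.toLinearEquiv.toLinearMap 0 (fun a b => ?_) w
    · simpa using this
    · simpa using ((hj a).2 i b (by simp [hij])).2
  · have h1 : ‖A j z‖ ≤ k * δ := by
      refine le_of_sq_le_sq ?_ (by positivity)
      rw [hA, EuclideanSpace.real_norm_sq_eq]
      calc ∑ a, (inner ℝ (g j a) z) ^ 2 ≤ ∑ _a : Fin k, δ ^ 2 := by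
            refine Finset.sum_le_sum fun a _ => ?_
            rw [← sq_abs]
            refine pow_le_pow_left₀ (abs_nonneg _) ((abs_real_inner_le_norm _ _).trans ?_) 2
            rwa [hg, one_mul]
        _ = k * δ ^ 2 := by simp
        _ ≤ k ^ 2 * δ ^ 2 := by
            gcongr
            exact le_self_pow₀ (by exact_mod_cast hk) two_ne_zero
        _ = (k * δ) ^ 2 := by ring
    calc ‖S.symm (A j z)‖ ≤ √k * (k * δ) := (hSsymm _).trans (by gcongr)
      _ = 1 / 10 := hδk
end

section
/- Let N be a positive integer and let Λ = (λ_{ij}) be an N × N real matrix such that (1°) 0 ≤ λ_{ij} ≤ 1 for all i, j; (2°) Σ_{i=1}^N λ_{ij} = 1 for every j; (3°) λ_{jj} = 0 for every j. Then there exists a subset J ⊂ {1, …, N} with |J| ≥ N/3 such that for every j ∈ J one has Σ_{i ∉ J} λ_{ij} ≥ 1/3. -/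
open Finset

section Decoupling

variable {ι κ : Type*} [Fintype ι] [DecidableEq ι] [DecidableEq κ]

/-- The monochromatic weight of a colouring, split into the pairs avoiding `j` and those
containing `j`. -/
theorem sum_monochromatic_eq (A : ι → ι → ℝ) (hsymm : ∀ i j, A i j = A j i)
    (hdiag : ∀ i, A i i = 0) (g : ι → κ) (j : ι) :
    ∑ i, ∑ k, (if g i = g k then A i k else 0) =
      ∑ i ∈ univ.erase j, ∑ k ∈ univ.erase j, (if g i = g k then A i k else 0) +
        2 * ∑ i ∈ univ.erase j, (if g i = g j then A i j else 0) := by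
  have hrow : ∀ i, ∑ k, (if g i = g k then A i k else 0) =
      ∑ k ∈ univ.erase j, (if g i = g k then A i k else 0) +
        (if g i = g j then A i j else 0) := fun i =>
    (sum_erase_add _ _ (mem_univ j)).symm
  have hcol : ∑ k ∈ univ.erase j, (if g j = g k then A j k else 0) =
      ∑ i ∈ univ.erase j, (if g i = g j then A i j else 0) :=
    sum_congr rfl fun k _ => by simp only [hsymm j k, eq_comm]
  rw [← sum_erase_add _ _ (mem_univ j), hrow j, hcol, sum_congr rfl fun i _ => hrow i,
    sum_add_distrib, hdiag]
  simp only [if_true]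
  ring

/-- A colouring of minimal monochromatic weight gives every vertex at most its fair share of
weight inside its own colour class. -/
theorem exists_coloring_card_mul_sum_le [Fintype κ] [Nonempty κ] (A : ι → ι → ℝ)
    (hsymm : ∀ i j, A i j = A j i) (hdiag : ∀ i, A i i = 0) :
    ∃ f : ι → κ, ∀ j,
      Fintype.card κ * ∑ i, (if f i = f j then A i j else 0) ≤ ∑ i, A i j := by
  obtain ⟨f, hf⟩ := Finite.exists_min
    fun g : ι → κ => ∑ i, ∑ k, (if g i = g k then A i k else 0)
  refine ⟨f, fun j => ?_⟩
  have hfull : ∀ c : κ, ∑ i ∈ univ.erase j, (if f i = c then A i j else 0) =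
      ∑ i, (if f i = c then A i j else 0) := fun c =>
    sum_erase _ (by simp [hdiag])
  have hmin : ∀ c : κ, ∑ i, (if f i = f j then A i j else 0) ≤
      ∑ i, (if f i = c then A i j else 0) := by
    intro c
    have h := hf (Function.update f j c)
    simp only [sum_monochromatic_eq A hsymm hdiag _ j] at h
    have hout : ∑ i ∈ univ.erase j, ∑ k ∈ univ.erase j,
        (if Function.update f j c i = Function.update f j c k then A i k else 0) =
        ∑ i ∈ univ.erase j, ∑ k ∈ univ.erase j, (if f i = f k then A i k else 0) :=
      sum_congr rfl fun i hi => sum_congr rfl fun k hk => by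
        rw [Function.update_of_ne (ne_of_mem_erase hi),
          Function.update_of_ne (ne_of_mem_erase hk)]
    have hin : ∑ i ∈ univ.erase j,
        (if Function.update f j c i = Function.update f j c j then A i j else 0) =
        ∑ i ∈ univ.erase j, (if f i = c then A i j else 0) :=
      sum_congr rfl fun i hi => by
        rw [Function.update_of_ne (ne_of_mem_erase hi), Function.update_self]
    rw [hout, hin, hfull, hfull] at h
    linarith
  calc Fintype.card κ * ∑ i, (if f i = f j then A i j else 0)
      = ∑ _c : κ, ∑ i, (if f i = f j then A i j else 0) := by simp
    _ ≤ ∑ c : κ, ∑ i, (if f i = c then A i j else 0) := sum_le_sum fun c _ => hmin c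
    _ = ∑ i, A i j := by rw [sum_comm]; simp

/-- A column-stochastic matrix with positive off-diagonal entries has a positive stationary
vector. -/
theorem exists_pos_stationary [Nonempty ι] (P : ι → ι → ℝ) (hnonneg : ∀ i j, 0 ≤ P i j)
    (hpos : ∀ i j, i ≠ j → 0 < P i j) (hcol : ∀ j, ∑ i, P i j = 1) :
    ∃ w : ι → ℝ, (∀ i, 0 < w i) ∧ ∀ i, ∑ j, P i j * w j = w i := by
  obtain ⟨u, hu0, hu⟩ : ∃ u : ι → ℝ, u ≠ 0 ∧ Matrix.mulVec (Matrix.of P - 1) u = 0 := by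
    rw [Matrix.exists_mulVec_eq_zero_iff, ← Matrix.exists_vecMul_eq_zero_iff]
    refine ⟨1, one_ne_zero, ?_⟩
    rw [Matrix.vecMul_sub, Matrix.vecMul_one, sub_eq_zero]
    ext j
    simp [Matrix.vecMul, dotProduct, hcol]
  have hfix : ∀ i, ∑ j, P i j * u j = u i := by
    intro i
    have h := congrFun hu i
    rw [Matrix.sub_mulVec, Matrix.one_mulVec] at h
    simpa [Matrix.mulVec, dotProduct, sub_eq_zero] using h
  have hle : ∀ i ∈ univ, |u i| ≤ ∑ j, P i j * |u j| := by
    intro i _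
    calc |u i| = |∑ j, P i j * u j| := by rw [hfix]
      _ ≤ ∑ j, |P i j * u j| := abs_sum_le_sum_abs _ _
      _ = ∑ j, P i j * |u j| := by simp only [abs_mul, abs_of_nonneg (hnonneg _ _)]
  have htotal : ∑ i, |u i| = ∑ i, ∑ j, P i j * |u j| := by
    rw [sum_comm]
    simp only [← sum_mul, hcol, one_mul]
  have habs := (sum_eq_sum_iff_of_le hle).1 htotal
  refine ⟨fun i => |u i|, fun i => abs_pos.2 fun hi => hu0 ?_,
    fun i => (habs i (mem_univ i)).symm⟩
  have hzero := habs i (mem_univ i)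
  rw [hi, abs_zero, eq_comm, sum_eq_zero_iff_of_nonneg
    fun j _ => mul_nonneg (hnonneg i j) (abs_nonneg _)] at hzero
  ext j
  by_cases hij : i = j
  · simpa [← hij] using hi
  · simpa [(hpos i j hij).ne'] using hzero j (mem_univ j)

/-- The decoupling property for matrices with positive off-diagonal entries. -/
theorem exists_decoupled_of_pos [Nonempty ι] (P : ι → ι → ℝ) (hdiag : ∀ i, P i i = 0)
    (hpos : ∀ i j, i ≠ j → 0 < P i j) (hcol : ∀ j, ∑ i, P i j = 1) :
    ∃ J : Finset ι, (Fintype.card ι : ℝ) / 3 ≤ #J ∧ ∀ j ∈ J, 1 / 3 ≤ ∑ i ∈ Jᶜ, P i j := by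
  have hnonneg : ∀ i j, 0 ≤ P i j := fun i j => by
    by_cases hij : i = j
    · simp [hij, hdiag]
    · exact (hpos i j hij).le
  obtain ⟨w, hw, hstat⟩ := exists_pos_stationary P hnonneg hpos hcol
  obtain ⟨f, hf⟩ := exists_coloring_card_mul_sum_le (κ := Fin 3)
    (fun i j => P i j * w j + P j i * w i) (fun _ _ => add_comm _ _) (fun i => by simp [hdiag])
  have hclass : ∀ j, ∑ i with f i = f j, P i j ≤ 2 / 3 := by
    intro j
    have htotal : ∑ i, (P i j * w j + P j i * w i) = 2 * w j := by
      rw [sum_add_distrib, hstat, ← sum_mul, hcol]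
      ring
    have hpart : (∑ i with f i = f j, P i j) * w j ≤
        ∑ i, (if f i = f j then P i j * w j + P j i * w i else 0) := by
      rw [← sum_filter, sum_mul]
      exact sum_le_sum fun i _ => le_add_of_nonneg_right (mul_nonneg (hnonneg _ _) (hw i).le)
    have h := hf j
    rw [htotal, Fintype.card_fin] at h
    push_cast at h
    refine le_of_mul_le_mul_right ?_ (hw j)
    linarith
  obtain ⟨c, -, hc⟩ := exists_le_card_fiber_of_nsmul_le_card_of_maps_to
    (s := (univ : Finset ι)) (t := (univ : Finset (Fin 3))) (f := f)
    (b := (Fintype.card ι : ℝ) / 3) (fun _ _ => mem_univ _) univ_nonempty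
    (by simp only [card_univ, Fintype.card_fin, nsmul_eq_mul]; push_cast; linarith)
  refine ⟨univ.filter fun i => f i = c, hc, fun j hj => ?_⟩
  have hadd := sum_add_sum_compl (univ.filter fun i => f i = c) fun i => P i j
  have hle := hclass j
  rw [(mem_filter.1 hj).2] at hle
  rw [hcol] at hadd
  linarith

end Decoupling

/-- **Decoupling lemma.** For an `N × N` matrix `Λ` with entries in `[0,1]`, columns summing
to `1`, and zero diagonal, there is a subset `J` of the indices with `|J| ≥ N/3` such that
for every `j ∈ J` one has `∑_{i ∉ J} Λ i j ≥ 1/3`. -/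
theorem decoupling_lemma (N : ℕ) (hN : 0 < N) (Λ : Fin N → Fin N → ℝ)
    (h01 : ∀ i j, 0 ≤ Λ i j ∧ Λ i j ≤ 1)
    (hcol : ∀ j, ∑ i, Λ i j = 1)
    (hdiag : ∀ j, Λ j j = 0) :
    ∃ J : Finset (Fin N), (N : ℝ) / 3 ≤ J.card ∧
      ∀ j ∈ J, (1 : ℝ) / 3 ≤ ∑ i ∈ Jᶜ, Λ i j := by
  have : Nonempty (Fin N) := ⟨⟨0, hN⟩⟩
  have hN1 : (0 : ℝ) < N - 1 := by
    have hne : N ≠ 1 := by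
      rintro rfl
      simpa [hdiag] using hcol 0
    have h : 1 < N := by omega
    exact sub_pos.2 (by exact_mod_cast h)
  -- Perturb `Λ` towards the uniform matrix; the parameters with the property form a closed set.
  let P : ℝ → Fin N → Fin N → ℝ := fun t i j =>
    (1 - t) * Λ i j + t * (if i = j then 0 else ((N : ℝ) - 1)⁻¹)
  let S : Set ℝ := ⋃ J : Finset (Fin N),
    {t | (N : ℝ) / 3 ≤ #J ∧ ∀ j ∈ J, 1 / 3 ≤ ∑ i ∈ Jᶜ, P t i j}
  have hclosed : IsClosed S := by
    refine isClosed_iUnion_of_finite fun J => ?_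
    simp only [Set.ofPred_and, Set.ofPred_forall]
    exact isClosed_const.inter <| isClosed_iInter fun j => isClosed_iInter fun _ =>
      isClosed_le continuous_const (by fun_prop)
  have hunif : ∀ j : Fin N, ∑ i, (if i = j then 0 else ((N : ℝ) - 1)⁻¹) = 1 := by
    intro j
    rw [← sum_erase_add _ _ (mem_univ j),
      sum_congr rfl fun i hi => if_neg (ne_of_mem_erase hi)]
    rw [sum_const, card_erase_of_mem (mem_univ j), card_univ, Fintype.card_fin, nsmul_eq_mul,
      Nat.cast_pred hN, mul_inv_cancel₀ hN1.ne']
    simp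
  have hsub : Set.Ioo (0 : ℝ) 1 ⊆ S := by
    rintro t ⟨ht0, ht1⟩
    have h := exists_decoupled_of_pos (P t) (fun i => by simp [P, hdiag])
      (fun i j hij => by
        simp only [P, if_neg hij]
        exact add_pos_of_nonneg_of_pos (mul_nonneg (sub_nonneg.2 ht1.le) (h01 i j).1)
          (mul_pos ht0 (inv_pos.2 hN1)))
      (fun j => by
        simp only [P]
        rw [sum_add_distrib, ← mul_sum, ← mul_sum, hcol, hunif]
        ring)
    rw [Fintype.card_fin] at h
    exact Set.mem_iUnion.2 h
  have hzero : (0 : ℝ) ∈ S := by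
    refine hclosed.closure_subset_iff.2 hsub ?_
    rw [closure_Ioo zero_ne_one]
    exact Set.left_mem_Icc.2 zero_le_one
  simpa [S, P] using hzero
end

section
/- There exists a universal constant c > 0 such that the following holds. Let n, m₀, k be positive integers satisfying √(n·log n) ≤ m₀ ≤ n and k ≤ c·m₀/√(n·log n). Then for every k-dimensional real normed space W there exists an n-dimensional real normed space X such that every quotient space X̃ of X (quotient of X by a linear subspace, equipped with the quotient norm) with dim X̃ ≥ m₀ contains a subspace which is 1-complemented in X̃ and isometric to W. -/
/-- The subspace `E` of `Y` is isometric to `W`: there is a linear bijection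
`T : W → E` with `‖T w‖ = ‖w‖` for all `w`. -/
def IsometricTo (W : Type*) [SeminormedAddCommGroup W] [NormedSpace ℝ W]
    {Y : Type*} [SeminormedAddCommGroup Y] [NormedSpace ℝ Y] (E : Submodule ℝ Y) : Prop :=
  ∃ T : W ≃ₗ[ℝ] E, ∀ w : W, ‖(T w : Y)‖ = ‖w‖

/-- The subspace `E` is `C`-complemented in `Y`: there is a linear projection of `Y`
onto `E` of norm at most `C`. -/
def ComplementedIn (C : ℝ) {Y : Type*} [SeminormedAddCommGroup Y] [NormedSpace ℝ Y]
    (E : Submodule ℝ Y) : Prop :=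
  ∃ P : Y →ₗ[ℝ] Y, P ∘ₗ P = P ∧ LinearMap.range P = E ∧ ∀ y, ‖P y‖ ≤ C * ‖y‖

open Matrix in
theorem dotProduct_self_nonneg {ι : Type*} [Fintype ι] (v : ι → ℝ) : 0 ≤ v ⬝ᵥ v :=
  Finset.sum_nonneg fun _ _ => mul_self_nonneg _

open Matrix in
/-- The Cauchy–Schwarz inequality for the dot product. -/
theorem dotProduct_sq_le {ι : Type*} [Fintype ι] (v w : ι → ℝ) :
    (v ⬝ᵥ w) ^ 2 ≤ (v ⬝ᵥ v) * (w ⬝ᵥ w) := by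
  simp only [dotProduct, ← sq]
  exact Finset.sum_mul_sq_le_sq_mul_sq _ _ _

/-- A linear map on `V` that vanishes on `Z` and is contractive induces a contractive map
on `V ⧸ Z`. -/
theorem norm_liftQ_le {V W : Type*} [SeminormedAddCommGroup V] [NormedSpace ℝ V]
    [SeminormedAddCommGroup W] [NormedSpace ℝ W] (Z : Submodule ℝ V) (T : V →ₗ[ℝ] W)
    (hZ : Z ≤ LinearMap.ker T) (hT : ∀ v, ‖T v‖ ≤ ‖v‖) (y : V ⧸ Z) :
    ‖Z.liftQ T hZ y‖ ≤ ‖y‖ := by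
  refine le_of_forall_pos_le_add fun ε hε => ?_
  obtain ⟨v, rfl, hv⟩ := Submodule.Quotient.norm_mk_lt y hε
  rw [Submodule.liftQ_apply]
  exact (hT v).trans hv.le

/-- If `W` factors contractively through `Y`, then `Y` contains a `1`-complemented isometric
copy of `W`. -/
theorem exists_complemented_isometric_of_factorization {W Y : Type*} [NormedAddCommGroup W]
    [NormedSpace ℝ W] [SeminormedAddCommGroup Y] [NormedSpace ℝ Y]
    (J : W →ₗ[ℝ] Y) (T : Y →ₗ[ℝ] W) (hJ : ∀ w, ‖J w‖ ≤ ‖w‖) (hT : ∀ y, ‖T y‖ ≤ ‖y‖)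
    (hTJ : ∀ w, T (J w) = w) :
    ∃ E : Submodule ℝ Y, ComplementedIn 1 E ∧ IsometricTo W E := by
  have hinj : Function.Injective J := Function.LeftInverse.injective hTJ
  refine ⟨LinearMap.range J, ⟨J ∘ₗ T, ?_, ?_, ?_⟩, LinearEquiv.ofInjective J hinj, ?_⟩
  · ext y
    simp [hTJ]
  · rw [LinearMap.range_comp_of_range_eq_top]
    exact LinearMap.range_eq_top.2 (Function.RightInverse.surjective hTJ)
  · intro y
    rw [one_mul]
    exact (hJ _).trans (hT y)
  · intro w
    refine le_antisymm (hJ w) ?_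
    conv_lhs => rw [← hTJ w]
    exact hT _

/-- Let `S i : W → F` be linear maps whose ranges span `F`. Quotients of the `ℓ₁`-sum quotient
norm on `F` contain a `1`-complemented copy of `W` as soon as some `S j` has a left inverse that
is contractive on all the `S i` and vanishes on the kernel of the quotient map. -/
theorem exists_normed_space_of_span {ι W F : Type} [Fintype ι] [NormedAddCommGroup W]
    [NormedSpace ℝ W] [FiniteDimensional ℝ W] [AddCommGroup F] [Module ℝ F] [FiniteDimensional ℝ F]
    (S : ι → W →ₗ[ℝ] F) (m : ℕ) (hspan : ⨆ i, LinearMap.range (S i) = ⊤)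
    (hS : ∀ Z : Submodule ℝ F, m ≤ Module.finrank ℝ (F ⧸ Z) →
      ∃ (j : ι) (T : F →ₗ[ℝ] W), Z ≤ LinearMap.ker T ∧ (∀ w, T (S j w) = w) ∧
        ∀ i w, ‖T (S i w)‖ ≤ ‖w‖) :
    ∃ (X : Type) (_ : NormedAddCommGroup X) (_ : NormedSpace ℝ X),
      Module.finrank ℝ X = Module.finrank ℝ F ∧
      ∀ Z : Submodule ℝ X, m ≤ Module.finrank ℝ (X ⧸ Z) →
        ∃ E : Submodule ℝ (X ⧸ Z), ComplementedIn 1 E ∧ IsometricTo W E := by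
  classical
  let V := PiLp 1 (fun _ : ι => W)
  let A : V →ₗ[ℝ] F := (LinearMap.lsum ℝ (fun _ : ι => W) ℝ S) ∘ₗ
    (WithLp.linearEquiv 1 ℝ (ι → W)).toLinearMap
  have hA : ∀ v : V, A v = ∑ i, S i (v i) := fun v => by
    simp only [A, LinearMap.comp_apply, LinearMap.lsum_apply, LinearMap.sum_apply]
    rfl
  have hAsingle : ∀ i w, A (WithLp.toLp 1 (Pi.single i w)) = S i w := fun i w => by
    rw [hA, Finset.sum_eq_single i]
    · simp
    · intro b _ hb
      simp [hb]
    · simp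
  have hsurj : LinearMap.range A = ⊤ := by
    rw [eq_top_iff, ← hspan, iSup_le_iff]
    rintro i _ ⟨w, rfl⟩
    exact ⟨_, hAsingle i w⟩
  have hcl : IsClosed (LinearMap.ker A : Set V) := Submodule.closed_of_finiteDimensional _
  let e : (V ⧸ LinearMap.ker A) ≃ₗ[ℝ] F :=
    A.quotKerEquivOfSurjective (LinearMap.range_eq_top.1 hsurj)
  have he : ∀ v : V, e (Submodule.Quotient.mk v) = A v := fun v => rfl
  refine ⟨V ⧸ LinearMap.ker A, inferInstance, inferInstance, e.finrank_eq, fun Z hZ => ?_⟩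
  have hfr : Module.finrank ℝ (F ⧸ Z.map e.toLinearMap) =
      Module.finrank ℝ ((V ⧸ LinearMap.ker A) ⧸ Z) :=
    (Submodule.Quotient.equiv Z (Z.map e.toLinearMap) e rfl).finrank_eq.symm
  obtain ⟨j, T, hTZ, hTj, hTi⟩ := hS (Z.map e.toLinearMap) (hfr ▸ hZ)
  have hTA : ∀ v : V, ‖T (A v)‖ ≤ ‖v‖ := fun v => by
    rw [hA, map_sum, PiLp.norm_eq_of_L1]
    exact (norm_sum_le _ _).trans (Finset.sum_le_sum fun i _ => hTi i _)
  have hker : LinearMap.ker A ≤ LinearMap.ker (T ∘ₗ A) := fun v hv => by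
    simp [LinearMap.mem_ker.1 hv]
  let T₁ : (V ⧸ LinearMap.ker A) →ₗ[ℝ] W := (LinearMap.ker A).liftQ (T ∘ₗ A) hker
  have hT₁ : ∀ x, T₁ x = T (e x) := fun x => by
    obtain ⟨v, rfl⟩ := Submodule.Quotient.mk_surjective _ x
    rfl
  have hT₁Z : Z ≤ LinearMap.ker T₁ := fun x hx => by
    rw [LinearMap.mem_ker, hT₁]
    exact hTZ ⟨x, hx, rfl⟩
  refine exists_complemented_isometric_of_factorization
    (Z.mkQ ∘ₗ (LinearMap.ker A).mkQ ∘ₗ (WithLp.linearEquiv 1 ℝ (ι → W)).symm.toLinearMap ∘ₗ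
      LinearMap.single ℝ (fun _ : ι => W) j)
    (Z.liftQ T₁ hT₁Z) (fun w => ?_)
    (norm_liftQ_le Z T₁ hT₁Z (norm_liftQ_le _ (T ∘ₗ A) hker hTA)) (fun w => ?_)
  · refine (Submodule.Quotient.norm_mk_le Z _).trans
      ((Submodule.Quotient.norm_mk_le (LinearMap.ker A) _).trans ?_)
    rw [PiLp.norm_eq_of_L1, Finset.sum_eq_single j]
    · simp
    · intro b _ hb
      simp [hb]
    · simp
  · refine Eq.trans ?_ (hTj w)
    rw [← hAsingle j w]
    rfl

open Matrix in
/-- Determinant of a rank-one perturbation of a multiple of the identity. -/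
theorem Matrix.det_smul_one_add_smul_vecMulVec {k : ℕ} {α : ℝ} (hα : α ≠ 0) (β : ℝ)
    (v : Fin k → ℝ) :
    (α • (1 : Matrix (Fin k) (Fin k) ℝ) + β • vecMulVec v v).det =
      α ^ k * (1 + β / α * (v ⬝ᵥ v)) := by
  have h : α • (1 : Matrix (Fin k) (Fin k) ℝ) + β • vecMulVec v v =
      α • (1 + replicateCol Unit ((β / α) • v) * replicateRow Unit v) := by
    rw [← vecMulVec_eq, smul_vecMulVec, smul_add, smul_smul, mul_div_cancel₀ _ hα]
  rw [h, det_smul, det_one_add_replicateCol_mul_replicateRow, Fintype.card_fin,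
    dotProduct_smul, smul_eq_mul]

/-- If `(1 - t) ^ k * (1 + q t / (1 - t)) ≤ 1` for all small `t`, then `q ≤ k`. -/
theorem le_of_pow_mul_le_one {k : ℕ} (hk : 0 < k) {q : ℝ}
    (h : ∀ t : ℝ, 0 < t → t < 1 → (1 - t) ^ (k - 1) * (1 - t + q * t) ≤ 1) : q ≤ k := by
  by_contra! hq
  have hk1 : (1 : ℝ) ≤ k := by exact_mod_cast hk
  have hq0 : 0 < q := by linarith
  set t := (q - k) / (2 * k * q) with ht
  have ht0 : 0 < t := by
    apply div_pos <;> [linarith; positivity]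
  have htq : t * (2 * k * q) = q - k := by
    rw [ht]
    field_simp
  have ht1 : t < 1 := by
    rw [ht, div_lt_one (by positivity)]
    nlinarith
  have hb := one_add_mul_le_pow (show (-2 : ℝ) ≤ -t by linarith) (k - 1)
  rw [Nat.cast_sub hk, Nat.cast_one, ← sub_eq_add_neg] at hb
  have h1 := h t ht0 ht1
  have h2 : (1 + ((k : ℝ) - 1) * -t) * (1 - t + q * t) ≤ 1 :=
    (mul_le_mul_of_nonneg_right hb (by nlinarith)).trans h1
  have h3 : t * ((q - k) - (k - 1) * (q - 1) * t) ≤ 0 := by nlinarith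
  have h4 : (q - k) - (k - 1) * (q - 1) * t ≤ 0 := by
    by_contra! h5
    nlinarith
  have h6 : (k - 1) * (q - 1) * t ≤ k * q * t := by
    apply mul_le_mul_of_nonneg_right _ ht0.le
    nlinarith
  nlinarith

open Matrix in
/-- **John's theorem**: a `k`-dimensional normed space is at distance at most `√k` from a
Euclidean space. -/
theorem exists_linearEquiv_norm_sq_le {W : Type*} [NormedAddCommGroup W] [NormedSpace ℝ W]
    [FiniteDimensional ℝ W] {k : ℕ} (hk : 0 < k) (hW : Module.finrank ℝ W = k) :
    ∃ e : W ≃ₗ[ℝ] (Fin k → ℝ), ∀ w, ‖w‖ ^ 2 ≤ e w ⬝ᵥ e w ∧ e w ⬝ᵥ e w ≤ k * ‖w‖ ^ 2 := by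
  have hk0 : (0 : ℝ) < k := by exact_mod_cast hk
  let b := Module.finBasisOfFinrankEq ℝ W hW
  let φ : (Fin k → ℝ) ≃L[ℝ] W := b.equivFunL.symm
  let C : Set (Matrix (Fin k) (Fin k) ℝ) := {B | ∀ x, (B *ᵥ x) ⬝ᵥ (B *ᵥ x) ≤ ‖φ x‖ ^ 2}
  have hcont : ∀ x, Continuous fun B : Matrix (Fin k) (Fin k) ℝ => (B *ᵥ x) ⬝ᵥ (B *ᵥ x) := by
    intro x
    fun_prop
  have hclosed : IsClosed C := by
    simp only [C, Set.ofPred_forall]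
    exact isClosed_iInter fun x => isClosed_le (hcont x) continuous_const
  have hsub : C ⊆ Set.univ.pi fun _ => Set.univ.pi fun a =>
      Set.Icc (-‖φ (Pi.single a 1)‖) ‖φ (Pi.single a 1)‖ := by
    intro B hB c _ a _
    have h1 := hB (Pi.single a 1)
    rw [mulVec_single_one] at h1
    have h2 : B c a ^ 2 ≤ ‖φ (Pi.single a 1)‖ ^ 2 := by
      refine le_trans ?_ h1
      rw [sq, dotProduct]
      exact Finset.single_le_sum (f := fun c => B.col a c * B.col a c)
        (fun i _ => mul_self_nonneg _) (Finset.mem_univ c)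
    exact abs_le.1 (abs_le_of_sq_le_sq h2 (norm_nonneg _))
  have hcomp : IsCompact C :=
    (isCompact_univ_pi fun _ => isCompact_univ_pi fun _ => isCompact_Icc).of_isClosed_subset
      hclosed hsub
  obtain ⟨δ, hδ, hδC⟩ : ∃ δ : ℝ, 0 < δ ∧ δ • (1 : Matrix (Fin k) (Fin k) ℝ) ∈ C := by
    obtain ⟨K, hK, hKb⟩ : ∃ K : ℝ, 0 < K ∧ ∀ x, ‖x‖ ≤ K * ‖φ x‖ := by
      refine ⟨‖(φ.symm : W →L[ℝ] (Fin k → ℝ))‖ + 1, by positivity, fun x => ?_⟩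
      have := (φ.symm : W →L[ℝ] (Fin k → ℝ)).le_opNorm (φ x)
      simp only [ContinuousLinearEquiv.coe_coe, ContinuousLinearEquiv.symm_apply_apply] at this
      nlinarith [norm_nonneg (φ x)]
    refine ⟨1 / (k * K), by positivity, fun x => ?_⟩
    rw [smul_mulVec, one_mulVec, dotProduct_smul, smul_dotProduct, smul_eq_mul, smul_eq_mul]
    have h1 : x ⬝ᵥ x ≤ k * (K * ‖φ x‖) ^ 2 := by
      rw [dotProduct]
      calc ∑ i, x i * x i ≤ ∑ i : Fin k, (K * ‖φ x‖) ^ 2 := by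
            refine Finset.sum_le_sum fun i _ => ?_
            rw [← sq, ← sq_abs]
            exact pow_le_pow_left₀ (abs_nonneg _) ((norm_le_pi_norm x i).trans (hKb x)) 2
        _ = _ := by simp
    have hk1 : (1 : ℝ) ≤ k := by exact_mod_cast hk
    calc 1 / (k * K) * (1 / (k * K) * x ⬝ᵥ x)
        ≤ 1 / (k * K) * (1 / (k * K) * (k * (K * ‖φ x‖) ^ 2)) := by gcongr
      _ = 1 / k * ‖φ x‖ ^ 2 := by field_simp
      _ ≤ 1 * ‖φ x‖ ^ 2 := by
        gcongr
        rw [div_le_one hk0]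
        exact hk1
      _ = ‖φ x‖ ^ 2 := one_mul _
  obtain ⟨B, hBC, hBmax⟩ := hcomp.exists_isMaxOn ⟨_, hδC⟩
    (f := fun B : Matrix (Fin k) (Fin k) ℝ => |B.det|) (by fun_prop)
  have hdet : 0 < |B.det| := by
    refine lt_of_lt_of_le ?_ (hBmax hδC)
    simp only [det_smul, det_one, mul_one]
    positivity
  have hunit : IsUnit B.det := (abs_pos.1 hdet).isUnit
  have hkey : ∀ x, ‖φ x‖ ^ 2 ≤ k * ((B *ᵥ x) ⬝ᵥ (B *ᵥ x)) := by
    intro x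
    by_cases hx : ‖φ x‖ = 0
    · rw [hx, zero_pow two_ne_zero]
      have := dotProduct_self_nonneg (B *ᵥ x)
      positivity
    obtain ⟨g, hg1, hgx⟩ := exists_dual_vector ℝ (φ x) hx
    let f : Fin k → ℝ := fun a => g (φ (Pi.single a 1))
    have hf : ∀ y, f ⬝ᵥ y = g (φ y) := by
      intro y
      conv_rhs => rw [pi_eq_sum_univ' y]
      rw [map_sum, map_sum, dotProduct]
      refine Finset.sum_congr rfl fun a _ => ?_
      rw [map_smul, map_smul, smul_eq_mul, mul_comm]
    let v := B⁻¹ᵀ *ᵥ f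
    have hv : ∀ y, v ⬝ᵥ (B *ᵥ y) = g (φ y) := by
      intro y
      rw [← hf, show v = B⁻¹ᵀ *ᵥ f from rfl, mulVec_transpose, ← dotProduct_mulVec,
        mulVec_mulVec, nonsing_inv_mul _ hunit,
        one_mulVec]
    have hgle : ∀ y, (g (φ y)) ^ 2 ≤ ‖φ y‖ ^ 2 := by
      intro y
      have h := g.le_opNorm (φ y)
      rw [hg1, one_mul, Real.norm_eq_abs] at h
      rw [← sq_abs]
      exact pow_le_pow_left₀ (abs_nonneg _) h 2
    have hvv : v ⬝ᵥ v ≤ k := by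
      refine le_of_pow_mul_le_one hk fun t ht0 ht1 => ?_
      set q := v ⬝ᵥ v with hq
      have hq0 : 0 ≤ q := dotProduct_self_nonneg v
      rcases hq0.eq_or_lt with hq0 | hq0
      · rw [← hq0, zero_mul, add_zero, ← pow_succ]
        exact pow_le_one₀ (by linarith) (by linarith)
      set α := √(1 - t)
      have hα2 : α ^ 2 = 1 - t := Real.sq_sqrt (by linarith)
      have hα : 0 < α := Real.sqrt_pos.2 (by linarith)
      set γ := √(1 - t + q * t)
      have hγ2 : γ ^ 2 = 1 - t + q * t := Real.sq_sqrt (by nlinarith)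
      have hγ : 0 < γ := Real.sqrt_pos.2 (by nlinarith)
      set β := (γ - α) / q
      have hβ : β * q = γ - α := by simp only [β]; field_simp
      have hβ2 : 2 * α * β + β ^ 2 * q = t := by
        have : q * (2 * α * β + β ^ 2 * q) = q * t := by
          linear_combination (2 * α + β * q + γ - α) * hβ + hγ2 - hα2
        exact mul_left_cancel₀ hq0.ne' this
      set D := α • (1 : Matrix (Fin k) (Fin k) ℝ) + β • vecMulVec v v
      have hD : ∀ z, (D *ᵥ z) ⬝ᵥ (D *ᵥ z) = α ^ 2 * (z ⬝ᵥ z) + t * (v ⬝ᵥ z) ^ 2 := by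
        intro z
        have hDz : D *ᵥ z = α • z + (β * (v ⬝ᵥ z)) • v := by
          simp only [D, add_mulVec, smul_mulVec, one_mulVec, vecMulVec_mulVec]
          rw [mul_smul]
          simp
        rw [hDz, ← hβ2]
        simp only [add_dotProduct, dotProduct_add, smul_dotProduct, dotProduct_smul, smul_eq_mul,
          dotProduct_comm z v, ← hq]
        ring
      have hDB : D * B ∈ C := by
        intro y
        rw [← mulVec_mulVec, hD, hv, hα2]
        nlinarith [hBC y, hgle y]
      have h1 : |(D * B).det| ≤ |B.det| := hBmax hDB
      rw [det_mul, abs_mul, mul_le_iff_le_one_left hdet, det_smul_one_add_smul_vecMulVec hα.ne',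
        ← hq] at h1
      have h2 : α ^ k * (1 + β / α * q) = α ^ (k - 1) * γ := by
        obtain ⟨l, rfl⟩ : ∃ l, k = l + 1 := ⟨k - 1, by omega⟩
        rw [Nat.add_sub_cancel, pow_succ]
        field_simp
        linear_combination hβ
      rw [h2, abs_of_nonneg (by positivity)] at h1
      have h3 := pow_le_one₀ (n := 2) (by positivity) h1
      rwa [mul_pow, hγ2, ← pow_mul, mul_comm (k - 1), pow_mul, hα2] at h3
    have hcs := dotProduct_sq_le v (B *ᵥ x)
    rw [hv, hgx] at hcs
    exact hcs.trans (mul_le_mul_of_nonneg_right hvv (dotProduct_self_nonneg _))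
  have hsk : √(k : ℝ) ≠ 0 := (Real.sqrt_pos.2 hk0).ne'
  let eB : (Fin k → ℝ) ≃ₗ[ℝ] (Fin k → ℝ) := B.toLinearEquiv' (B.invertibleOfIsUnitDet hunit)
  refine ⟨(φ.symm.toLinearEquiv.trans eB).trans (LinearEquiv.smulOfNeZero ℝ _ _ hsk), fun w => ?_⟩
  have hw : ((φ.symm.toLinearEquiv.trans eB).trans (LinearEquiv.smulOfNeZero ℝ _ _ hsk)) w =
      √(k : ℝ) • (B *ᵥ φ.symm w) := rfl
  have h1 := hkey (φ.symm w)
  have h2 := hBC (φ.symm w)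
  rw [ContinuousLinearEquiv.apply_symm_apply] at h1 h2
  rw [hw, dotProduct_smul, smul_dotProduct, smul_eq_mul, smul_eq_mul, ← mul_assoc,
    Real.mul_self_sqrt hk0.le]
  exact ⟨h1, mul_le_mul_of_nonneg_left h2 hk0.le⟩

/-- The real vector of a family of signs. -/
def signVec {ι : Type*} (ε : ι → ℤˣ) : ι → ℝ := fun s => ((ε s : ℤ) : ℝ)

theorem signVec_mul_self {ι : Type*} (ε : ι → ℤˣ) (s : ι) : signVec ε s * signVec ε s = 1 := by
  rcases Int.units_eq_one_or (ε s) with h | h <;> simp [signVec, h]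

theorem abs_signVec {ι : Type*} (ε : ι → ℤˣ) (s : ι) : |signVec ε s| = 1 := by
  rcases Int.units_eq_one_or (ε s) with h | h <;> simp [signVec, h]

open Matrix in
theorem signVec_dotProduct_self {n : ℕ} (ε : Fin n → ℤˣ) : signVec ε ⬝ᵥ signVec ε = n := by
  simp [dotProduct, signVec_mul_self]

open Matrix in
/-- The Laplace transform of a Rademacher sum. -/
theorem sum_exp_signVec_le {ι : Type*} [Fintype ι] [DecidableEq ι] (a : ι → ℝ) :
    ∑ ε : ι → ℤˣ, Real.exp (a ⬝ᵥ signVec ε) ≤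
      Fintype.card (ι → ℤˣ) * Real.exp ((a ⬝ᵥ a) / 2) := by
  have h1 : ∑ ε : ι → ℤˣ, Real.exp (a ⬝ᵥ signVec ε) =
      ∏ s, ∑ u : ℤˣ, Real.exp (a s * ((u : ℤ) : ℝ)) := by
    rw [Finset.prod_univ_sum, Fintype.piFinset_univ]
    refine Finset.sum_congr rfl fun ε _ => ?_
    rw [dotProduct, Real.exp_sum]
    rfl
  have h2 : ∀ s, ∑ u : ℤˣ, Real.exp (a s * ((u : ℤ) : ℝ)) ≤ 2 * Real.exp (a s * a s / 2) := by
    intro s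
    have := Real.cosh_le_exp_half_sq (a s)
    rw [Real.cosh_eq] at this
    have huniv : (Finset.univ : Finset ℤˣ) = {1, -1} := rfl
    rw [huniv, Finset.sum_pair (by decide)]
    simp only [Units.val_one, Int.cast_one, mul_one, Units.val_neg, Int.cast_neg, mul_neg]
    rw [← sq]
    linarith
  rw [h1]
  refine (Finset.prod_le_prod (fun s _ => by positivity) fun s _ => h2 s).trans_eq ?_
  rw [Finset.prod_mul_distrib, ← Real.exp_sum, dotProduct, Finset.sum_div]
  simp

open Matrix in
/-- Hoeffding's inequality for Rademacher sums, in counting form. -/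
theorem card_signVec_gt_le {ι : Type*} [Fintype ι] [DecidableEq ι] (a : ι → ℝ) {t v : ℝ}
    (hv : 0 < v) (ht : 0 ≤ t) (hav : a ⬝ᵥ a ≤ v) :
    (Nat.card {ε : ι → ℤˣ // t < |a ⬝ᵥ signVec ε|} : ℝ) ≤
      2 * Real.exp (-t ^ 2 / (2 * v)) * Fintype.card (ι → ℤˣ) := by
  classical
  rw [Nat.card_eq_fintype_card, Fintype.card_subtype, mul_assoc, mul_comm (Real.exp _)]
  set lam := t / v with hlam
  have hlam0 : 0 ≤ lam := by positivity
  have hexp : ∀ b : ι → ℝ, b ⬝ᵥ b ≤ v → ∑ ε : ι → ℤˣ, Real.exp (lam * (b ⬝ᵥ signVec ε) - lam * t) ≤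
      Fintype.card (ι → ℤˣ) * Real.exp (-t ^ 2 / (2 * v)) := by
    intro b hb
    have h := sum_exp_signVec_le (lam • b)
    simp only [smul_dotProduct, dotProduct_smul, smul_eq_mul] at h
    simp only [Real.exp_sub]
    rw [← Finset.sum_div, div_le_iff₀ (Real.exp_pos _), mul_assoc, ← Real.exp_add]
    refine h.trans ?_
    gcongr
    have h1 : lam * (lam * b ⬝ᵥ b) ≤ lam * (lam * v) := by gcongr
    have h2 : lam * v = t := by rw [hlam]; field_simp
    have h3 : -t ^ 2 / (2 * v) + lam * t = lam * (lam * v) / 2 := by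
      rw [hlam]
      field_simp
      ring
    linarith
  have h1 := hexp a hav
  have h2 := hexp (-a) (by simpa using hav)
  have h3 : ((Finset.univ.filter fun ε : ι → ℤˣ => t < |a ⬝ᵥ signVec ε|).card : ℝ) ≤
      ∑ ε : ι → ℤˣ, (Real.exp (lam * (a ⬝ᵥ signVec ε) - lam * t) +
        Real.exp (lam * (-a ⬝ᵥ signVec ε) - lam * t)) := by
    rw [Finset.card_filter, Nat.cast_sum]
    refine Finset.sum_le_sum fun ε _ => ?_
    have e1 := Real.exp_pos (lam * (a ⬝ᵥ signVec ε) - lam * t)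
    have e2 := Real.exp_pos (lam * (-a ⬝ᵥ signVec ε) - lam * t)
    split_ifs with h
    · rw [Nat.cast_one]
      rcases lt_abs.1 h with h | h
      · have := Real.one_le_exp (x := lam * (a ⬝ᵥ signVec ε) - lam * t) (by nlinarith)
        linarith
      · rw [← neg_dotProduct] at h
        have := Real.one_le_exp (x := lam * (-a ⬝ᵥ signVec ε) - lam * t) (by nlinarith)
        linarith
    · rw [Nat.cast_zero]
      positivity
  rw [Finset.sum_add_distrib] at h3
  linarith

/-- Fubini's theorem for counting: a bound for the conditional proportion given all coordinates
but one is a bound for the proportion. -/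
theorem card_le_of_forall_update {κ Γ : Type*} [Fintype κ] [DecidableEq κ] [Fintype Γ]
    (P : (κ → Γ) → Prop) (a : κ) (q : ℝ)
    (h : ∀ G, (Nat.card {g : Γ // P (Function.update G a g)} : ℝ) ≤ q * Fintype.card Γ) :
    (Nat.card {G : κ → Γ // P G} : ℝ) ≤ q * Fintype.card (κ → Γ) := by
  classical
  cases isEmpty_or_nonempty Γ
  · have : IsEmpty (κ → Γ) := ⟨fun G => IsEmpty.false (G a)⟩
    simp
  inhabit Γ
  let e := Equiv.funSplitAt a Γ
  have he : ∀ p g, Function.update (e.symm (default, p)) a g = e.symm (g, p) := by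
    intro p g
    ext j
    by_cases hj : j = a
    · subst hj
      simp [e, Equiv.funSplitAt, Equiv.piSplitAt]
    · simp [e, Equiv.funSplitAt, Equiv.piSplitAt, hj]
  have h1 : (Nat.card {G : κ → Γ // P G} : ℝ) =
      ∑ p : {j // j ≠ a} → Γ, (Nat.card {g : Γ // P (e.symm (g, p))} : ℝ) := by
    simp only [Nat.card_eq_fintype_card, Fintype.card_subtype, Finset.card_filter, Nat.cast_sum]
    rw [← e.symm.sum_comp, Fintype.sum_prod_type, Finset.sum_comm]
  have hcard : Fintype.card (κ → Γ) = Fintype.card Γ * Fintype.card ({j // j ≠ a} → Γ) := by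
    rw [Fintype.card_congr e, Fintype.card_prod]
  rw [h1, hcard, Nat.cast_mul]
  calc _ ≤ ∑ p : {j // j ≠ a} → Γ, q * (Fintype.card Γ : ℝ) :=
        Finset.sum_le_sum fun p _ => by
          have := h (e.symm (default, p))
          simp only [he] at this
          exact this
    _ = _ := by
        rw [Finset.sum_const, nsmul_eq_mul, Finset.card_univ]
        ring

theorem sum_eq_zero_of_flip_s15 {ι : Type*} [Fintype ι] [DecidableEq ι] (c : ι)
    (f : (ι → ℤˣ) → ℝ) (hf : ∀ ε, f (Function.update ε c (-ε c)) = -f ε) : ∑ ε, f ε = 0 := by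
  have hinv : Function.Involutive fun ε : ι → ℤˣ => Function.update ε c (-ε c) := by
    intro ε
    simp
  have h := Equiv.sum_comp (Function.Involutive.toPerm _ hinv) f
  simp only [Function.Involutive.coe_toPerm, hf, Finset.sum_neg_distrib] at h
  linarith

theorem signVec_flip_self {ι : Type*} [DecidableEq ι] (ε : ι → ℤˣ) (c : ι) :
    signVec (Function.update ε c (-ε c)) c = -signVec ε c := by
  simp [signVec]

theorem signVec_flip_of_ne {ι : Type*} [DecidableEq ι] (ε : ι → ℤˣ) {c s : ι} (h : s ≠ c) :
    signVec (Function.update ε c (-ε c)) s = signVec ε s := by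
  simp [signVec, h]

/-- Orthogonality of the Rademacher chaoses of order two. -/
theorem sum_signVec_four_eq_zero {ι : Type*} [Fintype ι] [DecidableEq ι] {s t u v : ι}
    (hst : s ≠ t) (huv : u ≠ v) (h1 : (u, v) ≠ (s, t)) (h2 : (u, v) ≠ (t, s)) :
    ∑ ε : ι → ℤˣ, signVec ε s * signVec ε t * (signVec ε u * signVec ε v) = 0 := by
  by_cases hs : s ≠ u ∧ s ≠ v
  · refine sum_eq_zero_of_flip_s15 s _ fun ε => ?_
    rw [signVec_flip_self, signVec_flip_of_ne _ hst.symm, signVec_flip_of_ne _ hs.1.symm,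
      signVec_flip_of_ne _ hs.2.symm]
    ring
  · have ht : t ≠ u ∧ t ≠ v := by
      constructor
      · rintro rfl
        apply hs
        refine ⟨hst, ?_⟩
        rintro rfl
        exact h2 rfl
      · rintro rfl
        apply hs
        refine ⟨?_, hst⟩
        rintro rfl
        exact h1 rfl
    refine sum_eq_zero_of_flip_s15 t _ fun ε => ?_
    rw [signVec_flip_self, signVec_flip_of_ne _ hst, signVec_flip_of_ne _ ht.1.symm,
      signVec_flip_of_ne _ ht.2.symm]
    ring

open Matrix in
/-- The variance of a Rademacher quadratic form. -/
theorem sum_sq_quadratic_sub_trace_le {n : ℕ} (M : Matrix (Fin n) (Fin n) ℝ) (hM : Mᵀ = M) :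
    ∑ ε : Fin n → ℤˣ, (signVec ε ⬝ᵥ M *ᵥ signVec ε - M.trace) ^ 2 ≤
      Fintype.card (Fin n → ℤˣ) * (2 * ∑ p : Fin n × Fin n, M p.1 p.2 ^ 2) := by
  let A : Fin n × Fin n → ℝ := fun p => if p.1 = p.2 then 0 else M p.1 p.2
  have hAM : ∀ p, A p ^ 2 ≤ M p.1 p.2 ^ 2 := by
    intro p
    by_cases h : p.1 = p.2 <;> simp [A, h, sq_nonneg]
  have hAswap : ∀ p, A p.swap = A p := by
    intro p
    have : M p.2 p.1 = M p.1 p.2 := congrFun (congrFun hM p.1) p.2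
    by_cases h : p.1 = p.2
    · simp [A, h]
    · simp [A, h, Ne.symm h, this]
  let z : (Fin n → ℤˣ) → Fin n × Fin n → ℝ := fun ε p => signVec ε p.1 * signVec ε p.2
  have hX : ∀ ε : Fin n → ℤˣ, signVec ε ⬝ᵥ M *ᵥ signVec ε - M.trace = ∑ p, A p * z ε p := by
    intro ε
    have htr : M.trace = ∑ p : Fin n × Fin n, if p.1 = p.2 then M p.1 p.2 * z ε p else 0 := by
      rw [Fintype.sum_prod_type, trace]
      refine Finset.sum_congr rfl fun s _ => ?_
      simp [z, signVec_mul_self]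
    rw [sub_eq_iff_eq_add, htr, ← Finset.sum_add_distrib, Fintype.sum_prod_type, dotProduct]
    refine Finset.sum_congr rfl fun s _ => ?_
    rw [mulVec, dotProduct, Finset.mul_sum]
    refine Finset.sum_congr rfl fun t _ => ?_
    by_cases h : s = t <;> simp [A, z, h] <;> ring
  have hz : ∀ p p', ∑ ε, A p * z ε p * (A p' * z ε p') ≤ Fintype.card (Fin n → ℤˣ) *
      ((if p' = p then A p ^ 2 else 0) + if p' = p.swap then A p ^ 2 else 0) := by
    intro p p'
    have hle : (A p' = A p) → ∀ ε, A p * z ε p * (A p' * z ε p') ≤ A p ^ 2 := by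
      intro h ε
      have hz1 : ∀ r, |z ε r| = 1 := fun r => by simp [z, abs_mul, abs_signVec]
      have : z ε p * z ε p' ≤ 1 := by
        refine (le_abs_self _).trans ?_
        rw [abs_mul, hz1, hz1, one_mul]
      rw [h]
      nlinarith [sq_nonneg (A p)]
    have hsum : (A p' = A p) → ∑ ε, A p * z ε p * (A p' * z ε p') ≤
        Fintype.card (Fin n → ℤˣ) * A p ^ 2 := by
      intro h
      refine (Finset.sum_le_sum fun ε _ => hle h ε).trans_eq ?_
      rw [Finset.sum_const, nsmul_eq_mul, Finset.card_univ]
    have hpos : ∀ (Q : Prop) [Decidable Q], 0 ≤ if Q then A p ^ 2 else 0 := by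
      intro Q _
      split_ifs <;> positivity
    by_cases h1 : p' = p
    · refine (hsum (by rw [h1])).trans ?_
      rw [if_pos h1]
      gcongr
      linarith [hpos (p' = p.swap)]
    by_cases h2 : p' = p.swap
    · refine (hsum (by rw [h2, hAswap])).trans ?_
      rw [if_pos h2]
      gcongr
      linarith [hpos (p' = p)]
    rw [if_neg h1, if_neg h2, add_zero, mul_zero]
    by_cases hp : p.1 = p.2
    · simp [A, hp]
    by_cases hp' : p'.1 = p'.2
    · simp [A, hp']
    have h0 := sum_signVec_four_eq_zero hp hp' (fun h => h1 h) (fun h => h2 h)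
    have : ∀ ε, A p * z ε p * (A p' * z ε p') = A p * A p' * (z ε p * z ε p') := fun ε => by ring
    simp only [this, ← Finset.mul_sum]
    simp only [z, h0, mul_zero, le_refl]
  calc ∑ ε : Fin n → ℤˣ, (signVec ε ⬝ᵥ M *ᵥ signVec ε - M.trace) ^ 2
      = ∑ p, ∑ p', ∑ ε, A p * z ε p * (A p' * z ε p') := by
        simp only [hX, sq, Finset.sum_mul_sum]
        rw [Finset.sum_comm]
        refine Finset.sum_congr rfl fun p _ => Finset.sum_comm
    _ ≤ ∑ p, ∑ p', Fintype.card (Fin n → ℤˣ) *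
          ((if p' = p then A p ^ 2 else 0) + if p' = p.swap then A p ^ 2 else 0) :=
        Finset.sum_le_sum fun p _ => Finset.sum_le_sum fun p' _ => hz p p'
    _ = Fintype.card (Fin n → ℤˣ) * (2 * ∑ p, A p ^ 2) := by
        simp only [← Finset.mul_sum, Finset.sum_add_distrib, Finset.sum_ite_eq', Finset.mem_univ,
          if_true]
        ring
    _ ≤ _ := mul_le_mul_of_nonneg_left (mul_le_mul_of_nonneg_left
        (Finset.sum_le_sum fun p _ => hAM p) zero_le_two) (Nat.cast_nonneg _)

/-- The number of entries of `ω` that are defective, or in conflict with a later entry. -/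
noncomputable def conflictCount {Ω : Type*} (D : Ω → Prop) (R : Ω → Ω → Prop) {N : ℕ}
    (ω : Fin N → Ω) : ℕ :=
  Nat.card {j : Fin N // D (ω j) ∨ ∃ i, j < i ∧ R (ω i) (ω j)}

open Classical in
theorem conflictCount_cons {Ω : Type*} (D : Ω → Prop) (R : Ω → Ω → Prop) {N : ℕ} (g : Ω)
    (ω : Fin N → Ω) :
    conflictCount D R (Fin.cons g ω : Fin (N + 1) → Ω) =
      (if D g ∨ ∃ i, R (ω i) g then 1 else 0) + conflictCount D R ω := by
  simp only [conflictCount, Nat.card_eq_fintype_card, Fintype.card_subtype, Finset.card_filter]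
  rw [Fin.sum_univ_succ]
  simp [Fin.exists_fin_succ]

/-- Exponential moment of the number of conflicts in a random sequence. -/
theorem sum_pow_conflictCount_le {Ω : Type*} [Fintype Ω] (D : Ω → Prop) (R : Ω → Ω → Prop)
    {p q : ℝ} (hq : 0 ≤ q) (hD : (Nat.card {g // D g} : ℝ) ≤ p * Fintype.card Ω)
    (hR : ∀ h, (Nat.card {g // R h g} : ℝ) ≤ q * Fintype.card Ω) {K : ℕ} (N : ℕ) (hN : N ≤ K)
    (hp : 64 * (p + K * q) ≤ 1) :
    ∑ ω : Fin N → Ω, (64 : ℝ) ^ conflictCount D R ω ≤ (2 * Fintype.card Ω) ^ N := by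
  classical
  induction N with
  | zero => simp [conflictCount]
  | succ N ih =>
    have hstep : ∀ ω : Fin N → Ω,
        ∑ g, (64 : ℝ) ^ (if D g ∨ ∃ i, R (ω i) g then 1 else 0) ≤ 2 * Fintype.card Ω := by
      intro ω
      have h1 : ∀ g, (64 : ℝ) ^ (if D g ∨ ∃ i, R (ω i) g then 1 else 0) ≤
          1 + 64 * ((if D g then 1 else 0) + ∑ i, if R (ω i) g then 1 else 0) := by
        intro g
        have hnn : (0 : ℝ) ≤ ∑ i, if R (ω i) g then (1 : ℝ) else 0 :=
          Finset.sum_nonneg fun i _ => by split_ifs <;> norm_num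
        by_cases hDg : D g
        · simp only [hDg, true_or, if_true]
          linarith
        by_cases hRg : ∃ i, R (ω i) g
        · obtain ⟨i, hi⟩ := hRg
          have h2 : (1 : ℝ) ≤ ∑ i, if R (ω i) g then (1 : ℝ) else 0 := by
            refine le_trans ?_ (Finset.single_le_sum (f := fun i => if R (ω i) g then (1 : ℝ) else 0)
              (fun i _ => by split_ifs <;> norm_num) (Finset.mem_univ i))
            simp [hi]
          rw [if_pos (Or.inr ⟨i, hi⟩), if_neg hDg]
          linarith
        · rw [if_neg (by tauto), if_neg hDg]
          linarith
      refine (Finset.sum_le_sum fun g _ => h1 g).trans ?_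
      rw [Finset.sum_add_distrib, ← Finset.mul_sum, Finset.sum_add_distrib, Finset.sum_comm]
      have hD' : ∑ g, (if D g then (1 : ℝ) else 0) ≤ p * Fintype.card Ω := by
        rw [Nat.card_eq_fintype_card, Fintype.card_subtype, Finset.card_filter] at hD
        exact_mod_cast hD
      have hR' : ∑ i, ∑ g, (if R (ω i) g then (1 : ℝ) else 0) ≤ K * q * Fintype.card Ω := by
        calc _ ≤ ∑ i : Fin N, q * (Fintype.card Ω : ℝ) := by
              refine Finset.sum_le_sum fun i _ => ?_
              have := hR (ω i)
              rw [Nat.card_eq_fintype_card, Fintype.card_subtype, Finset.card_filter] at this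
              exact_mod_cast this
          _ = N * q * Fintype.card Ω := by simp; ring
          _ ≤ K * q * Fintype.card Ω := by
              have : (N : ℝ) ≤ K := by exact_mod_cast (Nat.le_succ N).trans hN
              gcongr
      have hc : (0 : ℝ) ≤ Fintype.card Ω := Nat.cast_nonneg _
      simp only [Finset.sum_const, Finset.card_univ, nsmul_eq_mul, mul_one]
      nlinarith
    rw [← (Fin.consEquiv fun _ => Ω).sum_comp, Fintype.sum_prod_type, Finset.sum_comm]
    calc ∑ ω : Fin N → Ω, ∑ g, (64 : ℝ) ^ conflictCount D R (Fin.cons g ω : Fin (N + 1) → Ω)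
        = ∑ ω : Fin N → Ω, (∑ g, (64 : ℝ) ^ (if D g ∨ ∃ i, R (ω i) g then 1 else 0)) *
            (64 : ℝ) ^ conflictCount D R ω := by
          simp only [conflictCount_cons, pow_add, Finset.sum_mul]
      _ ≤ ∑ ω : Fin N → Ω, (2 * Fintype.card Ω : ℝ) * (64 : ℝ) ^ conflictCount D R ω := by
          gcongr with ω
          exact hstep ω
      _ ≤ (2 * Fintype.card Ω) ^ (N + 1) := by
          rw [← Finset.mul_sum, pow_succ']
          gcongr
          exact ih ((Nat.le_succ N).trans hN)

/-- Random sequences with few conflicts: for every parameter `M` some entry of the sequence is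
neither defective nor in conflict with any other entry. -/
theorem exists_seq_forall_exists_no_conflict {Ω μ : Type*} [Fintype Ω] [Nonempty Ω] [Fintype μ]
    (D : μ → Ω → Prop) (R : μ → Ω → Ω → Prop) {p q : ℝ} (hq : 0 ≤ q) (N : ℕ)
    (hD : ∀ M, (Nat.card {g // D M g} : ℝ) ≤ p * Fintype.card Ω)
    (hR : ∀ M h, (Nat.card {g // R M h g} : ℝ) ≤ q * Fintype.card Ω)
    (hp : 64 * (p + N * q) ≤ 1) (hμ : 2 * Fintype.card μ < 4 ^ N) :
    ∃ ω : Fin N → Ω, ∀ M, ∃ j, ¬ D M (ω j) ∧ ∀ i, i ≠ j → ¬ R M (ω i) (ω j) := by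
  classical
  by_contra! hcon
  have hbad : ∀ ω : Fin N → Ω, ∃ M, N ≤ conflictCount (D M) (R M) ω +
      conflictCount (D M) (R M) (ω ∘ Fin.rev) := by
    intro ω
    obtain ⟨M, hM⟩ := hcon ω
    refine ⟨M, ?_⟩
    have h2 : conflictCount (D M) (R M) (ω ∘ Fin.rev) =
        Nat.card {j : Fin N // D M (ω j) ∨ ∃ i, i < j ∧ R M (ω i) (ω j)} := by
      refine Nat.card_congr (Fin.revPerm.subtypeEquiv fun j => ?_)
      refine or_congr Iff.rfl ?_
      rw [← Fin.revPerm.exists_congr_right]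
      simp only [Function.comp_apply, Fin.revPerm_apply, Fin.rev_rev]
      exact exists_congr fun a => and_congr_left' Fin.lt_rev_iff
    rw [h2, conflictCount]
    simp only [Nat.card_eq_fintype_card, Fintype.card_subtype]
    refine le_trans ?_ (Finset.card_union_le _ _)
    rw [← Finset.filter_or, Finset.filter_true_of_mem]
    · simp
    · intro j _
      by_cases hj : D M (ω j)
      · exact Or.inl (Or.inl hj)
      obtain ⟨i, hij, hi⟩ := hM j hj
      rcases lt_or_gt_of_ne hij with h | h
      · exact Or.inr (Or.inr ⟨i, h, hi⟩)
      · exact Or.inl (Or.inr ⟨i, h, hi⟩)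
  have hmom : ∀ M, ∑ ω : Fin N → Ω, (64 : ℝ) ^ conflictCount (D M) (R M) ω ≤
      (2 * Fintype.card Ω) ^ N := fun M =>
    sum_pow_conflictCount_le (D M) (R M) hq (hD M) (hR M) N le_rfl hp
  have hmomrev : ∀ M, ∑ ω : Fin N → Ω, (64 : ℝ) ^ conflictCount (D M) (R M) (ω ∘ Fin.rev) ≤
      (2 * Fintype.card Ω) ^ N := fun M => by
    refine le_trans (le_of_eq ?_) (hmom M)
    exact Equiv.sum_comp (Equiv.arrowCongr Fin.revPerm (Equiv.refl Ω))
      (fun ω : Fin N → Ω => (64 : ℝ) ^ conflictCount (D M) (R M) ω)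
  have hpoint : ∀ ω : Fin N → Ω, (8 : ℝ) ^ N ≤ ∑ M, ((64 : ℝ) ^ conflictCount (D M) (R M) ω +
      (64 : ℝ) ^ conflictCount (D M) (R M) (ω ∘ Fin.rev)) := by
    intro ω
    obtain ⟨M, hM⟩ := hbad ω
    refine le_trans ?_ (Finset.single_le_sum (f := fun M => (64 : ℝ) ^ conflictCount (D M) (R M) ω +
      (64 : ℝ) ^ conflictCount (D M) (R M) (ω ∘ Fin.rev)) (fun M _ => by positivity)
      (Finset.mem_univ M))
    set x := conflictCount (D M) (R M) ω
    set y := conflictCount (D M) (R M) (ω ∘ Fin.rev)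
    have h1 : (8 : ℝ) ^ N ≤ 8 ^ x * 8 ^ y := by
      rw [← pow_add]
      exact pow_le_pow_right₀ (by norm_num) hM
    have h64 : ∀ z : ℕ, (64 : ℝ) ^ z = (8 ^ z) ^ 2 := fun z => by
      rw [← pow_mul, mul_comm, pow_mul]
      norm_num
    simp only [h64]
    nlinarith [sq_nonneg ((8 : ℝ) ^ x - 8 ^ y), sq_nonneg ((8 : ℝ) ^ x), sq_nonneg ((8 : ℝ) ^ y)]
  have htotal := Finset.sum_le_sum fun (ω : Fin N → Ω) (_ : ω ∈ Finset.univ) => hpoint ω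
  rw [Finset.sum_comm] at htotal
  have hupper : ∑ M, ∑ ω : Fin N → Ω, ((64 : ℝ) ^ conflictCount (D M) (R M) ω +
      (64 : ℝ) ^ conflictCount (D M) (R M) (ω ∘ Fin.rev)) ≤
      ∑ _M : μ, 2 * (2 * Fintype.card Ω : ℝ) ^ N :=
    Finset.sum_le_sum fun M _ => by
      rw [Finset.sum_add_distrib, two_mul]
      exact add_le_add (hmom M) (hmomrev M)
  have h := htotal.trans hupper
  simp only [Finset.sum_const, Finset.card_univ, nsmul_eq_mul, Fintype.card_fun, Fintype.card_fin,
    Nat.cast_pow] at h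
  have hΩ : (0 : ℝ) < (Fintype.card Ω : ℝ) ^ N := by
    have : 0 < Fintype.card Ω := Fintype.card_pos
    positivity
  have h3 : (2 * Fintype.card μ : ℝ) < 4 ^ N := by exact_mod_cast hμ
  rw [mul_pow, show (8 : ℝ) = 4 * 2 by norm_num, mul_pow] at h
  have h4 : (2 * Fintype.card μ : ℝ) * (2 ^ N * (Fintype.card Ω : ℝ) ^ N) <
      4 ^ N * (2 ^ N * (Fintype.card Ω : ℝ) ^ N) := by gcongr
  nlinarith

/-- A maximal `1`-separated subset of the ball of radius `2`. -/
theorem exists_net_card_le_five_pow (E : Type*) [NormedAddCommGroup E] [NormedSpace ℝ E]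
    [FiniteDimensional ℝ E] :
    ∃ s : Finset E, s.card ≤ 5 ^ Module.finrank ℝ E ∧ (∀ z ∈ s, ‖z‖ ≤ 2) ∧
      ∀ x : E, ‖x‖ ≤ 2 → ∃ z ∈ s, ‖x - z‖ ≤ 1 := by
  classical
  let Q : ℕ → Prop := fun c => ∃ s : Finset E, s.card = c ∧ (∀ z ∈ s, ‖z‖ ≤ 2) ∧
    ∀ z ∈ s, ∀ w ∈ s, z ≠ w → 1 ≤ ‖z - w‖
  have hbound : ∀ c, Q c → c ≤ 5 ^ Module.finrank ℝ E := by
    rintro c ⟨s, rfl, h1, h2⟩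
    exact Besicovitch.card_le_of_separated s h1 h2
  have h0 : Q 0 := ⟨∅, by simp⟩
  have hmax := Nat.findGreatest_spec (P := Q) (Nat.zero_le (5 ^ Module.finrank ℝ E)) h0
  set c := Nat.findGreatest Q (5 ^ Module.finrank ℝ E) with hc
  obtain ⟨s, hs, h1, h2⟩ := hmax
  refine ⟨s, hs.trans_le (Nat.findGreatest_le _), h1, fun x hx => ?_⟩
  by_contra! hcon
  have hxs : x ∉ s := fun h => by
    have := hcon x h
    simp at this
    linarith
  have hQ : Q (c + 1) := by
    refine ⟨insert x s, by rw [Finset.card_insert_of_notMem hxs, hs], ?_, ?_⟩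
    · intro z hz
      rcases Finset.mem_insert.1 hz with rfl | hz
      · exact hx
      · exact h1 z hz
    · intro z hz w hw hzw
      rcases Finset.mem_insert.1 hz with hzx | hzs <;>
        rcases Finset.mem_insert.1 hw with hwx | hws
      · exact absurd (hzx.trans hwx.symm) hzw
      · exact hzx ▸ (hcon w hws).le
      · rw [norm_sub_rev]
        exact hwx ▸ (hcon z hzs).le
      · exact h2 z hzs w hws hzw
  have := Nat.le_findGreatest (hbound _ hQ) hQ
  omega

theorem norm_le_of_forall_net {E : Type*} [NormedAddCommGroup E] [NormedSpace ℝ E]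
    {s : Finset E} (hs : ∀ x : E, ‖x‖ ≤ 2 → ∃ z ∈ s, ‖x - z‖ ≤ 1) (g : E →L[ℝ] ℝ) {t : ℝ}
    (hg : ∀ z ∈ s, |g z| ≤ t) : ‖g‖ ≤ t := by
  have ht : 0 ≤ t := by
    obtain ⟨z, hz, -⟩ := hs 0 (by simp)
    exact (abs_nonneg _).trans (hg z hz)
  have h : ‖g‖ ≤ (t + ‖g‖) / 2 := by
    refine g.opNorm_le_of_unit_norm (by positivity) fun x hx => ?_
    obtain ⟨z, hz, hxz⟩ := hs ((2 : ℝ) • x) (by rw [norm_smul, hx]; norm_num)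
    have h1 := g.le_opNorm ((2 : ℝ) • x - z)
    have h2 := hg z hz
    have h3 : ‖g ((2 : ℝ) • x)‖ ≤ |g z| + ‖g ((2 : ℝ) • x - z)‖ := by
      have h4 : g ((2 : ℝ) • x) = g z + g ((2 : ℝ) • x - z) := by rw [map_sub]; ring
      rw [h4]
      exact norm_add_le _ _
    rw [map_smul, norm_smul, Real.norm_two] at h3
    have h5 : ‖g‖ * ‖(2 : ℝ) • x - z‖ ≤ ‖g‖ := mul_le_of_le_one_right (norm_nonneg _) hxz
    linarith
  linarith

open Matrix in
/-- A small set of vectors that controls the norms of all bilinear forms. -/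
theorem exists_net_bilinear (k : ℕ) :
    ∃ s : Finset (Fin k → ℝ), s.card ≤ 5 ^ k ∧ (∀ z ∈ s, z ⬝ᵥ z ≤ 4) ∧
      ∀ (A : Matrix (Fin k) (Fin k) ℝ) (t : ℝ), (∀ x ∈ s, ∀ y ∈ s, |x ⬝ᵥ A *ᵥ y| ≤ t) →
        ∀ x y, |x ⬝ᵥ A *ᵥ y| ≤ t * (√(x ⬝ᵥ x) * √(y ⬝ᵥ y)) := by
  classical
  obtain ⟨s, hs1, hs2, hs3⟩ := exists_net_card_le_five_pow (EuclideanSpace ℝ (Fin k))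
  have hnorm : ∀ x : EuclideanSpace ℝ (Fin k), ‖x‖ = √(x.ofLp ⬝ᵥ x.ofLp) := by
    intro x
    rw [EuclideanSpace.norm_eq]
    simp [dotProduct, sq]
  refine ⟨s.image WithLp.ofLp, Finset.card_image_le.trans (by simpa using hs1), ?_, ?_⟩
  · intro z hz
    obtain ⟨w, hw, rfl⟩ := Finset.mem_image.1 hz
    have h := hs2 w hw
    rw [hnorm, Real.sqrt_le_left (by norm_num)] at h
    linarith
  · intro A t hA
    let toE : (Fin k → ℝ) ≃ₗ[ℝ] EuclideanSpace ℝ (Fin k) := (WithLp.linearEquiv 2 ℝ _).symm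
    have hrow : ∀ v : Fin k → ℝ, ∃ g : EuclideanSpace ℝ (Fin k) →L[ℝ] ℝ,
        ∀ x, g x = x.ofLp ⬝ᵥ v := by
      intro v
      refine ⟨LinearMap.toContinuousLinearMap
        { toFun := fun x => x.ofLp ⬝ᵥ v
          map_add' := fun x y => by simp [add_dotProduct]
          map_smul' := fun c x => by simp [smul_dotProduct] }, fun x => rfl⟩
    have h1 : ∀ y ∈ s, ∀ x : EuclideanSpace ℝ (Fin k), |x.ofLp ⬝ᵥ A *ᵥ y.ofLp| ≤ t * ‖x‖ := by
      intro y hy x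
      obtain ⟨g, hg⟩ := hrow (A *ᵥ y.ofLp)
      have h := norm_le_of_forall_net hs3 g (t := t) fun z hz => by
        rw [hg]
        exact hA _ (Finset.mem_image_of_mem _ hz) _ (Finset.mem_image_of_mem _ hy)
      rw [← hg, ← Real.norm_eq_abs]
      exact (g.le_opNorm x).trans (mul_le_mul_of_nonneg_right h (norm_nonneg _))
    intro x y
    obtain ⟨g, hg⟩ := hrow (x ᵥ* A)
    have hgy : ∀ z : EuclideanSpace ℝ (Fin k), g z = x ⬝ᵥ A *ᵥ z.ofLp := fun z => by
      rw [hg, dotProduct_mulVec, dotProduct_comm]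
    have h := norm_le_of_forall_net hs3 g (t := t * ‖WithLp.toLp 2 x‖) fun z hz => by
      rw [hgy]
      exact h1 z hz (WithLp.toLp 2 x)
    have h2 := (g.le_opNorm (WithLp.toLp 2 y)).trans (mul_le_mul_of_nonneg_right h (norm_nonneg _))
    rw [hgy, Real.norm_eq_abs, hnorm, hnorm, mul_assoc] at h2
    exact h2

/-- A finite net, in the entrywise distance, for a set of matrices with entries in `[-1, 1]`. -/
theorem exists_entrywise_net {n : ℕ} (S : Set (Matrix (Fin n) (Fin n) ℝ))
    (hS : ∀ M ∈ S, ∀ s t, |M s t| ≤ 1) (K : ℕ) (hK : 0 < K) :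
    ∃ (μ : Type) (_ : Fintype μ) (F : μ → Matrix (Fin n) (Fin n) ℝ), (∀ c, F c ∈ S) ∧
      Fintype.card μ ≤ (2 * K + 1) ^ (n * n) ∧
      ∀ M ∈ S, ∃ c, ∀ s t, |M s t - F c s t| ≤ 1 / K := by
  classical
  have hK0 : (0 : ℝ) < K := by exact_mod_cast hK
  let ρ : Matrix (Fin n) (Fin n) ℝ → (Fin n × Fin n → Fin (2 * K + 1)) := fun M p =>
    Fin.ofNat _ (⌊K * (M p.1 p.2 + 1)⌋₊)
  let μ := {c : Fin n × Fin n → Fin (2 * K + 1) // ∃ M ∈ S, ρ M = c}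
  choose F hFS hF using fun c : μ => c.2
  refine ⟨μ, inferInstance, F, hFS, (Fintype.card_subtype_le _).trans_eq (by simp), ?_⟩
  intro M hM
  refine ⟨⟨ρ M, M, hM, rfl⟩, fun s t => ?_⟩
  set M' := F ⟨ρ M, M, hM, rfl⟩ with hM'
  have h := congrArg Fin.val (congrFun (hF ⟨ρ M, M, hM, rfl⟩) (s, t))
  have hval : ∀ L ∈ S, (ρ L (s, t) : ℕ) = ⌊K * (L s t + 1)⌋₊ := by
    intro L hL
    have h1 := abs_le.1 (hS L hL s t)
    refine Nat.mod_eq_of_lt (Nat.lt_succ_of_le (Nat.floor_le_of_le ?_))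
    push_cast
    nlinarith
  rw [hval _ (hFS _), hval _ hM, ← hM'] at h
  have hnn : ∀ L ∈ S, 0 ≤ K * (L s t + 1) := fun L hL => by
    have h1 := abs_le.1 (hS L hL s t)
    exact mul_nonneg hK0.le (by linarith)
  have a1 := Nat.floor_le (hnn M hM)
  have a2 := Nat.lt_floor_add_one (K * (M s t + 1))
  have b1 := Nat.floor_le (hnn M' (hFS _))
  have b2 := Nat.lt_floor_add_one (K * (M' s t + 1))
  rw [h] at b1 b2
  rw [abs_le, le_div_iff₀ hK0, neg_le_iff_add_nonneg]
  constructor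
  · have : 0 ≤ K * (M s t - M' s t + 1 / K) := by
      have : K * (M s t - M' s t + 1 / K) = K * (M s t - M' s t) + 1 := by field_simp
      rw [this]
      linarith
    exact nonneg_of_mul_nonneg_right this hK0
  · linarith

open Matrix in
/-- The matrices of orthogonal projections of rank at least `m`. -/
def projectionMatrices (n m : ℕ) : Set (Matrix (Fin n) (Fin n) ℝ) :=
  {M | Mᵀ = M ∧ M * M = M ∧ (m : ℝ) ≤ M.trace}

section projection

open Matrix

variable {n : ℕ} {M : Matrix (Fin n) (Fin n) ℝ}

theorem mulVec_dotProduct_mulVec_of_isProj (hM : Mᵀ = M) (hMM : M * M = M) (v w : Fin n → ℝ) :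
    M *ᵥ v ⬝ᵥ M *ᵥ w = v ⬝ᵥ M *ᵥ w := by
  rw [← vecMul_transpose, hM, ← dotProduct_mulVec, mulVec_mulVec, hMM]

theorem mulVec_dotProduct_self_le_of_isProj (hM : Mᵀ = M) (hMM : M * M = M) (v : Fin n → ℝ) :
    M *ᵥ v ⬝ᵥ M *ᵥ v ≤ v ⬝ᵥ v := by
  have h1 := dotProduct_sq_le v (M *ᵥ v)
  rw [mulVec_dotProduct_mulVec_of_isProj hM hMM] at h1 ⊢
  have h2 := dotProduct_self_nonneg (M *ᵥ v)
  rw [mulVec_dotProduct_mulVec_of_isProj hM hMM] at h2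
  have h3 := dotProduct_self_nonneg v
  by_contra! h
  nlinarith

theorem sum_sq_eq_trace_of_isProj (hM : Mᵀ = M) (hMM : M * M = M) :
    ∑ p : Fin n × Fin n, M p.1 p.2 ^ 2 = M.trace := by
  rw [Fintype.sum_prod_type, trace]
  refine Finset.sum_congr rfl fun s _ => ?_
  conv_rhs => rw [← hMM, diag_apply, mul_apply]
  refine Finset.sum_congr rfl fun t _ => ?_
  rw [sq]
  congr 1
  conv_lhs => rw [← hM, transpose_apply]

theorem abs_apply_le_one_of_isProj (hM : Mᵀ = M) (hMM : M * M = M) (s t : Fin n) :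
    |M s t| ≤ 1 := by
  have h : ∀ t, M s t * M s t ≤ M s s := by
    intro t
    have h1 : M s s = ∑ t, M s t * M s t := by
      conv_lhs => rw [← hMM, mul_apply]
      refine Finset.sum_congr rfl fun t _ => ?_
      congr 1
      conv_lhs => rw [← hM, transpose_apply]
    rw [h1]
    exact Finset.single_le_sum (f := fun t => M s t * M s t) (fun t _ => mul_self_nonneg _)
      (Finset.mem_univ t)
  have h1 := h s
  have h2 := h t
  rw [← sq_le_one_iff_abs_le_one]
  nlinarith [sq_nonneg (M s s - 1)]

end projection

section quadratic

open Matrix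

variable {k : ℕ}

theorem sq_sum_abs_le (x : Fin k → ℝ) : (∑ a, |x a|) ^ 2 ≤ k * (x ⬝ᵥ x) := by
  have h := sq_sum_le_card_mul_sum_sq (s := Finset.univ) (f := fun a => |x a|)
  simpa [dotProduct, sq] using h

theorem dotProduct_mulVec_eq_sum (A : Matrix (Fin k) (Fin k) ℝ) (x y : Fin k → ℝ) :
    x ⬝ᵥ A *ᵥ y = ∑ a, ∑ b, x a * A a b * y b := by
  simp only [dotProduct, mulVec, Finset.mul_sum, mul_assoc]

/-- A lower bound for the quadratic form of a diagonally dominant matrix. -/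
theorem le_dotProduct_mulVec_of_diag_dominant {A : Matrix (Fin k) (Fin k) ℝ} {α β : ℝ}
    (hβ : 0 ≤ β) (hd : ∀ a, α ≤ A a a) (ho : ∀ a b, a ≠ b → |A a b| ≤ β / k) (x : Fin k → ℝ) :
    (α - β) * (x ⬝ᵥ x) ≤ x ⬝ᵥ A *ᵥ x := by
  have hterm : ∀ a b, (if a = b then α * (x a * x a) else 0) - β / k * (|x a| * |x b|) ≤
      x a * A a b * x b := by
    intro a b
    split_ifs with h
    · subst h
      have h1 := mul_le_mul_of_nonneg_right (hd a) (mul_self_nonneg (x a))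
      have h2 : 0 ≤ β / k * (|x a| * |x a|) := by positivity
      linarith
    · have h1 : |x a * A a b * x b| ≤ β / k * (|x a| * |x b|) := by
        rw [abs_mul, abs_mul, mul_right_comm, mul_comm (_ * _)]
        exact mul_le_mul_of_nonneg_right (ho a b h) (by positivity)
      linarith [neg_abs_le (x a * A a b * x b)]
  have hsum := Finset.sum_le_sum fun a (_ : a ∈ Finset.univ) =>
    Finset.sum_le_sum fun b (_ : b ∈ Finset.univ) => hterm a b
  rw [dotProduct_mulVec_eq_sum]
  refine le_trans ?_ hsum
  simp only [Finset.sum_sub_distrib, Finset.sum_ite_eq, Finset.mem_univ, if_true,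
    ← Finset.mul_sum, ← Finset.sum_mul]
  have h3 := sq_sum_abs_le x
  have h4 : β / k * ((∑ a, |x a|) * ∑ a, |x a|) ≤ β * (x ⬝ᵥ x) := by
    rcases Nat.eq_zero_or_pos k with rfl | hk
    · simp
    have hk' : (0 : ℝ) < k := by exact_mod_cast hk
    rw [← sq]
    calc β / k * (∑ a, |x a|) ^ 2 ≤ β / k * (k * (x ⬝ᵥ x)) := by gcongr
      _ = _ := by field_simp
  rw [sub_mul, show ∑ i, x i * x i = x ⬝ᵥ x from rfl]
  linarith

theorem abs_dotProduct_mulVec_le_of_entrywise {A : Matrix (Fin k) (Fin k) ℝ} {δ : ℝ} (hδ : 0 ≤ δ)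
    (hA : ∀ a b, |A a b| ≤ δ) (x y : Fin k → ℝ) :
    |x ⬝ᵥ A *ᵥ y| ≤ δ * k * (√(x ⬝ᵥ x) * √(y ⬝ᵥ y)) := by
  have h1 : |x ⬝ᵥ A *ᵥ y| ≤ δ * ((∑ a, |x a|) * ∑ b, |y b|) := by
    rw [dotProduct_mulVec_eq_sum, Finset.sum_mul_sum, Finset.mul_sum]
    refine (Finset.abs_sum_le_sum_abs _ _).trans (Finset.sum_le_sum fun a _ => ?_)
    rw [Finset.mul_sum]
    refine (Finset.abs_sum_le_sum_abs _ _).trans (Finset.sum_le_sum fun b _ => ?_)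
    rw [abs_mul, abs_mul, mul_right_comm, mul_comm (_ * _)]
    exact mul_le_mul_of_nonneg_right (hA a b) (by positivity)
  have h2 : ∀ z : Fin k → ℝ, ∑ a, |z a| ≤ √k * √(z ⬝ᵥ z) := fun z => by
    rw [← Real.sqrt_mul (Nat.cast_nonneg k)]
    exact Real.le_sqrt_of_sq_le (sq_sum_abs_le z)
  refine h1.trans ?_
  rw [mul_assoc]
  refine mul_le_mul_of_nonneg_left ?_ hδ
  calc _ ≤ (√k * √(x ⬝ᵥ x)) * (√k * √(y ⬝ᵥ y)) := by
        gcongr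
        · exact h2 x
        · exact h2 y
    _ = (√k * √k) * (√(x ⬝ᵥ x) * √(y ⬝ᵥ y)) := by ring
    _ = _ := by rw [Real.mul_self_sqrt (Nat.cast_nonneg k)]

end quadratic

section signs

open Matrix

variable {n k : ℕ}

/-- The matrix whose columns are the given sign vectors. -/
def signMatrix (G : Fin k → Fin n → ℤˣ) : Matrix (Fin n) (Fin k) ℝ :=
  Matrix.of fun s a => signVec (G a) s

/-- The matrix of the form `M` in terms of the sign vectors `G` and `H`. -/
def signForm (M : Matrix (Fin n) (Fin n) ℝ) (G H : Fin k → Fin n → ℤˣ) :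
    Matrix (Fin k) (Fin k) ℝ :=
  (signMatrix G)ᵀ * M * signMatrix H

theorem signForm_apply (M : Matrix (Fin n) (Fin n) ℝ) (G H : Fin k → Fin n → ℤˣ) (a b : Fin k) :
    signForm M G H a b = signVec (G a) ⬝ᵥ M *ᵥ signVec (H b) := by
  rw [signForm, Matrix.mul_assoc, mul_apply]
  rfl

theorem dotProduct_signForm_mulVec (M : Matrix (Fin n) (Fin n) ℝ) (G H : Fin k → Fin n → ℤˣ)
    (x y : Fin k → ℝ) :
    x ⬝ᵥ signForm M G H *ᵥ y = signMatrix G *ᵥ x ⬝ᵥ M *ᵥ (signMatrix H *ᵥ y) := by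
  rw [signForm, ← mulVec_mulVec, ← mulVec_mulVec, dotProduct_mulVec, vecMul_transpose]

theorem abs_signForm_apply_le {M : Matrix (Fin n) (Fin n) ℝ} {δ : ℝ} (hM : ∀ s t, |M s t| ≤ δ)
    (G H : Fin k → Fin n → ℤˣ) (a b : Fin k) : |signForm M G H a b| ≤ n * n * δ := by
  rw [signForm_apply, dotProduct_mulVec_eq_sum]
  calc _ ≤ ∑ _s : Fin n, ∑ _t : Fin n, δ := by
        refine (Finset.abs_sum_le_sum_abs _ _).trans (Finset.sum_le_sum fun s _ => ?_)
        refine (Finset.abs_sum_le_sum_abs _ _).trans (Finset.sum_le_sum fun t _ => ?_)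
        rw [abs_mul, abs_mul, abs_signVec, abs_signVec, one_mul, mul_one]
        exact hM s t
    _ = _ := by simp [mul_assoc]

theorem signForm_sub (M L : Matrix (Fin n) (Fin n) ℝ) (G H : Fin k → Fin n → ℤˣ) :
    signForm (M - L) G H = signForm M G H - signForm L G H := by
  simp only [signForm, Matrix.mul_sub, Matrix.sub_mul]

theorem signMatrix_mulVec_dotProduct_self_le {G : Fin k → Fin n → ℤˣ}
    (hG : ∀ a b, a ≠ b → |signVec (G a) ⬝ᵥ signVec (G b)| ≤ n / k) (x : Fin k → ℝ) :
    signMatrix G *ᵥ x ⬝ᵥ signMatrix G *ᵥ x ≤ 2 * n * (x ⬝ᵥ x) := by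
  have h := le_dotProduct_mulVec_of_diag_dominant (A := -signForm 1 G G) (α := -n) (β := n)
    (Nat.cast_nonneg n) (fun a => by
      rw [neg_apply, signForm_apply, one_mulVec, signVec_dotProduct_self]) (fun a b hab => by
      rw [neg_apply, abs_neg, signForm_apply, one_mulVec]
      exact hG a b hab) x
  rw [neg_mulVec, dotProduct_neg, dotProduct_signForm_mulVec, one_mulVec] at h
  linarith

end signs

section counting

open Matrix

theorem card_exists_le {Γ ι : Type*} [Fintype Γ] [Fintype ι] (P : ι → Γ → Prop) {q : ℝ}
    (h : ∀ i, (Nat.card {g // P i g} : ℝ) ≤ q * Fintype.card Γ) :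
    (Nat.card {g // ∃ i, P i g} : ℝ) ≤ Fintype.card ι * q * Fintype.card Γ := by
  classical
  have h1 : Nat.card {g // ∃ i, P i g} ≤ ∑ i, Nat.card {g // P i g} := by
    simp only [Nat.card_eq_fintype_card, Fintype.card_subtype]
    refine le_trans (Finset.card_le_card ?_) Finset.card_biUnion_le
    intro g hg
    simpa using hg
  calc (Nat.card {g // ∃ i, P i g} : ℝ) ≤ ∑ i, (Nat.card {g // P i g} : ℝ) := by exact_mod_cast h1
    _ ≤ ∑ _i : ι, q * Fintype.card Γ := Finset.sum_le_sum fun i _ => h i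
    _ = _ := by simp [mul_assoc]

theorem card_or_le {Γ : Type*} [Fintype Γ] (P Q : Γ → Prop) {p q : ℝ}
    (hP : (Nat.card {g // P g} : ℝ) ≤ p * Fintype.card Γ)
    (hQ : (Nat.card {g // Q g} : ℝ) ≤ q * Fintype.card Γ) :
    (Nat.card {g // P g ∨ Q g} : ℝ) ≤ (p + q) * Fintype.card Γ := by
  classical
  have h1 : Nat.card {g // P g ∨ Q g} ≤ Nat.card {g // P g} + Nat.card {g // Q g} := by
    simp only [Nat.card_eq_fintype_card]
    exact Fintype.card_subtype_or _ _
  have h2 : (Nat.card {g // P g ∨ Q g} : ℝ) ≤ Nat.card {g // P g} + Nat.card {g // Q g} := by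
    exact_mod_cast h1
  linarith

theorem card_le_of_imp {Γ : Type*} [Fintype Γ] {P Q : Γ → Prop} (h : ∀ g, P g → Q g) :
    (Nat.card {g // P g} : ℝ) ≤ Nat.card {g // Q g} := by
  exact_mod_cast Nat.card_le_card_of_injective (Subtype.map id h)
    (Subtype.map_injective h Function.injective_id)

/-- Passing to a subset containing at least half of the elements at most doubles proportions. -/
theorem card_subtype_le_two_mul {Γ : Type*} [Fintype Γ] {A : Γ → Prop} [Fintype {g // A g}]
    (hA : (Nat.card {g // ¬ A g} : ℝ) ≤ 1 / 2 * Fintype.card Γ) {P : Γ → Prop} {q : ℝ} (hq : 0 ≤ q)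
    (hP : (Nat.card {g // P g} : ℝ) ≤ q * Fintype.card Γ) :
    (Nat.card {g : {g // A g} // P g.1} : ℝ) ≤ 2 * q * Fintype.card {g // A g} := by
  classical
  have h1 : Nat.card {g : {g // A g} // P g.1} ≤ Nat.card {g // P g} :=
    Nat.card_le_card_of_injective (fun g => ⟨g.1.1, g.2⟩) fun g h hgh =>
      Subtype.ext (Subtype.ext (Subtype.mk.inj hgh))
  have h1' : (Nat.card {g : {g // A g} // P g.1} : ℝ) ≤ Nat.card {g // P g} := by exact_mod_cast h1
  have h2 : (Fintype.card Γ : ℝ) = Fintype.card {g // A g} + Nat.card {g // ¬ A g} := by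
    rw [Nat.card_eq_fintype_card, ← Nat.cast_add, Fintype.card_subtype_compl,
      Nat.add_sub_cancel' (Fintype.card_subtype_le A)]
  nlinarith

variable {n k m : ℕ} {M : Matrix (Fin n) (Fin n) ℝ}

theorem card_quadratic_lt_le (hm : 0 < m) (hM : M ∈ projectionMatrices n m) :
    (Nat.card {ε : Fin n → ℤˣ // signVec ε ⬝ᵥ M *ᵥ signVec ε < 7 / 8 * m} : ℝ) ≤
      128 / m * Fintype.card (Fin n → ℤˣ) := by
  classical
  obtain ⟨hMt, hMM, htr⟩ := hM
  have hm' : (0 : ℝ) < m := by exact_mod_cast hm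
  have hr : 0 < M.trace := hm'.trans_le htr
  have h := sum_sq_quadratic_sub_trace_le M hMt
  rw [sum_sq_eq_trace_of_isProj hMt hMM] at h
  rw [Nat.card_eq_fintype_card, Fintype.card_subtype]
  set E := Finset.univ.filter fun ε : Fin n → ℤˣ => signVec ε ⬝ᵥ M *ᵥ signVec ε < 7 / 8 * m
  have h1 : (E.card : ℝ) * (M.trace / 8) ^ 2 ≤
      ∑ ε : Fin n → ℤˣ, (signVec ε ⬝ᵥ M *ᵥ signVec ε - M.trace) ^ 2 := by
    rw [← nsmul_eq_mul]
    refine (Finset.card_nsmul_le_sum E _ _ fun ε hε => ?_).trans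
      (Finset.sum_le_univ_sum_of_nonneg fun ε => sq_nonneg _)
    have : signVec ε ⬝ᵥ M *ᵥ signVec ε < 7 / 8 * m := (Finset.mem_filter.1 hε).2
    rw [← neg_sq (_ - _)]
    exact pow_le_pow_left₀ (by positivity) (by linarith) 2
  have h2 := h1.trans h
  have h3 : (E.card : ℝ) * M.trace ≤ 128 * Fintype.card (Fin n → ℤˣ) := by
    refine le_of_mul_le_mul_right ?_ hr
    nlinarith
  rw [div_mul_eq_mul_div, le_div_iff₀ hm']
  exact (mul_le_mul_of_nonneg_left htr (Nat.cast_nonneg _)).trans h3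

theorem card_diag_lt_le (hm : 0 < m) (hM : M ∈ projectionMatrices n m) (a : Fin k) :
    (Nat.card {G : Fin k → Fin n → ℤˣ // signForm M G G a a < 7 / 8 * m} : ℝ) ≤
      128 / m * Fintype.card (Fin k → Fin n → ℤˣ) := by
  refine card_le_of_forall_update _ a _ fun G => ?_
  simpa only [signForm_apply, Function.update_self] using card_quadratic_lt_le hm hM

theorem card_offDiag_gt_le (hn : 0 < n) (hM : Mᵀ = M) (hMM : M * M = M) {t : ℝ} (ht : 0 ≤ t)
    {a b : Fin k} (hab : a ≠ b) :
    (Nat.card {G : Fin k → Fin n → ℤˣ // t < |signForm M G G a b|} : ℝ) ≤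
      2 * Real.exp (-t ^ 2 / (2 * n)) * Fintype.card (Fin k → Fin n → ℤˣ) := by
  refine card_le_of_forall_update _ a _ fun G => ?_
  simp only [signForm_apply, Function.update_self, Function.update_of_ne hab.symm]
  simp only [dotProduct_comm (signVec _)]
  refine card_signVec_gt_le _ (by exact_mod_cast hn) ht ?_
  exact (mulVec_dotProduct_self_le_of_isProj hM hMM _).trans_eq (signVec_dotProduct_self _)

theorem card_signForm_gt_le (hn : 0 < n) (hM : Mᵀ = M) (hMM : M * M = M)
    {H : Fin k → Fin n → ℤˣ}
    (hH : ∀ a b, a ≠ b → |signVec (H a) ⬝ᵥ signVec (H b)| ≤ n / k) {x y : Fin k → ℝ}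
    (hx : x ⬝ᵥ x ≤ 4) (hy : y ⬝ᵥ y ≤ 4) {t : ℝ} (ht : 0 ≤ t) :
    (Nat.card {G : Fin k → Fin n → ℤˣ // t < |x ⬝ᵥ signForm M G H *ᵥ y|} : ℝ) ≤
      2 * Real.exp (-t ^ 2 / (64 * n)) * Fintype.card (Fin k → Fin n → ℤˣ) := by
  have hn' : (0 : ℝ) < n := by exact_mod_cast hn
  set p := M *ᵥ (signMatrix H *ᵥ y) with hp
  have hpp : p ⬝ᵥ p ≤ 8 * n := by
    refine (mulVec_dotProduct_self_le_of_isProj hM hMM _).trans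
      ((signMatrix_mulVec_dotProduct_self_le hH y).trans ?_)
    nlinarith
  let c : Fin k × Fin n → ℝ := fun q => x q.1 * p q.2
  have hc : c ⬝ᵥ c ≤ 32 * n := by
    have h1 : c ⬝ᵥ c = (x ⬝ᵥ x) * (p ⬝ᵥ p) := by
      simp only [dotProduct, Fintype.sum_prod_type, Finset.sum_mul_sum, c]
      exact Finset.sum_congr rfl fun a _ => Finset.sum_congr rfl fun s _ => by ring
    rw [h1]
    calc _ ≤ 4 * (8 * (n : ℝ)) := mul_le_mul hx hpp (dotProduct_self_nonneg p) (by norm_num)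
      _ = 32 * (n : ℝ) := by ring
  have h := card_signVec_gt_le c (v := 32 * n) (by positivity) ht hc
  rw [Fintype.card_congr (Equiv.curry (Fin k) (Fin n) ℤˣ)] at h
  rw [show (64 : ℝ) * n = 2 * (32 * n) by ring]
  refine le_trans (le_of_eq ?_) h
  congr 1
  refine Nat.card_congr ((Equiv.curry (Fin k) (Fin n) ℤˣ).subtypeEquiv fun ε => ?_).symm
  have h2 : c ⬝ᵥ signVec ε = x ⬝ᵥ signForm M (Equiv.curry (Fin k) (Fin n) ℤˣ ε) H *ᵥ y := by
    rw [dotProduct_signForm_mulVec, ← hp, ← vecMul_transpose, ← dotProduct_mulVec]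
    simp only [dotProduct, mulVec, Fintype.sum_prod_type, Finset.mul_sum, c]
    exact Finset.sum_congr rfl fun a _ => Finset.sum_congr rfl fun s _ => by
      simp only [signMatrix, transpose_apply, of_apply, signVec, Equiv.curry_apply,
        Function.curry_apply]
      ring
  rw [h2]

end counting

open Matrix in
theorem card_exists_offDiag_gt_le {n k : ℕ} {M : Matrix (Fin n) (Fin n) ℝ} (hn : 0 < n)
    (hM : Mᵀ = M) (hMM : M * M = M) {t : ℝ} (ht : 0 ≤ t) :
    (Nat.card {G : Fin k → Fin n → ℤˣ //
        ∃ p : Fin k × Fin k, p.1 ≠ p.2 ∧ t < |signForm M G G p.1 p.2|} : ℝ) ≤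
      k * k * (2 * Real.exp (-t ^ 2 / (2 * n))) * Fintype.card (Fin k → Fin n → ℤˣ) := by
  have h := card_exists_le (q := 2 * Real.exp (-t ^ 2 / (2 * n)))
    (fun (p : Fin k × Fin k) (G : Fin k → Fin n → ℤˣ) =>
      p.1 ≠ p.2 ∧ t < |signForm M G G p.1 p.2|) fun p => by
    by_cases hp : p.1 = p.2
    · simp only [hp, ne_eq, not_true_eq_false, false_and, Nat.card_of_isEmpty, Nat.cast_zero]
      positivity
    · exact (card_le_of_imp fun G hG => hG.2).trans (card_offDiag_gt_le hn hM hMM ht hp)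
  simpa using h

open Matrix in
theorem card_exists_signForm_gt_le {n k : ℕ} {M : Matrix (Fin n) (Fin n) ℝ} (hn : 0 < n)
    (hM : Mᵀ = M) (hMM : M * M = M) {H : Fin k → Fin n → ℤˣ}
    (hH : ∀ a b, a ≠ b → |signVec (H a) ⬝ᵥ signVec (H b)| ≤ n / k) {s : Finset (Fin k → ℝ)}
    (hs : s.card ≤ 5 ^ k) (hs4 : ∀ z ∈ s, z ⬝ᵥ z ≤ 4) {t : ℝ} (ht : 0 ≤ t) :
    (Nat.card {G : Fin k → Fin n → ℤˣ //
        ∃ p : s × s, t < |p.1.1 ⬝ᵥ signForm M G H *ᵥ p.2.1|} : ℝ) ≤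
      25 ^ k * (2 * Real.exp (-t ^ 2 / (64 * n))) * Fintype.card (Fin k → Fin n → ℤˣ) := by
  have h := card_exists_le (q := 2 * Real.exp (-t ^ 2 / (64 * n)))
    (fun (p : s × s) (G : Fin k → Fin n → ℤˣ) => t < |p.1.1 ⬝ᵥ signForm M G H *ᵥ p.2.1|)
    fun p => card_signForm_gt_le hn hM hMM hH (hs4 _ p.1.2) (hs4 _ p.2.2) ht
  refine h.trans ?_
  gcongr
  rw [Fintype.card_prod, Fintype.card_coe]
  have h1 : s.card * s.card ≤ 25 ^ k := by
    rw [show 25 = 5 * 5 by norm_num, mul_pow]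
    exact Nat.mul_le_mul hs hs
  exact_mod_cast h1

theorem exp_neg_le_one_div_pow {n : ℕ} (hn : 0 < n) {j : ℕ} {z : ℝ}
    (h : j * Real.log n ≤ z) : Real.exp (-z) ≤ (1 / n) ^ j := by
  have hn' : (0 : ℝ) < n := by exact_mod_cast hn
  calc Real.exp (-z) ≤ Real.exp (-(j * Real.log n)) := Real.exp_le_exp.2 (by linarith)
    _ = (1 / n) ^ j := by
      rw [Real.exp_neg, Real.exp_nat_mul, Real.exp_log hn', one_div, inv_pow]

theorem two_mul_lt_four_pow_of_le {n c : ℕ} (hn : 2 ≤ n)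
    (hc : c ≤ (2 * (4 * n ^ 3) + 1) ^ (n * n)) : 2 * c < 4 ^ (7 * n ^ 3) := by
  have hn0 : 0 < n := by omega
  have h1 : 2 * (4 * n ^ 3) + 1 ≤ n ^ 7 := by
    have : 2 ^ 4 ≤ n ^ 4 := Nat.pow_le_pow_left hn 4
    have h3 : 1 ≤ n ^ 3 := Nat.one_le_pow _ _ hn0
    calc 2 * (4 * n ^ 3) + 1 ≤ 2 ^ 4 * n ^ 3 := by omega
      _ ≤ n ^ 4 * n ^ 3 := Nat.mul_le_mul_right _ this
      _ = n ^ 7 := by ring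
  have h2 : c ≤ 2 ^ (7 * n ^ 3) := by
    calc c ≤ (n ^ 7) ^ (n * n) := hc.trans (Nat.pow_le_pow_left h1 _)
      _ ≤ ((2 ^ n) ^ 7) ^ (n * n) := by
        gcongr
        exact Nat.lt_two_pow_self.le
      _ = 2 ^ (7 * n ^ 3) := by rw [← pow_mul, ← pow_mul]; ring_nf
  have h3 : 2 < 2 ^ (7 * n ^ 3) := by
    have : 1 ≤ n ^ 3 := Nat.one_le_pow _ _ hn0
    calc 2 < 2 ^ 7 := by norm_num
      _ ≤ 2 ^ (7 * n ^ 3) := Nat.pow_le_pow_right (by norm_num) (by omega)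
  calc 2 * c ≤ 2 * 2 ^ (7 * n ^ 3) := by gcongr
    _ < 2 ^ (7 * n ^ 3) * 2 ^ (7 * n ^ 3) := by gcongr
    _ = 4 ^ (7 * n ^ 3) := by rw [← mul_pow]; norm_num

theorem twentyFive_pow_mul_exp_le {n m k : ℕ} (hn : 2 ≤ n) (hk : 0 < k)
    (hmk : 2 ^ 32 * (k ^ 2 * (n * Real.log n)) ≤ (m : ℝ) ^ 2) :
    25 ^ k * (2 * Real.exp (-((m : ℝ) / (4 * √k)) ^ 2 / (64 * n))) ≤ 2 * (1 / (n : ℝ)) ^ 40 := by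
  have hn0 : 0 < n := by omega
  have hn2 : (2 : ℝ) ≤ n := by exact_mod_cast hn
  have hL : 0 ≤ Real.log n := Real.log_natCast_nonneg n
  have hk1 : (1 : ℝ) ≤ k := by exact_mod_cast hk
  have hsk : 0 < √(k : ℝ) := Real.sqrt_pos.2 (by linarith)
  have hsk2 : √(k : ℝ) ^ 2 = k := Real.sq_sqrt (by linarith)
  set u : ℝ := 1 / n with hu
  have hu0 : 0 < u := by positivity
  have hu2 : u ≤ 1 / 2 := by
    rw [hu]
    exact one_div_le_one_div_of_le (by norm_num) hn2
  have h1 : Real.exp (-((m : ℝ) / (4 * √k)) ^ 2 / (64 * n)) ≤ u ^ (45 * k) := by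
    rw [neg_div]
    refine exp_neg_le_one_div_pow hn0 ?_
    rw [le_div_iff₀ (by positivity), div_pow, mul_pow, hsk2, le_div_iff₀ (by positivity)]
    push_cast
    have : 0 ≤ (k : ℝ) ^ 2 * (n * Real.log n) := by positivity
    nlinarith
  have h2 : 25 * u ^ 5 ≤ 1 := by
    have := pow_le_pow_left₀ hu0.le hu2 5
    linarith
  have h3 : (25 : ℝ) ^ k * u ^ (45 * k) ≤ u ^ 40 := by
    calc (25 : ℝ) ^ k * u ^ (45 * k) = (25 * u ^ 5) ^ k * (u ^ 40) ^ k := by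
          rw [pow_mul, ← mul_pow, ← mul_pow]
          ring
      _ ≤ 1 * (u ^ 40) ^ 1 := by
          gcongr ?_ * ?_
          · exact pow_le_one₀ (by positivity) h2
          · exact pow_le_pow_of_le_one (by positivity) (pow_le_one₀ hu0.le (by linarith)) hk
      _ = _ := by ring
  calc _ = 2 * (25 ^ k * Real.exp (-((m : ℝ) / (4 * √k)) ^ 2 / (64 * n))) := by ring
    _ ≤ 2 * (25 ^ k * u ^ (45 * k)) := by gcongr
    _ ≤ _ := by gcongr

open Matrix in
theorem abs_signForm_sub_le {n k : ℕ} (hn : 0 < n) (hkn : (k : ℝ) ≤ n)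
    {M L : Matrix (Fin n) (Fin n) ℝ} (hML : ∀ s t, |M s t - L s t| ≤ 1 / (4 * n ^ 3))
    (G H : Fin k → Fin n → ℤˣ) (x y : Fin k → ℝ) :
    |x ⬝ᵥ signForm M G H *ᵥ y - x ⬝ᵥ signForm L G H *ᵥ y| ≤
      1 / 4 * (√(x ⬝ᵥ x) * √(y ⬝ᵥ y)) := by
  have hn' : (0 : ℝ) < n := by exact_mod_cast hn
  have h1 := abs_signForm_apply_le (M := M - L) hML G H
  have h2 := abs_dotProduct_mulVec_le_of_entrywise (by positivity) h1 x y
  rw [signForm_sub, sub_mulVec, dotProduct_sub] at h2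
  refine h2.trans ?_
  gcongr
  calc (n : ℝ) * n * (1 / (4 * n ^ 3)) * k ≤ (n : ℝ) * n * (1 / (4 * n ^ 3)) * n := by gcongr
    _ = 1 / 4 := by field_simp

open Matrix in
/-- Random sign matrices satisfy, simultaneously for all projections of large rank, that some
member of the family is well conditioned and nearly orthogonal to the other members. -/
theorem exists_signMatrices {n m k : ℕ} (hn : 2 ≤ n) (hk : 0 < k) (hmn : m ≤ n)
    (hkm : 2 ^ 16 * (k : ℝ) ≤ m) (hmk : 2 ^ 32 * (k ^ 2 * (n * Real.log n)) ≤ (m : ℝ) ^ 2) :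
    ∃ (N : ℕ) (G : Fin N → Fin k → Fin n → ℤˣ),
      (∀ j x, signMatrix (G j) *ᵥ x ⬝ᵥ signMatrix (G j) *ᵥ x ≤ 2 * n * (x ⬝ᵥ x)) ∧
      ∀ M ∈ projectionMatrices n m, ∃ j,
        (∀ x, m / 2 * (x ⬝ᵥ x) ≤ x ⬝ᵥ signForm M (G j) (G j) *ᵥ x) ∧
        ∀ i, i ≠ j → ∀ x y, |x ⬝ᵥ signForm M (G j) (G i) *ᵥ y| ≤
          m / (2 * √k) * (√(x ⬝ᵥ x) * √(y ⬝ᵥ y)) := by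
  classical
  have hn0 : 0 < n := by omega
  have hk1 : (1 : ℝ) ≤ k := by exact_mod_cast hk
  have hn2 : (2 : ℝ) ≤ n := by exact_mod_cast hn
  have hnm : (m : ℝ) ≤ n := by exact_mod_cast hmn
  have hm0 : (0 : ℝ) < m := by nlinarith
  have hm : 0 < m := by exact_mod_cast hm0
  have hkm' : (k : ℝ) ≤ m := by nlinarith
  have hL : 0 ≤ Real.log n := Real.log_natCast_nonneg n
  have hsk : 0 < √(k : ℝ) := Real.sqrt_pos.2 (by linarith)
  have hsk2 : √(k : ℝ) ^ 2 = k := Real.sq_sqrt (by linarith)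
  have hskk : √(k : ℝ) ≤ k := by nlinarith
  set u : ℝ := 1 / n with hu
  have hu0 : 0 < u := by positivity
  have hun : u * n = 1 := by rw [hu]; field_simp
  have hu2 : u ≤ 1 / 2 := by
    rw [hu]
    exact one_div_le_one_div_of_le (by norm_num) hn2
  obtain ⟨s, hs, hs4, hnet⟩ := exists_net_bilinear k
  let good : (Fin k → Fin n → ℤˣ) → Prop := fun G =>
    ∀ a b, a ≠ b → |signVec (G a) ⬝ᵥ signVec (G b)| ≤ n / k
  have hexpD : Real.exp (-((m : ℝ) / 8 / k) ^ 2 / (2 * n)) ≤ u ^ 40 := by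
    rw [neg_div]
    refine exp_neg_le_one_div_pow hn0 ?_
    rw [le_div_iff₀ (by positivity), div_pow, div_pow, le_div_iff₀ (by positivity)]
    push_cast
    have : 0 ≤ (k : ℝ) ^ 2 * (n * Real.log n) := by positivity
    nlinarith
  have hexpO : Real.exp (-((n : ℝ) / k) ^ 2 / (2 * n)) ≤ u ^ 40 := by
    rw [neg_div]
    refine exp_neg_le_one_div_pow hn0 ?_
    rw [le_div_iff₀ (by positivity), div_pow, le_div_iff₀ (by positivity)]
    push_cast
    have : 0 ≤ (k : ℝ) ^ 2 * (n * Real.log n) := by positivity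
    nlinarith
  have hexpR := twentyFive_pow_mul_exp_le hn hk hmk
  have hk2 : (k : ℝ) * k * (2 * u ^ 40) ≤ 2 * u ^ 38 := by
    calc (k : ℝ) * k * (2 * u ^ 40) ≤ n * n * (2 * u ^ 40) := by
          have : (k : ℝ) ≤ n := hkm'.trans hnm
          gcongr
      _ = 2 * u ^ 38 * (u * n) ^ 2 := by ring
      _ = _ := by rw [hun]; ring
  have hu38 : u ^ 38 ≤ (1 / 2) ^ 38 := pow_le_pow_left₀ hu0.le hu2 38
  have hgood : (Nat.card {G : Fin k → Fin n → ℤˣ // ¬ good G} : ℝ) ≤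
      1 / 2 * Fintype.card (Fin k → Fin n → ℤˣ) := by
    have h := card_exists_offDiag_gt_le (k := k) (M := 1) hn0 transpose_one (one_mul 1)
      (t := n / k) (by positivity)
    refine (card_le_of_imp fun G hG => ?_).trans (h.trans ?_)
    · simp only [good, not_forall, not_le] at hG
      obtain ⟨a, b, hab, hlt⟩ := hG
      exact ⟨(a, b), hab, by rwa [signForm_apply, one_mulVec]⟩
    · gcongr
      calc (k : ℝ) * k * (2 * Real.exp (-((n : ℝ) / k) ^ 2 / (2 * n)))
          ≤ k * k * (2 * u ^ 40) := by gcongr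
        _ ≤ 2 * u ^ 38 := hk2
        _ ≤ 1 / 2 := by norm_num at hu38 ⊢; linarith
  have hne : Nonempty {G : Fin k → Fin n → ℤˣ // good G} := by
    by_contra hempty
    have hall : ∀ G, ¬ good G := fun G hG => hempty ⟨⟨G, hG⟩⟩
    have hcard : Nat.card {G : Fin k → Fin n → ℤˣ // ¬ good G} =
        Fintype.card (Fin k → Fin n → ℤˣ) := by
      rw [← Nat.card_eq_fintype_card]
      exact Nat.card_congr (Equiv.subtypeUnivEquiv hall)
    rw [hcard] at hgood
    have : (0 : ℝ) < Fintype.card (Fin k → Fin n → ℤˣ) := by exact_mod_cast Fintype.card_pos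
    linarith
  obtain ⟨μ, hμfin, F, hFS, hμcard, hF⟩ := exists_entrywise_net (projectionMatrices n m)
    (fun M hM => abs_apply_le_one_of_isProj hM.1 hM.2.1) (4 * n ^ 3) (by positivity)
  let D : μ → {G : Fin k → Fin n → ℤˣ // good G} → Prop := fun c G =>
    (∃ a, signForm (F c) G.1 G.1 a a < 7 / 8 * m) ∨
      ∃ p : Fin k × Fin k, p.1 ≠ p.2 ∧ (m : ℝ) / 8 / k < |signForm (F c) G.1 G.1 p.1 p.2|
  let R : μ → {G : Fin k → Fin n → ℤˣ // good G} → {G : Fin k → Fin n → ℤˣ // good G} → Prop :=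
    fun c H G => ∃ p : s × s, (m : ℝ) / (4 * √k) < |p.1.1 ⬝ᵥ signForm (F c) G.1 H.1 *ᵥ p.2.1|
  obtain ⟨ω, hω⟩ := exists_seq_forall_exists_no_conflict D R
    (p := 2 * (k * (128 / m) + 2 * u ^ 38)) (q := 2 * (2 * u ^ 40)) (by positivity) (7 * n ^ 3)
    (fun c => by
      have h1 := card_exists_le (fun (a : Fin k) (G : Fin k → Fin n → ℤˣ) =>
        signForm (F c) G G a a < 7 / 8 * m) fun a => card_diag_lt_le hm (hFS c) a
      have h2 := card_exists_offDiag_gt_le (k := k) hn0 (hFS c).1 (hFS c).2.1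
        (t := (m : ℝ) / 8 / k) (by positivity)
      rw [Fintype.card_fin] at h1
      have h3 := (card_or_le _ _ h1 h2).trans (mul_le_mul_of_nonneg_right
        (add_le_add_right (le_trans (by gcongr) hk2) _) (Nat.cast_nonneg _))
      have h4 := card_subtype_le_two_mul hgood (by positivity) h3
      exact h4)
    (fun c H => by
      have h := card_exists_signForm_gt_le hn0 (hFS c).1 (hFS c).2.1 H.2 hs hs4
        (t := (m : ℝ) / (4 * √k)) (by positivity)
      have h1 := h.trans (mul_le_mul_of_nonneg_right hexpR (Nat.cast_nonneg _))
      have h2 := card_subtype_le_two_mul hgood (by positivity) h1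
      exact h2)
    (by
      have h1 : (k : ℝ) * (128 / m) ≤ 1 / 2 ^ 9 := by
        rw [mul_div_assoc', div_le_div_iff₀ hm0 (by positivity)]
        linarith
      have h2 : ((7 * n ^ 3 : ℕ) : ℝ) * (2 * (2 * u ^ 40)) = 28 * u ^ 37 * (u * n) ^ 3 := by
        push_cast
        ring
      have hu37 : u ^ 37 ≤ (1 / 2) ^ 37 := pow_le_pow_left₀ hu0.le hu2 37
      rw [h2, hun]
      norm_num at hu38 hu37 h1 ⊢
      linarith)
    (two_mul_lt_four_pow_of_le hn hμcard)
  refine ⟨7 * n ^ 3, fun j => (ω j).1, fun j x =>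
    signMatrix_mulVec_dotProduct_self_le (ω j).2 x, fun M hM => ?_⟩
  obtain ⟨c, hc⟩ := hF M hM
  obtain ⟨j, hDj, hRj⟩ := hω c
  have hpert := abs_signForm_sub_le hn0 (hkm'.trans hnm) (by exact_mod_cast hc)
  simp only [D, not_or, not_exists, not_lt, not_and] at hDj
  refine ⟨j, fun x => ?_, fun i hij x y => ?_⟩
  · have h1 := le_dotProduct_mulVec_of_diag_dominant (by positivity) hDj.1
      (fun a b hab => hDj.2 (a, b) hab) x
    have h2 := (abs_le.1 (hpert (ω j).1 (ω j).1 x x)).1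
    have hx := dotProduct_self_nonneg x
    rw [Real.mul_self_sqrt hx] at h2
    have hm1 : (1 : ℝ) ≤ m := by exact_mod_cast hm
    have h3 := mul_le_mul_of_nonneg_right hm1 hx
    linarith
  · have h1 := hRj i hij
    simp only [R, not_exists, not_lt] at h1
    have h2 := hnet (signForm (F c) (ω j).1 (ω i).1) _ (fun x hx y hy => h1 (⟨x, hx⟩, ⟨y, hy⟩)) x y
    have h3 := hpert (ω j).1 (ω i).1 x y
    have h4 : (1 : ℝ) / 4 ≤ m / (4 * √k) := by
      rw [div_le_div_iff₀ (by norm_num) (by positivity)]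
      linarith
    have h5 : (m : ℝ) / (2 * √k) = m / (4 * √k) + m / (4 * √k) := by field_simp; norm_num
    have h6 : 0 ≤ √(x ⬝ᵥ x) * √(y ⬝ᵥ y) := by positivity
    have h7 := abs_sub_abs_le_abs_sub (x ⬝ᵥ signForm M (ω j).1 (ω i).1 *ᵥ y)
      (x ⬝ᵥ signForm (F c) (ω j).1 (ω i).1 *ᵥ y)
    have h8 := mul_le_mul_of_nonneg_right h4 h6
    rw [h5, add_mul]
    linarith

open Matrix in
/-- Every subspace of `ℝⁿ` of codimension at least `m` is annihilated by an orthogonal projection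
of rank at least `m`. -/
theorem exists_mem_projectionMatrices {n m : ℕ} (Z : Submodule ℝ (Fin n → ℝ))
    (hZ : m ≤ Module.finrank ℝ ((Fin n → ℝ) ⧸ Z)) :
    ∃ M ∈ projectionMatrices n m, ∀ v ∈ Z, M *ᵥ v = 0 := by
  let toE : (Fin n → ℝ) ≃ₗ[ℝ] EuclideanSpace ℝ (Fin n) := (WithLp.linearEquiv 2 ℝ _).symm
  let Z' : Submodule ℝ (EuclideanSpace ℝ (Fin n)) := Z.map toE.toLinearMap
  let b := stdOrthonormalBasis ℝ Z'ᗮ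
  have hinner : ∀ v w : EuclideanSpace ℝ (Fin n), inner ℝ v w = v.ofLp ⬝ᵥ w.ofLp := fun v w => by
    rw [EuclideanSpace.inner_eq_star_dotProduct, dotProduct_comm]
    rfl
  let B : Matrix (Fin n) (Fin (Module.finrank ℝ Z'ᗮ)) ℝ := Matrix.of fun s i => (b i).1.ofLp s
  have hBB : Bᵀ * B = 1 := by
    ext i j
    rw [mul_apply, one_apply, ← orthonormal_iff_ite.1 b.orthonormal i j, Submodule.coe_inner,
      hinner]
    rfl
  have hrank : Module.finrank ℝ ((Fin n → ℝ) ⧸ Z) = Module.finrank ℝ Z'ᗮ := by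
    have h1 := Z'.finrank_add_finrank_orthogonal
    have h2 := Z.finrank_quotient_add_finrank
    have h3 : Module.finrank ℝ Z' = Module.finrank ℝ Z := LinearEquiv.finrank_map_eq toE Z
    rw [finrank_euclideanSpace_fin] at h1
    rw [Module.finrank_fin_fun] at h2
    omega
  refine ⟨B * Bᵀ, ⟨by rw [transpose_mul, transpose_transpose], ?_, ?_⟩, fun v hv => ?_⟩
  · rw [Matrix.mul_assoc, ← Matrix.mul_assoc Bᵀ, hBB, Matrix.one_mul]
  · rw [trace_mul_comm, hBB, trace_one, Fintype.card_fin, ← hrank]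
    exact_mod_cast hZ
  · rw [← mulVec_mulVec]
    have : Bᵀ *ᵥ v = 0 := by
      ext i
      have h := Submodule.inner_left_of_mem_orthogonal (K := Z') (Submodule.mem_map_of_mem hv)
        (b i).2
      rw [hinner] at h
      exact h
    rw [this, mulVec_zero]

open Matrix in
theorem exists_leftInverse_of_coercive {W : Type*} [NormedAddCommGroup W] [NormedSpace ℝ W]
    {n m k : ℕ} (hm : 0 < m) (hk : 0 < k) (e : W ≃ₗ[ℝ] (Fin k → ℝ))
    (he : ∀ w, ‖w‖ ^ 2 ≤ e w ⬝ᵥ e w ∧ e w ⬝ᵥ e w ≤ k * ‖w‖ ^ 2) (M : Matrix (Fin n) (Fin n) ℝ)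
    (U : Matrix (Fin n) (Fin k) ℝ) (hU : ∀ x, m / 2 * (x ⬝ᵥ x) ≤ U *ᵥ x ⬝ᵥ M *ᵥ (U *ᵥ x)) :
    ∃ T : (Fin n → ℝ) →ₗ[ℝ] W, (∀ v, M *ᵥ v = 0 → T v = 0) ∧ (∀ w, T (U *ᵥ e w) = w) ∧
      ∀ V : Matrix (Fin n) (Fin k) ℝ,
        (∀ x y, |U *ᵥ x ⬝ᵥ M *ᵥ (V *ᵥ y)| ≤ m / (2 * √k) * (√(x ⬝ᵥ x) * √(y ⬝ᵥ y))) →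
        ∀ w, ‖T (V *ᵥ e w)‖ ≤ ‖w‖ := by
  have hm' : (0 : ℝ) < m := by exact_mod_cast hm
  have hk' : (0 : ℝ) < k := by exact_mod_cast hk
  have hsk : 0 < √(k : ℝ) := Real.sqrt_pos.2 hk'
  set B : Matrix (Fin k) (Fin k) ℝ := Uᵀ * M * U with hB
  have hform : ∀ x, x ⬝ᵥ B *ᵥ x = U *ᵥ x ⬝ᵥ M *ᵥ (U *ᵥ x) := fun x => by
    rw [hB, ← mulVec_mulVec, ← mulVec_mulVec, dotProduct_mulVec, vecMul_transpose]
  have hunit : IsUnit B := by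
    rw [← mulVec_injective_iff_isUnit]
    refine (injective_iff_map_eq_zero B.mulVecLin).2 fun x hx => ?_
    rw [mulVecLin_apply] at hx
    have h1 := hU x
    rw [← hform, hx, dotProduct_zero] at h1
    have h2 := dotProduct_self_nonneg x
    exact dotProduct_self_eq_zero.1 (by nlinarith)
  have hdet : IsUnit B.det := (isUnit_iff_isUnit_det B).1 hunit
  refine ⟨e.symm.toLinearMap ∘ₗ (B⁻¹ * (Uᵀ * M)).mulVecLin, fun v hv => ?_, fun w => ?_,
    fun V hV w => ?_⟩
  · simp only [LinearMap.comp_apply, mulVecLin_apply, ← mulVec_mulVec, hv, mulVec_zero, map_zero]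
  · simp only [LinearMap.comp_apply, mulVecLin_apply, mulVec_mulVec, LinearEquiv.coe_coe]
    rw [Matrix.mul_assoc, ← hB, nonsing_inv_mul B hdet, one_mulVec, e.symm_apply_apply]
  · set z := (B⁻¹ * (Uᵀ * M)) *ᵥ (V *ᵥ e w) with hz
    have hBz : B *ᵥ z = Uᵀ *ᵥ (M *ᵥ (V *ᵥ e w)) := by
      rw [hz, mulVec_mulVec, ← Matrix.mul_assoc B, mul_nonsing_inv B hdet, Matrix.one_mul,
        ← mulVec_mulVec _ Uᵀ]
    have h1 := hU z
    rw [← hform, hBz, dotProduct_mulVec z Uᵀ, vecMul_transpose] at h1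
    have h2 := (h1.trans (le_abs_self _)).trans (hV z (e w))
    have hzz := dotProduct_self_nonneg z
    have h3 : √(z ⬝ᵥ z) ≤ √(e w ⬝ᵥ e w) / √k := by
      rcases (Real.sqrt_nonneg (z ⬝ᵥ z)).eq_or_lt with h0 | h0
      · rw [← h0]
        positivity
      · refine le_of_mul_le_mul_left ?_ (mul_pos (half_pos hm') h0)
        calc (m / 2 * √(z ⬝ᵥ z)) * √(z ⬝ᵥ z) = m / 2 * (z ⬝ᵥ z) := by
              rw [mul_assoc, Real.mul_self_sqrt hzz]
          _ ≤ _ := h2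
          _ = _ := by field_simp
    have h4 : √(e w ⬝ᵥ e w) ≤ √k * ‖w‖ := by
      rw [Real.sqrt_le_left (by positivity), mul_pow, Real.sq_sqrt hk'.le]
      exact (he w).2
    have h5 : ‖e.symm z‖ ≤ √(z ⬝ᵥ z) := by
      have := (he (e.symm z)).1
      rw [e.apply_symm_apply] at this
      exact Real.le_sqrt_of_sq_le this
    calc ‖e.symm z‖ ≤ √(e w ⬝ᵥ e w) / √k := h5.trans h3
      _ ≤ ‖w‖ := by rwa [div_le_iff₀' hsk]

open Matrix in
theorem abs_dotProduct_single_mulVec_le {n m k : ℕ} (hn : 0 < n) (hkm : (k : ℝ) ≤ m)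
    (hk : 0 < k) {M : Matrix (Fin n) (Fin n) ℝ} (hM : Mᵀ = M) (hMM : M * M = M)
    {U : Matrix (Fin n) (Fin k) ℝ} (hU : ∀ x, U *ᵥ x ⬝ᵥ U *ᵥ x ≤ 2 * n * (x ⬝ᵥ x)) (s : Fin n)
    (a : Fin k) (x y : Fin k → ℝ) :
    |U *ᵥ x ⬝ᵥ M *ᵥ (Matrix.single s a (1 / (4 * n : ℝ)) *ᵥ y)| ≤
      m / (2 * √k) * (√(x ⬝ᵥ x) * √(y ⬝ᵥ y)) := by
  have hn1 : (1 : ℝ) ≤ n := by exact_mod_cast hn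
  have hk1 : (1 : ℝ) ≤ k := by exact_mod_cast hk
  have hsk : 0 < √(k : ℝ) := Real.sqrt_pos.2 (by linarith)
  have hskm : √(k : ℝ) ≤ m := by
    have : √(k : ℝ) ^ 2 = k := Real.sq_sqrt (by linarith)
    nlinarith
  set v := Matrix.single s a (1 / (4 * n : ℝ)) *ᵥ y with hv
  have hvv : v ⬝ᵥ v ≤ (1 / (4 * n)) ^ 2 * (y ⬝ᵥ y) := by
    have h1 : y a * y a ≤ y ⬝ᵥ y :=
      Finset.single_le_sum (f := fun a => y a * y a) (fun a _ => mul_self_nonneg _)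
        (Finset.mem_univ a)
    have h2 : v ⬝ᵥ v = (1 / (4 * n)) ^ 2 * (y a * y a) := by
      rw [hv, single_mulVec]
      simp [dotProduct, Function.update_apply]
      ring
    rw [h2]
    gcongr
  have hxx := dotProduct_self_nonneg x
  have hyy := dotProduct_self_nonneg y
  have h1 : |U *ᵥ x ⬝ᵥ M *ᵥ v| ≤ 1 / 2 * (√(x ⬝ᵥ x) * √(y ⬝ᵥ y)) := by
    refine abs_le_of_sq_le_sq ?_ (by positivity)
    rw [mul_pow, mul_pow, Real.sq_sqrt hxx, Real.sq_sqrt hyy]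
    calc _ ≤ _ := dotProduct_sq_le _ _
      _ ≤ (2 * n * (x ⬝ᵥ x)) * ((1 / (4 * n)) ^ 2 * (y ⬝ᵥ y)) :=
        mul_le_mul (hU x) ((mulVec_dotProduct_self_le_of_isProj hM hMM v).trans hvv)
          (dotProduct_self_nonneg _) (by positivity)
      _ = 1 / (8 * n) * ((x ⬝ᵥ x) * (y ⬝ᵥ y)) := by field_simp; ring
      _ ≤ (1 / 2) ^ 2 * ((x ⬝ᵥ x) * (y ⬝ᵥ y)) := by
        gcongr
        rw [div_le_iff₀ (by positivity)]
        linarith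
  refine h1.trans (mul_le_mul_of_nonneg_right ?_ (by positivity))
  rw [div_le_div_iff₀ (by norm_num) (by positivity)]
  linarith

/-- **Quotient saturation (main theorem of [ST1], up to a logarithmic factor).**
There is `c > 0` such that if `√(n log n) ≤ m₀ ≤ n` and `k ≤ c m₀/√(n log n)`, then for
every `k`-dimensional normed space `W` there is an `n`-dimensional normed space `X` such
that every quotient of `X` of dimension at least `m₀` contains a `1`-complemented
subspace isometric to `W`. -/
theorem quotient_saturation :
    ∃ c : ℝ, 0 < c ∧
    ∀ n m₀ k : ℕ, 0 < n → 0 < m₀ → 0 < k →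
      Real.sqrt ((n : ℝ) * Real.log n) ≤ (m₀ : ℝ) → m₀ ≤ n →
      (k : ℝ) ≤ c * (m₀ : ℝ) / Real.sqrt ((n : ℝ) * Real.log n) →
    ∀ (W : Type) (_ : NormedAddCommGroup W) (_ : NormedSpace ℝ W),
      FiniteDimensional ℝ W → Module.finrank ℝ W = k →
    ∃ (X : Type) (_ : NormedAddCommGroup X) (_ : NormedSpace ℝ X),
      Module.finrank ℝ X = n ∧
      ∀ Z : Submodule ℝ X, m₀ ≤ Module.finrank ℝ (X ⧸ Z) →
        ∃ E : Submodule ℝ (X ⧸ Z), ComplementedIn 1 E ∧ IsometricTo W E := by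
  refine ⟨1 / 2 ^ 16, by norm_num, ?_⟩
  intro n m k hn hm hk hsqrt hmn hkc W _ _ _ hW
  have hk1 : (1 : ℝ) ≤ k := by exact_mod_cast hk
  have hn2 : 2 ≤ n := by
    by_contra! h
    obtain rfl : n = 1 := by omega
    simp only [Nat.cast_one, Real.log_one, mul_zero, Real.sqrt_zero, div_zero] at hkc
    linarith
  have hn2' : (2 : ℝ) ≤ n := by exact_mod_cast hn2
  have hlog : 1 / 2 ≤ Real.log n := by
    have := Real.log_le_log (by norm_num) hn2'
    have := Real.log_two_gt_d9
    linarith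
  set r := √((n : ℝ) * Real.log n) with hr
  have hr1 : 1 ≤ r := Real.one_le_sqrt.2 (by nlinarith)
  have hr2 : r ^ 2 = n * Real.log n := Real.sq_sqrt (by nlinarith)
  rw [le_div_iff₀ (by linarith)] at hkc
  have hkm : 2 ^ 16 * (k : ℝ) ≤ m := by nlinarith
  have hmk : 2 ^ 32 * (k ^ 2 * (n * Real.log n)) ≤ (m : ℝ) ^ 2 := by
    rw [← hr2]
    calc (2 : ℝ) ^ 32 * (k ^ 2 * r ^ 2) = (2 ^ 16 * (k * r)) ^ 2 := by ring
      _ ≤ (m : ℝ) ^ 2 := by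
        refine pow_le_pow_left₀ (by positivity) ?_ 2
        linarith
  obtain ⟨e, he⟩ := exists_linearEquiv_norm_sq_le hk hW
  obtain ⟨N, G, hG, hproj⟩ := exists_signMatrices hn2 hk hmn hkm hmk
  let V : Fin N ⊕ Fin n → Matrix (Fin n) (Fin k) ℝ :=
    Sum.elim (fun j => signMatrix (G j)) fun s => Matrix.single s ⟨0, hk⟩ (1 / (4 * n : ℝ))
  have h := exists_normed_space_of_span (fun i => (V i).mulVecLin ∘ₗ e.toLinearMap) m ?_ ?_
  · simpa only [Module.finrank_fin_fun] using h
  · rw [eq_top_iff, ← (Pi.basisFun ℝ (Fin n)).span_eq, Submodule.span_le]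
    rintro _ ⟨s, rfl⟩
    refine Submodule.mem_iSup_of_mem (Sum.inr s) ⟨e.symm (Pi.single ⟨0, hk⟩ (4 * n : ℝ)), ?_⟩
    have hn0 : (n : ℝ) ≠ 0 := by positivity
    ext t
    rcases eq_or_ne t s with rfl | hts
    · simp [V]
      field_simp
    · simp [V, hts, hts.symm]
  · intro Z hZ
    obtain ⟨M, hM, hMZ⟩ := exists_mem_projectionMatrices Z hZ
    obtain ⟨j, hj, hij⟩ := hproj M hM
    obtain ⟨T, hT0, hTj, hTV⟩ := exists_leftInverse_of_coercive hm hk e he M (signMatrix (G j))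
      fun x => by simpa only [dotProduct_signForm_mulVec] using hj x
    refine ⟨Sum.inl j, T, fun v hv => hT0 v (hMZ v hv), hTj, fun i w => ?_⟩
    rcases i with i | s
    · by_cases hi : i = j
      · subst hi
        exact (congrArg norm (hTj w)).le
      · exact hTV (signMatrix (G i)) (fun x y => by
          simpa only [dotProduct_signForm_mulVec] using hij i hi x y) w
    · exact hTV _ (abs_dotProduct_single_mulVec_le hn (by linarith) hk hM.1 hM.2.1 (hG j) s _) w
end
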